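/- Theorem 2 (local controllability of the control dynamical system): Let (x̂,û) be an admissible process for system (12). Assume there exists q = (h,v) ∈ K(x̂,û) such that Λ(x̂,û,q) = ∅. Then system (12) is locally controllable with respect to the process (x̂,û). Moreover, there exists a constant c₀ > 0 such that the functions x_y in the definition of local controllability can be chosen so that ‖x_y − x̂‖_{C([t₀,t₁],ℝ^n)} ≤ c₀|y|^{1/2}. -/

import Mathlib

section Part1

open Set Topology Filter Matrix MeasureTheory intervalIntegral

set_option linter.unusedSectionVars false

namespace ODEC

section volterra
variable {E : Type*} [NormedAddCommGroup E] [NormedSpace ℝ E] [CompleteSpace E]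
variable {t₀ t₁ : ℝ}

/-- The primitive of `ψ` as a continuous map on `[t₀,t₁]` (junk if not continuous). -/
noncomputable def prim (t₀ t₁ : ℝ) (ψ : ℝ → E) : C(Icc t₀ t₁, E) := by
  classical
  exact if h : Continuous (fun t : Icc t₀ t₁ => ∫ s in t₀..t, ψ s) then ⟨_, h⟩ else 0

lemma prim_apply {ψ : ℝ → E} (hψ : IntervalIntegrable ψ volume t₀ t₁) (t : Icc t₀ t₁) :
    prim t₀ t₁ ψ t = ∫ s in t₀..t, ψ s := by
  have h : Continuous (fun t : Icc t₀ t₁ => ∫ s in t₀..t, ψ s) := by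
    have hle : t₀ ≤ t₁ := t.2.1.trans t.2.2
    have := intervalIntegral.continuousOn_primitive_interval' hψ left_mem_uIcc
    rw [uIcc_of_le hle] at this
    exact continuousOn_iff_continuous_domRestrict.1 this
  unfold prim
  rw [dif_pos h]
  rfl

/-- bounded strongly measurable functions are interval integrable -/
lemma ii_of_bdd {F : Type*} [NormedAddCommGroup F] {ψ : ℝ → F} {a b M : ℝ} (hab : a ≤ b)
    (hm : StronglyMeasurable ψ)
    (hb : ∀ s ∈ Icc a b, ‖ψ s‖ ≤ M) : IntervalIntegrable ψ volume a b := by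
  rw [intervalIntegrable_iff_integrableOn_Icc_of_le hab]
  refine Measure.integrableOn_of_bounded (M := M) (by simp) hm.aestronglyMeasurable ?_
  exact (ae_restrict_iff' measurableSet_Icc).2 (Eventually.of_forall hb)

lemma ii_sub {F : Type*} [NormedAddCommGroup F] {ψ : ℝ → F} {t : ℝ}
    (h : IntervalIntegrable ψ volume t₀ t₁) (ht : t ∈ Icc t₀ t₁) :
    IntervalIntegrable ψ volume t₀ t := by
  refine h.mono_set ?_
  rw [uIcc_of_le ht.1, uIcc_of_le (ht.1.trans ht.2)]
  exact Icc_subset_Icc_right ht.2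

/-- The extension of a continuous map on `[t₀,t₁]` to `ℝ`. -/
noncomputable def ext (ht : t₀ ≤ t₁) (ξ : C(Icc t₀ t₁, E)) : ℝ → E := IccExtend ht ξ

lemma ext_cont (ht : t₀ ≤ t₁) (ξ : C(Icc t₀ t₁, E)) : Continuous (ext ht ξ) :=
  ξ.continuous.Icc_extend'

lemma ext_of_mem (ht : t₀ ≤ t₁) (ξ : C(Icc t₀ t₁, E)) {s : ℝ} (hs : s ∈ Icc t₀ t₁) :
    ext ht ξ s = ξ ⟨s, hs⟩ := IccExtend_of_mem ht _ hs

lemma norm_ext_le (ht : t₀ ≤ t₁) (ξ : C(Icc t₀ t₁, E)) (s : ℝ) : ‖ext ht ξ s‖ ≤ ‖ξ‖ :=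
  ξ.norm_coe_le_norm _

lemma sm_clm_apply {F G : Type*} [NormedAddCommGroup F] [NormedSpace ℝ F] [NormedAddCommGroup G]
    [NormedSpace ℝ G] {A : ℝ → F →L[ℝ] G} {b : ℝ → F} (hA : StronglyMeasurable A)
    (hb : StronglyMeasurable b) : StronglyMeasurable fun s => A s (b s) :=
  (isBoundedBilinearMap_apply (𝕜 := ℝ) (E := F) (F := G)).continuous.comp_stronglyMeasurable
    (hA.prodMk hb)

lemma neumann {X : Type*} [NormedAddCommGroup X] [NormedSpace ℝ X] [CompleteSpace X]
    (K : X →L[ℝ] X) (c : ℕ → ℝ) (hc : Summable c) (hK : ∀ k : ℕ, ‖K ^ k‖ ≤ c k) :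
    ∃ S : X →L[ℝ] X, ∀ η, S η - K (S η) = η := by
  have hsum : Summable (fun k : ℕ => K ^ k) := Summable.of_norm_bounded hc hK
  refine ⟨∑' k, K ^ k, fun η => ?_⟩
  have h5 := hsum.one_sub_mul_tsum_pow
  rw [sub_mul, one_mul] at h5
  exact DFunLike.congr_fun h5 η

set_option maxHeartbeats 400000 in
lemma volterra (ht : t₀ ≤ t₁) (A : ℝ → E →L[ℝ] E) (hA : StronglyMeasurable A) (L : ℝ)
    (hL : ∀ s ∈ Icc t₀ t₁, ‖A s‖ ≤ L) :
    ∃ K S : C(Icc t₀ t₁, E) →L[ℝ] C(Icc t₀ t₁, E),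
      (∀ ξ t, K ξ t = ∫ s in t₀..t, A s (ext ht ξ s)) ∧ (∀ η, S η - K (S η) = η) := by
  have hL0 : 0 ≤ L := (norm_nonneg _).trans (hL t₀ ⟨le_rfl, ht⟩)
  have hsm : ∀ ξ : C(Icc t₀ t₁, E), StronglyMeasurable fun s => A s (ext ht ξ s) := fun ξ =>
    sm_clm_apply hA (ext_cont ht ξ).stronglyMeasurable
  have hbd : ∀ ξ : C(Icc t₀ t₁, E), ∀ s ∈ Icc t₀ t₁, ‖A s (ext ht ξ s)‖ ≤ L * ‖ext ht ξ s‖ :=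
    fun ξ s hs => (A s).le_of_opNorm_le (hL s hs) _
  have hii : ∀ ξ : C(Icc t₀ t₁, E),
      IntervalIntegrable (fun s => A s (ext ht ξ s)) volume t₀ t₁ := fun ξ =>
    ii_of_bdd ht (hsm ξ) (M := L * ‖ξ‖) fun s hs => (hbd ξ s hs).trans (by
      gcongr; exact norm_ext_le ht ξ s)
  let K0 : C(Icc t₀ t₁, E) →ₗ[ℝ] C(Icc t₀ t₁, E) :=
    { toFun := fun ξ => prim t₀ t₁ fun s => A s (ext ht ξ s)
      map_add' := by
        intro ξ η
        ext1 t
        have e : (fun s => A s (ext ht (ξ + η) s)) = fun s => A s (ext ht ξ s) + A s (ext ht η s) := by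
          funext s
          rw [← map_add]; rfl
        rw [ContinuousMap.add_apply, prim_apply (hii _), prim_apply (hii _), prim_apply (hii _), e,
          intervalIntegral.integral_add (ii_sub (hii _) t.2) (ii_sub (hii _) t.2)]
      map_smul' := by
        intro c ξ
        ext1 t
        have e : (fun s => A s (ext ht (c • ξ) s)) = fun s => c • A s (ext ht ξ s) := by
          funext s
          rw [← map_smul]; rfl
        rw [RingHom.id_apply, ContinuousMap.smul_apply, prim_apply (hii _), prim_apply (hii _), e,
          intervalIntegral.integral_smul] }
  have hK0 : ∀ ξ t, K0 ξ t = ∫ s in t₀..t, A s (ext ht ξ s) := fun ξ t => prim_apply (hii ξ) t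
  have hK0n : ∀ ξ, ‖K0 ξ‖ ≤ (L * (t₁ - t₀)) * ‖ξ‖ := by
    intro ξ
    refine (ContinuousMap.norm_le _ (by have := sub_nonneg.2 ht; positivity)).2 fun t => ?_
    rw [hK0]
    have := intervalIntegral.norm_integral_le_of_norm_le_const (a := t₀) (b := t)
      (f := fun s => A s (ext ht ξ s)) (C := L * ‖ξ‖) (by
        intro s hs
        rw [uIoc_of_le t.2.1] at hs
        refine (hbd ξ s ⟨hs.1.le, hs.2.trans t.2.2⟩).trans ?_
        gcongr; exact norm_ext_le ht ξ s)
    refine this.trans ?_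
    rw [abs_of_nonneg (sub_nonneg.2 t.2.1)]
    have : (t : ℝ) - t₀ ≤ t₁ - t₀ := by linarith [t.2.2]
    calc L * ‖ξ‖ * (t - t₀) ≤ L * ‖ξ‖ * (t₁ - t₀) := by gcongr
      _ = _ := by ring
  obtain ⟨K, hK⟩ : ∃ K : C(Icc t₀ t₁, E) →L[ℝ] C(Icc t₀ t₁, E),
      ∀ ξ t, K ξ t = ∫ s in t₀..t, A s (ext ht ξ s) := ⟨K0.mkContinuous _ hK0n, hK0⟩
  clear hK0n hK0 K0
  have hpow : ∀ (k : ℕ) (ξ : C(Icc t₀ t₁, E)) (t : Icc t₀ t₁),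
      ‖(K ^ k) ξ t‖ ≤ (L * (t - t₀)) ^ k / k.factorial * ‖ξ‖ := by
    intro k ξ
    induction k with
    | zero => intro t; simpa using ξ.norm_coe_le_norm t
    | succ k ih =>
      intro t
      rw [pow_succ', mul_apply_eq_comp, hK]
      have h1 : ‖∫ s in t₀..t, A s (ext ht ((K ^ k) ξ) s)‖ ≤
          ∫ s in t₀..t, L * ((L * (s - t₀)) ^ k / k.factorial * ‖ξ‖) := by
        refine intervalIntegral.norm_integral_le_of_norm_le t.2.1 ?_ ?_
        · refine Eventually.of_forall fun s hs => ?_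
          have hs' : s ∈ Icc t₀ t₁ := ⟨hs.1.le, hs.2.trans t.2.2⟩
          refine (hbd _ s hs').trans ?_
          gcongr
          rw [ext_of_mem ht _ hs']
          exact ih ⟨s, hs'⟩
        · exact (by fun_prop : Continuous _).intervalIntegrable _ _
      refine h1.trans (le_of_eq ?_)
      have h2 : ∀ s, L * ((L * (s - t₀)) ^ k / k.factorial * ‖ξ‖) =
          (L ^ (k + 1) / k.factorial * ‖ξ‖) * (s - t₀) ^ k := by intro s; rw [mul_pow]; ring
      simp_rw [h2]
      rw [intervalIntegral.integral_const_mul, intervalIntegral.integral_comp_sub_right (fun s => s ^ k),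
        integral_pow, Nat.factorial_succ, mul_pow]
      have : (k.factorial : ℝ) ≠ 0 := by positivity
      push_cast
      simp
      field_simp
  have hnorm : ∀ k : ℕ, ‖K ^ k‖ ≤ (L * (t₁ - t₀)) ^ k / k.factorial := by
    intro k
    have h0 : 0 ≤ L * (t₁ - t₀) := mul_nonneg hL0 (sub_nonneg.2 ht)
    have h00 : 0 ≤ (L * (t₁ - t₀)) ^ k / k.factorial := by positivity
    refine ContinuousLinearMap.opNorm_le_bound _ h00 fun ξ => ?_
    refine (ContinuousMap.norm_le _ (mul_nonneg h00 (norm_nonneg _))).2 fun t => (hpow k ξ t).trans ?_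
    have h3 : 0 ≤ L * (t - t₀) := mul_nonneg hL0 (sub_nonneg.2 t.2.1)
    have h4 : L * (t - t₀) ≤ L * (t₁ - t₀) :=
      mul_le_mul_of_nonneg_left (sub_le_sub_right t.2.2 _) hL0
    refine mul_le_mul_of_nonneg_right ?_ (norm_nonneg ξ)
    exact div_le_div_of_nonneg_right (pow_le_pow_left₀ h3 h4 k) (by positivity)
  have hsum0 : Summable (fun k : ℕ => (L * (t₁ - t₀)) ^ k / k.factorial) :=
    Real.summable_pow_div_factorial (L * (t₁ - t₀))
  obtain ⟨S, hS⟩ := neumann K _ hsum0 hnorm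
  exact ⟨K, S, hK, hS⟩

end volterra

lemma by_parts {t₀ t₁ : ℝ} (ht : t₀ ≤ t₁) {p x B C : ℝ → ℝ} {p0 x0 : ℝ}
    (hB : IntervalIntegrable B volume t₀ t₁) (hC : IntervalIntegrable C volume t₀ t₁)
    (hp : ∀ t ∈ Icc t₀ t₁, p t = p0 + ∫ s in t₀..t, B s)
    (hx : ∀ t ∈ Icc t₀ t₁, x t = x0 + ∫ s in t₀..t, C s) :
    p t₁ * x t₁ - p t₀ * x t₀ = ∫ s in t₀..t₁, (B s * x s + p s * C s) := by
  have ac : ∀ (c : ℝ) (D : ℝ → ℝ), IntervalIntegrable D volume t₀ t₁ →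
      AbsolutelyContinuousOnInterval (fun t => c + ∫ s in t₀..t, D s) t₀ t₁ := by
    intro c D hD
    have h1 : AbsolutelyContinuousOnInterval (fun _ : ℝ => c) t₀ t₁ :=
      (LipschitzWith.const c).lipschitzOnWith.absolutelyContinuousOnInterval
    exact h1.add (hD.absolutelyContinuousOnInterval_intervalIntegral (c := t₀) (by simp))
  have key := (ac p0 B hB).integral_deriv_mul_eq_sub (ac x0 C hC)
  rw [← hp t₁ ⟨ht, le_rfl⟩, ← hx t₁ ⟨ht, le_rfl⟩, ← hp t₀ ⟨le_rfl, ht⟩, ← hx t₀ ⟨le_rfl, ht⟩] at key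
  rw [← key]
  refine intervalIntegral.integral_congr_ae ?_
  filter_upwards [hB.ae_hasDerivAt_integral, hC.ae_hasDerivAt_integral] with s h1 h2 hs
  have hs' : s ∈ uIcc t₀ t₁ := uIoc_subset_uIcc hs
  have hs'' : s ∈ Icc t₀ t₁ := by rwa [uIcc_of_le ht] at hs'
  rw [((h1 hs' t₀ (by simp)).const_add p0).deriv, ((h2 hs' t₀ (by simp)).const_add x0).deriv,
    hp s hs'', hx s hs'']

end ODEC

end Part1

section Part2

open Set Topology Filter Matrix MeasureTheory intervalIntegral
set_option linter.unusedSectionVars false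
set_option linter.unusedVariables false

namespace ODEC

/-- indicator of `[a,b)` evaluated at `x` -/
noncomputable def chi (a b x : ℝ) : ℝ := if a ≤ x ∧ x < b then 1 else 0

lemma quantile {t₀ t₁ : ℝ} (ht : t₀ < t₁) {P : Set ℝ} (hP : MeasurableSet P)
    (hPs : P ⊆ Ioc t₀ t₁) {a : ℝ} (ha : a ∈ Icc (0:ℝ) 1) :
    volume.real (P ∩ {s | volume.real (P ∩ Iic s) / volume.real P < a}) = a * volume.real P := by
  have hfin : volume P ≠ ⊤ := ((measure_mono hPs).trans_lt (by simp)).ne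
  have hfin' : ∀ S : Set ℝ, volume (P ∩ S) ≠ ⊤ := fun S =>
    ((measure_mono inter_subset_left).trans_lt hfin.lt_top).ne
  rcases eq_or_lt_of_le (measureReal_nonneg (μ := volume) (s := P)) with h0 | hV
  · rw [← h0, mul_zero]
    refine le_antisymm ?_ measureReal_nonneg
    rw [h0]
    exact measureReal_mono inter_subset_left hfin
  set V := volume.real P with hVdef
  let F : ℝ → ℝ := fun s => volume.real (P ∩ Iic s)
  have hmono : Monotone F := fun s s' h =>
    measureReal_mono (inter_subset_inter_right _ (Iic_subset_Iic.2 h)) (hfin' _)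
  have hstep : ∀ s s', s ≤ s' → F s' ≤ F s + (s' - s) := by
    intro s s' h
    have h1 : P ∩ Iic s' ⊆ (P ∩ Iic s) ∪ Ioc s s' := by
      rintro x ⟨hx, hx'⟩
      rcases le_or_gt x s with h2 | h2
      · exact Or.inl ⟨hx, h2⟩
      · exact Or.inr ⟨h2, hx'⟩
    calc F s' ≤ volume.real ((P ∩ Iic s) ∪ Ioc s s') :=
          measureReal_mono h1 (by
            refine (measure_union_lt_top (hfin' _).lt_top (by simp)).ne)
      _ ≤ F s + volume.real (Ioc s s') := measureReal_union_le _ _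
      _ = _ := by rw [Real.volume_real_Ioc_of_le h]
  have hcont : Continuous F := by
    have : LipschitzWith 1 F := by
      refine LipschitzWith.of_le_add fun x y => ?_
      rcases le_total x y with h | h
      · exact (hmono h).trans (le_add_of_nonneg_right dist_nonneg)
      · refine (hstep y x h).trans ?_
        rw [Real.dist_eq, abs_of_nonneg (sub_nonneg.2 h)]
    exact this.continuous
  have hF0 : F t₀ = 0 := by
    have : P ∩ Iic t₀ = ∅ := by
      ext x; simp only [mem_inter_iff, mem_Iic, mem_empty_iff_false, iff_false, not_and, not_le]
      exact fun hx => (hPs hx).1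
    simp [F, this]
  have hF1 : F t₁ = V := by
    have : P ∩ Iic t₁ = P := inter_eq_left.2 fun x hx => (hPs hx).2
    simp [F, this, hVdef]
  obtain ⟨σ₁, hσ₁, hFσ₁⟩ : a * V ∈ F '' Icc t₀ t₁ := by
    refine intermediate_value_Icc ht.le hcont.continuousOn ?_
    rw [hF0, hF1]
    exact ⟨mul_nonneg ha.1 hV.le, by nlinarith [ha.2]⟩
  let T : Set ℝ := {s | s ∈ Icc t₀ t₁ ∧ a * V ≤ F s}
  have hTc : IsClosed T := isClosed_Icc.inter (isClosed_le continuous_const hcont)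
  have hTn : T.Nonempty := ⟨σ₁, hσ₁, hFσ₁.ge⟩
  have hTb : BddBelow T := ⟨t₀, fun s hs => hs.1.1⟩
  have hσ := hTc.csInf_mem hTn hTb
  set σ := sInf T with hσdef
  have hσle : σ ≤ σ₁ := csInf_le hTb ⟨hσ₁, hFσ₁.ge⟩
  have hFσ : F σ = a * V := le_antisymm (by rw [← hFσ₁]; exact hmono hσle) hσ.2
  have hset : P ∩ {s | volume.real (P ∩ Iic s) / V < a} = P ∩ Iio σ := by
    ext s
    simp only [mem_inter_iff, mem_ofPred_eq, mem_Iio, and_congr_right_iff]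
    intro hs
    rw [div_lt_iff₀ hV]
    constructor
    · intro h
      by_contra hc
      have := hmono (not_lt.1 hc)
      rw [hFσ] at this
      exact absurd h (not_lt.2 this)
    · intro h
      by_contra hc
      have : σ ≤ s := csInf_le hTb ⟨Ioc_subset_Icc_self (hPs hs), not_lt.1 hc⟩
      linarith
  rw [hset, ← hFσ]
  refine measureReal_congr ?_
  exact (Filter.EventuallyEq.refl _ _).inter Iio_ae_eq_Iic

lemma exists_cells {E : Type*} [NormedAddCommGroup E] [NormedSpace ℝ E] [FiniteDimensional ℝ E]
    [MeasurableSpace E] [BorelSpace E]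
    {t₀ t₁ : ℝ} (ht : t₀ < t₁) (ψ : ℝ → E) (hψ : Measurable ψ) (M : ℝ)
    (hM : ∀ s ∈ Icc t₀ t₁, ‖ψ s‖ ≤ M) {κ : ℝ} (hκ : 0 < κ) :
    ∃ (N : ℕ) (c : ℝ → ℕ) (e : ℕ → ℝ × E), Measurable c ∧ (∀ s, c s < N) ∧
      ∀ s ∈ Icc t₀ t₁, |s - (e (c s)).1| < κ ∧ ‖ψ s - (e (c s)).2‖ < κ := by
  have hprop : ProperSpace E := FiniteDimensional.proper ℝ E
  have hcomp : IsCompact (Icc t₀ t₁ ×ˢ Metric.closedBall (0:E) M) :=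
    isCompact_Icc.prod (isCompact_closedBall _ _)
  obtain ⟨T, hTs, hTfin, hTcov⟩ := Metric.totallyBounded_iff.1 hcomp.totallyBounded κ hκ |>.imp
    fun T h => (⟨trivial, h.1, h.2⟩ : True ∧ _ ∧ _)
  classical
  let l := hTfin.toFinset.toList
  let e : ℕ → ℝ × E := fun k => l.getD k 0
  let N := l.length
  have hcov : ∀ s ∈ Icc t₀ t₁, ∃ k ≤ N, dist (s, ψ s) (e k) < κ := by
    intro s hs
    have : (s, ψ s) ∈ Icc t₀ t₁ ×ˢ Metric.closedBall (0:E) M :=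
      ⟨hs, by simpa using hM s hs⟩
    obtain ⟨y, hy, hy'⟩ := mem_iUnion₂.1 (hTcov this)
    have hyl : y ∈ l := by simp [l, hy]
    obtain ⟨k, hk, rfl⟩ := List.getElem_of_mem hyl
    refine ⟨k, hk.le, ?_⟩
    have : e k = l[k] := List.getD_eq_getElem _ _ hk
    rw [this]; exact hy'
  refine ⟨N + 1, fun s => SimpleFunc.nearestPtInd e N (s, ψ s), e, ?_, ?_, ?_⟩
  · exact (SimpleFunc.measurable _).comp (measurable_id.prodMk hψ)
  · intro s
    exact Nat.lt_succ_of_le (SimpleFunc.nearestPtInd_le e N _)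
  · intro s hs
    obtain ⟨k, hk, hd⟩ := hcov s hs
    have h1 := SimpleFunc.edist_nearestPt_le e (s, ψ s) hk
    have h2 : dist (e (SimpleFunc.nearestPtInd e N (s, ψ s))) (s, ψ s) < κ := by
      rw [edist_dist, edist_dist, ENNReal.ofReal_le_ofReal_iff dist_nonneg] at h1
      refine lt_of_le_of_lt h1 ?_
      rwa [dist_comm]
    rw [dist_comm, Prod.dist_eq, max_lt_iff] at h2
    exact ⟨by simpa [Real.dist_eq] using h2.1, by simpa [dist_eq_norm] using h2.2⟩

end ODEC

end Part2

section Part3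

open Set Topology Filter Matrix MeasureTheory intervalIntegral
set_option linter.unusedSectionVars false

namespace ODEC

lemma chi_nonneg (a b x : ℝ) : 0 ≤ chi a b x := by unfold chi; split_ifs <;> norm_num
lemma chi_le_one (a b x : ℝ) : chi a b x ≤ 1 := by unfold chi; split_ifs <;> norm_num
lemma chi_eq_ind (a b x : ℝ) : chi a b x = (Ico a b).indicator (fun _ => (1:ℝ)) x := by
  by_cases hx : a ≤ x ∧ x < b <;> simp [chi, indicator, mem_Ico, hx]
lemma measurable_chi (a b : ℝ) : Measurable (chi a b) := by
  have : chi a b = (Ico a b).indicator (fun _ => (1:ℝ)) := funext fun x => chi_eq_ind a b x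
  rw [this]
  exact measurable_const.indicator measurableSet_Ico

lemma meas_family (F : ℕ → ℝ → ℝ) (hF : ∀ k, Measurable (F k)) {c : ℝ → ℕ} (hc : Measurable c) :
    Measurable fun s => F (c s) s := by
  have h1 : Measurable (fun x : ℕ × ℝ => F x.1 x.2) :=
    measurable_from_prod_countable_right hF
  exact h1.comp (hc.prodMk measurable_id)

set_option maxHeartbeats 1000000 in
lemma mix {E : Type} [NormedAddCommGroup E] [NormedSpace ℝ E] [FiniteDimensional ℝ E]
    [MeasurableSpace E] [BorelSpace E]
    {t₀ t₁ : ℝ} (ht : t₀ < t₁) (ψ : ℝ → E) (hψ : Measurable ψ) (M : ℝ)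
    (hM : ∀ s ∈ Icc t₀ t₁, ‖ψ s‖ ≤ M) {κ : ℝ} (hκ : 0 < κ) :
    ∃ m : ℝ → ℝ, Measurable m ∧ ∀ a b : ℝ, 0 ≤ a → a ≤ b → b ≤ 1 →
      (∫ s in t₀..t₁, chi a b (m s)) = (b - a) * (t₁ - t₀) ∧
      ∀ t ∈ Icc t₀ t₁, ‖(∫ s in t₀..t, chi a b (m s) • ψ s) - (b - a) • ∫ s in t₀..t, ψ s‖
        ≤ κ * (b - a) := by
  have hM0 : 0 ≤ M := (norm_nonneg _).trans (hM t₀ ⟨le_rfl, ht.le⟩)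
  have hT : 0 < t₁ - t₀ := sub_pos.2 ht
  obtain ⟨κ', hκ'0, hκ'1, hκ'2⟩ : ∃ κ' : ℝ, 0 < κ' ∧ κ' ≤ 1 ∧
      κ' * (2 * (t₁ - t₀) + 8 * (M + 1)) ≤ κ := by
    have hD : 0 < 2 * (t₁ - t₀) + 8 * (M + 1) := by positivity
    refine ⟨min 1 (κ / (2 * (t₁ - t₀) + 8 * (M + 1))), by positivity, min_le_left _ _, ?_⟩
    rw [← le_div_iff₀ hD]
    exact min_le_right _ _
  obtain ⟨N, c, e, hc, hcN, hcell⟩ := exists_cells ht ψ hψ M hM hκ'0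
  let P : ℕ → Set ℝ := fun k => Ioc t₀ t₁ ∩ c ⁻¹' {k}
  have hP : ∀ k, MeasurableSet (P k) := fun k => measurableSet_Ioc.inter (hc (measurableSet_singleton k))
  have hPs : ∀ k, P k ⊆ Ioc t₀ t₁ := fun k => inter_subset_left
  have hPfin : ∀ k (S : Set ℝ), volume (P k ∩ S) ≠ ⊤ := fun k S =>
    ((measure_mono (inter_subset_left.trans (hPs k))).trans_lt (by simp)).ne
  let F : ℕ → ℝ → ℝ := fun k s => volume.real (P k ∩ Iic s)
  have hFm : ∀ k, Measurable (F k) := fun k => by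
    refine Monotone.measurable fun s s' h => ?_
    exact measureReal_mono (inter_subset_inter_right _ (Iic_subset_Iic.2 h)) (hPfin _ _)
  let m : ℝ → ℝ := fun s => F (c s) s / volume.real (P (c s))
  have hm : Measurable m := by
    exact meas_family (fun k s => F k s / volume.real (P k)) (fun k => (hFm k).div_const _) hc
  refine ⟨m, hm, fun a b ha hab hb => ?_⟩
  have hba : 0 ≤ b - a := sub_nonneg.2 hab
  let χ : ℝ → ℝ := fun s => chi a b (m s)
  have hχm : Measurable χ := (measurable_chi a b).comp hm
  have hχi : ∀ S : Set ℝ, volume S ≠ ⊤ → IntegrableOn χ S := fun S hS =>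
    Measure.integrableOn_of_bounded (M := 1) hS hχm.aestronglyMeasurable
      (Eventually.of_forall fun s => by
        rw [Real.norm_eq_abs, abs_of_nonneg (chi_nonneg _ _ _)]; exact chi_le_one _ _ _)
  have hPfin1 : ∀ k, volume (P k) ≠ ⊤ := fun k => by simpa using hPfin k univ
  -- the key quantile property on each cell
  have hq : ∀ k, ∫ s in P k, χ s = (b - a) * volume.real (P k) := by
    intro k
    let Q : ℝ → Set ℝ := fun x => P k ∩ {s | F k s / volume.real (P k) < x}
    have hQm : ∀ x, MeasurableSet (Q x) := fun x =>
      (hP k).inter (measurableSet_lt ((hFm k).div_const _) measurable_const)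
    have hQ : ∀ x ∈ Icc (0:ℝ) 1, volume.real (Q x) = x * volume.real (P k) := fun x hx =>
      quantile ht (hP k) (hPs k) hx
    have hsub : Q a ⊆ Q b := fun s hs => ⟨hs.1, lt_of_lt_of_le hs.2 hab⟩
    have h1 : ∫ s in P k, χ s = ∫ s in P k, (Q b \ Q a).indicator (fun _ => (1:ℝ)) s := by
      refine setIntegral_congr_fun (hP k) fun s hs => ?_
      have hcs : c s = k := hs.2
      have hms : m s = F k s / volume.real (P k) := by simp [m, hcs]
      have h2 : s ∈ Q b \ Q a ↔ a ≤ m s ∧ m s < b := by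
        rw [hms]
        simp only [Q, Set.mem_sdiff, mem_inter_iff, hs, true_and, mem_ofPred_eq, not_lt]
        exact and_comm
      simp only [χ, chi, indicator]
      by_cases h3 : a ≤ m s ∧ m s < b
      · rw [if_pos h3, if_pos (h2.2 h3)]
      · rw [if_neg h3, if_neg (fun h => h3 (h2.1 h))]
    rw [h1, setIntegral_indicator ((hQm b).diff (hQm a))]
    have h4 : P k ∩ (Q b \ Q a) = Q b \ Q a := inter_eq_right.2 fun s hs => hs.1.1
    rw [h4, setIntegral_const, smul_eq_mul, mul_one, measureReal_sdiff hsub (hQm a) (hPfin k _),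
      hQ b ⟨ha.trans hab, hb⟩, hQ a ⟨ha, hab.trans hb⟩]
    ring
  have hdisj : ∀ S : Set ℝ, Set.PairwiseDisjoint (↑(Finset.range N) : Set ℕ) (fun k => P k ∩ S) := by
    intro S i _ j _ hij
    refine Set.disjoint_left.2 fun s hs hs' => hij ?_
    have h1 : c s = i := hs.1.2
    have h2 : c s = j := hs'.1.2
    exact h1.symm.trans h2
  have hunion : ∀ S : Set ℝ, (⋃ k ∈ Finset.range N, P k ∩ S) = Ioc t₀ t₁ ∩ S := by
    intro S
    ext s
    simp only [mem_iUnion, Finset.mem_range]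
    constructor
    · rintro ⟨k, hk, h⟩; exact ⟨h.1.1, h.2⟩
    · rintro ⟨h1, h2⟩; exact ⟨c s, hcN s, ⟨h1, rfl⟩, h2⟩
  have hsumint : ∀ {G : Type} [NormedAddCommGroup G] [NormedSpace ℝ G] (S : Set ℝ) (w : ℝ → G),
      MeasurableSet S → IntegrableOn w (Ioc t₀ t₁) →
      ∫ s in Ioc t₀ t₁ ∩ S, w s = ∑ k ∈ Finset.range N, ∫ s in P k ∩ S, w s := by
    intro G _ _ S w hS hw
    rw [← hunion S]
    exact integral_biUnion_finset _ (fun k _ => (hP k).inter hS) (hdisj S)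
      (fun k _ => hw.mono_set (inter_subset_left.trans (hPs k)))
  have hsumvol : ∀ S : Set ℝ, MeasurableSet S →
      ∑ k ∈ Finset.range N, volume.real (P k ∩ S) = volume.real (Ioc t₀ t₁ ∩ S) := by
    intro S hS
    have := hsumint S (fun _ => (1:ℝ)) hS (integrableOn_const (by simp))
    simp only [setIntegral_const, smul_eq_mul, mul_one] at this
    exact this.symm
  have hvolT : ∑ k ∈ Finset.range N, volume.real (P k) = t₁ - t₀ := by
    have := hsumvol univ MeasurableSet.univ
    simpa [Real.volume_real_Ioc_of_le ht.le] using this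
  constructor
  · rw [intervalIntegral.integral_of_le ht.le]
    have := hsumint univ χ MeasurableSet.univ (hχi _ (by simp))
    simp only [inter_univ] at this
    rw [this, Finset.sum_congr rfl fun k _ => hq k, ← Finset.mul_sum, hvolT]
  intro t htt
  have hψi : IntegrableOn ψ (Ioc t₀ t₁) := by
    refine Measure.integrableOn_of_bounded (M := M) (by simp)
      hψ.aestronglyMeasurable ?_
    exact (ae_restrict_iff' measurableSet_Ioc).2
      (Eventually.of_forall fun s hs => hM s (Ioc_subset_Icc_self hs))
  let θ : ℝ → ℝ := fun s => χ s - (b - a)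
  have hθm : Measurable θ := hχm.sub_const _
  have hθabs : ∀ s, |θ s| ≤ χ s + (b - a) := fun s => by
    have := chi_nonneg a b (m s)
    simp only [θ, χ]
    rw [abs_le]; constructor <;> linarith
  have hθi : ∀ S : Set ℝ, volume S ≠ ⊤ → IntegrableOn θ S := fun S hS =>
    (hχi S hS).sub (integrableOn_const hS)
  have hχψi : IntegrableOn (fun s => χ s • ψ s) (Ioc t₀ t₁) := by
    refine Measure.integrableOn_of_bounded (M := M) (by simp)
      (hχm.smul hψ).aestronglyMeasurable ?_
    refine (ae_restrict_iff' measurableSet_Ioc).2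
      (Eventually.of_forall fun s hs => ?_)
    rw [norm_smul, Real.norm_eq_abs, abs_of_nonneg (chi_nonneg _ _ _)]
    have := hM s (Ioc_subset_Icc_self hs)
    have h1 := chi_le_one a b (m s)
    have h2 := chi_nonneg a b (m s)
    calc chi a b (m s) * ‖ψ s‖ ≤ 1 * M := by gcongr
      _ = M := one_mul _
  have hθψi : IntegrableOn (fun s => θ s • ψ s) (Ioc t₀ t₁) := by
    have := hχψi.sub (hψi.smul (b - a))
    refine this.congr_fun (fun s _ => ?_) measurableSet_Ioc
    simp [θ, sub_smul]
  have hIoct : Ioc t₀ t₁ ∩ Iic t = Ioc t₀ t := by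
    ext s; simp only [mem_inter_iff, mem_Ioc, mem_Iic]
    exact ⟨fun h => ⟨h.1.1, h.2⟩, fun h => ⟨⟨h.1, h.2.trans htt.2⟩, h.2⟩⟩
  have hmain : (∫ s in t₀..t, chi a b (m s) • ψ s) - (b - a) • ∫ s in t₀..t, ψ s =
      ∑ k ∈ Finset.range N, ∫ s in P k ∩ Iic t, θ s • ψ s := by
    rw [← hsumint (Iic t) _ measurableSet_Iic hθψi, hIoct, intervalIntegral.integral_of_le htt.1,
      intervalIntegral.integral_of_le htt.1, ← MeasureTheory.integral_smul, ← MeasureTheory.integral_sub]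
    · refine integral_congr_ae (Eventually.of_forall fun s => ?_)
      simp [θ, χ, sub_smul]
    · exact hχψi.mono_set (Ioc_subset_Ioc_right htt.2)
    · exact (hψi.mono_set (Ioc_subset_Ioc_right htt.2)).smul _
  rw [hmain]
  let W : Set ℝ := Icc (t - 2 * κ') (t + 2 * κ')
  have habsP : ∀ k (S : Set ℝ), MeasurableSet S →
      ∫ s in P k ∩ S, |θ s| ≤ 2 * (b - a) * volume.real (P k) := by
    intro k S hS
    calc ∫ s in P k ∩ S, |θ s| ≤ ∫ s in P k, |θ s| :=
          setIntegral_mono_set (hθi _ (hPfin1 k)).abs (Eventually.of_forall fun s => abs_nonneg _)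
            (Eventually.of_forall inter_subset_left)
      _ ≤ ∫ s in P k, (χ s + (b - a)) :=
          integral_mono (hθi _ (hPfin1 k)).abs ((hχi _ (hPfin1 k)).add (integrableOn_const (hPfin1 k)))
            hθabs
      _ = 2 * (b - a) * volume.real (P k) := by
          rw [integral_add (hχi _ (hPfin1 k)) (integrableOn_const (hPfin1 k)), hq, setIntegral_const,
            smul_eq_mul]
          ring
  have hδ : ∀ k, |∫ s in P k ∩ Iic t, θ s| ≤ 2 * (b - a) * volume.real (P k ∩ W) := by
    intro k
    by_cases h1 : P k ⊆ Iic t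
    · have h2 : ∫ s in P k ∩ Iic t, θ s = 0 := by
        rw [inter_eq_left.2 h1, integral_sub (hχi _ (hPfin1 k)) (integrableOn_const (hPfin1 k)), hq,
          setIntegral_const, smul_eq_mul]
        ring
      rw [h2, abs_zero]
      positivity
    by_cases h2 : P k ∩ Iic t = ∅
    · rw [h2]; simp; positivity
    obtain ⟨x, hx, hxt⟩ := not_subset.1 h1
    obtain ⟨y, hy, hyt⟩ := nonempty_iff_ne_empty.2 h2
    have h3 : P k ⊆ W := by
      intro s hs
      have hs1 := (hcell s (Ioc_subset_Icc_self hs.1)).1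
      have hx1 := (hcell x (Ioc_subset_Icc_self hx.1)).1
      have hy1 := (hcell y (Ioc_subset_Icc_self hy.1)).1
      have e1 : c s = k := hs.2
      have e2 : c x = k := hx.2
      have e3 : c y = k := hy.2
      rw [e1, abs_lt] at hs1
      rw [e2, abs_lt] at hx1
      rw [e3, abs_lt] at hy1
      have h4 : t < x := not_le.1 hxt
      have h5 : y ≤ t := hyt
      constructor <;> linarith
    rw [inter_eq_left.2 h3]
    exact (MeasureTheory.abs_integral_le_integral_abs).trans (habsP k _ measurableSet_Iic)
  have hk : ∀ k ∈ Finset.range N, ‖∫ s in P k ∩ Iic t, θ s • ψ s‖ ≤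
      κ' * (2 * (b - a) * volume.real (P k)) +
        2 * (b - a) * volume.real (P k ∩ W) * (M + 1) := by
    intro k _
    rcases (P k).eq_empty_or_nonempty with h0 | ⟨x, hx⟩
    · rw [h0]; simp
    have hek : ‖(e k).2‖ ≤ M + 1 := by
      have hx1 := (hcell x (Ioc_subset_Icc_self hx.1)).2
      have e2 : c x = k := hx.2
      rw [e2] at hx1
      have := norm_sub_norm_le (e k).2 (ψ x)
      rw [norm_sub_rev] at this
      linarith [hM x (Ioc_subset_Icc_self hx.1)]
    have hint1 : IntegrableOn (fun s => θ s • ψ s) (P k ∩ Iic t) :=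
      hθψi.mono_set (inter_subset_left.trans (hPs k))
    have hint2 : IntegrableOn (fun s => θ s • (e k).2) (P k ∩ Iic t) :=
      (hθi _ (hPfin k _)).smul_const _
    have hsplit : ∫ s in P k ∩ Iic t, θ s • ψ s =
        (∫ s in P k ∩ Iic t, θ s • (ψ s - (e k).2)) + (∫ s in P k ∩ Iic t, θ s) • (e k).2 := by
      rw [← _root_.integral_smul_const, ← MeasureTheory.integral_add]
      · refine integral_congr_ae (Eventually.of_forall fun s => ?_)
        simp [smul_sub]
      · refine (hint1.sub hint2).congr_fun (fun s _ => ?_) ((hP k).inter measurableSet_Iic)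
        simp [smul_sub]
      · exact hint2
    rw [hsplit]
    refine (norm_add_le _ _).trans (add_le_add ?_ ?_)
    · calc ‖∫ s in P k ∩ Iic t, θ s • (ψ s - (e k).2)‖
          ≤ ∫ s in P k ∩ Iic t, |θ s| * κ' := by
            refine norm_integral_le_of_norm_le ((hθi _ (hPfin k _)).abs.mul_const _) ?_
            refine (ae_restrict_iff' ((hP k).inter measurableSet_Iic)).2
              (Eventually.of_forall fun s hs => ?_)
            have hs1 := (hcell s (Ioc_subset_Icc_self hs.1.1)).2
            have e1 : c s = k := hs.1.2
            rw [e1] at hs1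
            rw [norm_smul, Real.norm_eq_abs]
            gcongr
        _ = κ' * ∫ s in P k ∩ Iic t, |θ s| := by rw [MeasureTheory.integral_mul_const, mul_comm]
        _ ≤ _ := by gcongr; exact habsP k _ measurableSet_Iic
    · rw [norm_smul, Real.norm_eq_abs]
      exact mul_le_mul (hδ k) hek (norm_nonneg _) (by positivity)
  calc ‖∑ k ∈ Finset.range N, ∫ s in P k ∩ Iic t, θ s • ψ s‖
      ≤ ∑ k ∈ Finset.range N, (κ' * (2 * (b - a) * volume.real (P k)) +
        2 * (b - a) * volume.real (P k ∩ W) * (M + 1)) := norm_sum_le_of_le _ hk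
    _ = κ' * (2 * (b - a) * (t₁ - t₀)) + 2 * (b - a) * volume.real (Ioc t₀ t₁ ∩ W) * (M + 1) := by
        rw [Finset.sum_add_distrib, ← Finset.mul_sum, ← Finset.mul_sum, hvolT, ← Finset.sum_mul,
          ← Finset.mul_sum, hsumvol W measurableSet_Icc]
    _ ≤ κ' * (2 * (b - a) * (t₁ - t₀)) + 2 * (b - a) * (4 * κ') * (M + 1) := by
        have : volume.real (Ioc t₀ t₁ ∩ W) ≤ 4 * κ' := by
          refine (measureReal_mono inter_subset_right (by simp [W])).trans ?_
          rw [Real.volume_real_Icc_of_le (by linarith)]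
          linarith
        gcongr
    _ = (κ' * (2 * (t₁ - t₀) + 8 * (M + 1))) * (b - a) := by ring
    _ ≤ κ * (b - a) := by gcongr

end ODEC

end Part3

section Part4

open Set Topology Filter MeasureTheory
set_option linter.unusedSectionVars false
set_option linter.unusedVariables false

namespace ODEC

section cone
variable {V : Type} [NormedAddCommGroup V] [NormedSpace ℝ V] [FiniteDimensional ℝ V]

lemma cone_convex (C : Submodule NNReal V) : Convex ℝ (C : Set V) := by
  intro x hx y hy a b ha hb _
  exact C.add_mem (C.smul_mem ⟨a, ha⟩ hx) (C.smul_mem ⟨b, hb⟩ hy)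

lemma cone_sep (C : Submodule NNReal V) (w : V) (hw : w ∉ interior (C : Set V)) :
    ∃ l : V →L[ℝ] ℝ, l ≠ 0 ∧ (∀ c ∈ C, 0 ≤ l c) ∧ l w ≤ 0 := by
  have hC := cone_convex C
  rcases (interior (C : Set V)).eq_empty_or_nonempty with he | hne
  · have h1 : affineSpan ℝ (C : Set V) ≠ ⊤ := by
      intro h
      have := hC.interior_nonempty_iff_affineSpan_eq_top.2 h
      rw [he] at this
      exact not_nonempty_empty this
    have h2 : Submodule.span ℝ (C : Set V) < ⊤ := by
      refine lt_of_le_of_ne le_top fun h => h1 ?_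
      rw [AffineSubspace.affineSpan_eq_top_iff_vectorSpan_eq_top_of_nonempty ℝ V V ⟨0, C.zero_mem⟩,
        vectorSpan_eq_span_vsub_set_right ℝ (show (0:V) ∈ (C : Set V) from C.zero_mem)]
      simpa using h
    obtain ⟨l, hl, hl2⟩ := Submodule.exists_le_ker_of_lt_top _ h2
    have hl3 : ∀ c ∈ C, l c = 0 := fun c hc => hl2 (Submodule.subset_span hc)
    let l' : V →L[ℝ] ℝ := LinearMap.toContinuousLinearMap l
    have hl' : l' ≠ 0 := by
      intro h; apply hl; ext x
      exact DFunLike.congr_fun h x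
    rcases le_total (l w) 0 with h | h
    · exact ⟨l', hl', fun c hc => (hl3 c hc).ge, h⟩
    · refine ⟨-l', neg_ne_zero.2 hl', fun c hc => ?_, ?_⟩
      · show 0 ≤ -(l c)
        rw [hl3 c hc, neg_zero]
      · show -(l w) ≤ 0
        linarith
  · obtain ⟨f, hf⟩ := geometric_hahn_banach_open_point hC.interior isOpen_interior hw
    have hcl : ∀ c ∈ C, f c ≤ f w := by
      intro c hc
      have h1 : c ∈ closure (interior (C : Set V)) := by
        rw [hC.closure_interior_eq_closure_of_nonempty_interior hne]
        exact subset_closure hc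
      have h2 : IsClosed {x | f x ≤ f w} := isClosed_le f.continuous continuous_const
      exact closure_minimal (fun x hx => (hf x hx).le) h2 h1
    refine ⟨-f, ?_, fun c hc => ?_, ?_⟩
    · intro h
      obtain ⟨x, hx⟩ := hne
      have h1 := hf x hx
      have h2 : ∀ y, f y = 0 := fun y => by
        have := DFunLike.congr_fun h y
        simpa using this
      rw [h2, h2] at h1
      exact lt_irrefl _ h1
    · show 0 ≤ -(f c)
      by_contra hneg
      have hpos : 0 < f c := by linarith
      have h3 : 0 ≤ (|f w| + 1) / f c := by positivity
      have h1 : f (((|f w| + 1) / f c) • c) ≤ f w :=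
        hcl _ (C.smul_mem (⟨(|f w| + 1) / f c, h3⟩ : NNReal) hc)
      rw [map_smul, smul_eq_mul, div_mul_cancel₀ _ hpos.ne'] at h1
      linarith [le_abs_self (f w)]
    · show -(f w) ≤ 0
      have := hcl 0 C.zero_mem
      rw [map_zero] at this
      linarith

lemma cone_param0 (D : Set V) (w : V)
    (hw : w ∈ interior (Submodule.span NNReal D : Set V)) :
    ∃ (ι : Type) (_ : Fintype ι) (d : ι → V) (β : ι → ℝ) (A : V →L[ℝ] (ι → ℝ)) (ρ : ℝ), 0 < ρ ∧
      (∀ i, d i ∈ D) ∧ (∀ z, ∑ i, (β i + A z i) • d i = w + z) ∧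
      ∀ z, ‖z‖ ≤ ρ → ∀ i, 0 ≤ β i + A z i := by
  have hle : (Submodule.span NNReal D : Set V) ⊆ Submodule.span ℝ D := by
    intro x hx
    refine Submodule.span_induction (p := fun x _ => x ∈ Submodule.span ℝ D)
      (fun x hx => Submodule.subset_span hx) (Submodule.zero_mem _)
      (fun x y _ _ hx hy => Submodule.add_mem _ hx hy)
      (fun a x _ hx => ?_) hx
    rw [NNReal.smul_def]
    exact Submodule.smul_mem _ _ hx
  have htop : Submodule.span ℝ D = ⊤ :=
    Submodule.eq_top_of_nonempty_interior' _ ⟨w, interior_mono hle hw⟩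
  obtain ⟨b, hbD, hbs, hbl⟩ := exists_linearIndependent ℝ D
  let B : Module.Basis b ℝ V := Module.Basis.mk hbl (by
    rw [Subtype.range_coe, hbs, htop])
  have hBa : ∀ i : b, B i = (i : V) := fun i => by simp [B]
  have : Finite b := Module.Finite.finite_basis B
  have : Fintype b := Fintype.ofFinite b
  obtain ⟨δ, hδ, hmem⟩ : ∃ δ > (0:ℝ), w - δ • ∑ i, B i ∈ Submodule.span NNReal D := by
    have hc : Continuous fun δ : ℝ => w - δ • ∑ i, B i := by fun_prop
    have h1 : (fun δ : ℝ => w - δ • ∑ i, B i) ⁻¹' interior (Submodule.span NNReal D : Set V) ∈ 𝓝 (0:ℝ) := by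
      refine hc.continuousAt.preimage_mem_nhds (isOpen_interior.mem_nhds ?_)
      simpa using hw
    obtain ⟨ε, hε, hball⟩ := Metric.mem_nhds_iff.1 h1
    refine ⟨ε / 2, by positivity, interior_subset (hball ?_)⟩
    rw [Metric.mem_ball, Real.dist_eq, sub_zero, abs_of_pos (by positivity)]
    linarith
  obtain ⟨k, γ, d', hd'⟩ := (Submodule.mem_span_set' (R := NNReal)).1 hmem
  let A0 : V →ₗ[ℝ] (b ⊕ Fin k → ℝ) :=
    { toFun := fun z => Sum.elim (fun i => B.repr z i) 0
      map_add' := by intro x y; funext i; rcases i with i | i <;> simp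
      map_smul' := by intro x y; funext i; rcases i with i | i <;> simp }
  let A : V →L[ℝ] (b ⊕ Fin k → ℝ) := LinearMap.toContinuousLinearMap A0
  have hAl : ∀ z i, A z (Sum.inl i) = B.repr z i := fun z i => rfl
  have hAr : ∀ z i, A z (Sum.inr i) = 0 := fun z i => rfl
  refine ⟨b ⊕ Fin k, inferInstance, Sum.elim (fun i => (i : V)) (fun j => (d' j : V)),
    Sum.elim (fun _ => δ) (fun j => (γ j : ℝ)), A, δ / (‖A‖ + 1), by positivity, ?_, ?_, ?_⟩
  · rintro (i | j)
    · exact hbD i.2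
    · exact (d' j).2
  · intro z
    rw [Fintype.sum_sum_type]
    simp only [Sum.elim_inl, Sum.elim_inr, hAl, hAr, add_zero, add_smul, Finset.sum_add_distrib]
    have h1 : ∑ i, B.repr z i • (i : V) = z := by
      have := B.sum_repr z
      simp only [hBa] at this
      exact this
    have h2 : ∑ j, (γ j : ℝ) • (d' j : V) = w - δ • ∑ i, B i := hd'
    rw [h1, h2, ← Finset.smul_sum]
    simp only [hBa]
    abel
  · intro z hz i
    rcases i with i | i
    · simp only [Sum.elim_inl]
      have h1 : |A z (Sum.inl i)| ≤ δ := by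
        calc |A z (Sum.inl i)| ≤ ‖A z‖ := norm_le_pi_norm (A z) _
          _ ≤ ‖A‖ * ‖z‖ := A.le_opNorm z
          _ ≤ (‖A‖ + 1) * (δ / (‖A‖ + 1)) := by gcongr; linarith
          _ = δ := by field_simp
      linarith [neg_abs_le (A z (Sum.inl i))]
    · simp only [Sum.elim_inr, hAr, add_zero]
      exact (γ i).2

lemma cone_param (D : Set V) (w : V)
    (hw : w ∈ interior (Submodule.span NNReal D : Set V)) :
    ∃ (k : ℕ) (d : Fin k → V) (β : Fin k → ℝ) (A : V →L[ℝ] (Fin k → ℝ)) (ρ : ℝ), 0 < ρ ∧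
      (∀ i, d i ∈ D) ∧ (∀ z, ∑ i, (β i + A z i) • d i = w + z) ∧
      ∀ z, ‖z‖ ≤ ρ → ∀ i, 0 ≤ β i + A z i := by
  obtain ⟨ι, _, d, β, A, ρ, hρ, hd, hs, hp⟩ := cone_param0 D w hw
  let e := Fintype.equivFin ι
  let R : (ι → ℝ) →L[ℝ] (Fin (Fintype.card ι) → ℝ) :=
    LinearMap.toContinuousLinearMap (LinearMap.funLeft ℝ ℝ e.symm)
  have hR : ∀ a i, R a i = a (e.symm i) := fun a i => rfl
  refine ⟨Fintype.card ι, d ∘ e.symm, β ∘ e.symm, R.comp A, ρ, hρ, fun i => hd _, fun z => ?_,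
    fun z hz i => hp z hz _⟩
  rw [← hs z, ← e.symm.sum_comp]
  rfl

end cone
end ODEC

end Part4

section Part5

open Set Topology Filter MeasureTheory
open scoped Matrix
set_option linter.unusedSectionVars false
set_option linter.unusedVariables false

namespace ODEC

section adj
variable {n : ℕ}

/-- transpose -/
noncomputable def tr : ((Fin n → ℝ) →L[ℝ] (Fin n → ℝ)) →L[ℝ] ((Fin n → ℝ) →L[ℝ] (Fin n → ℝ)) :=
  LinearMap.toContinuousLinearMap
    { toFun := fun B => LinearMap.toContinuousLinearMap
        { toFun := fun x => fun i => x ⬝ᵥ B (Pi.single i 1)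
          map_add' := by intro x y; funext i; simp [add_dotProduct]
          map_smul' := by intro c x; funext i; simp [smul_dotProduct] }
      map_add' := by intro B C; ext x i; simp
      map_smul' := by intro c B; ext x i; simp }

lemma tr_apply (B : (Fin n → ℝ) →L[ℝ] (Fin n → ℝ)) (x : Fin n → ℝ) :
    tr B x = fun i => x ⬝ᵥ B (Pi.single i 1) := rfl

lemma clm_eq_sum {F : Type*} [NormedAddCommGroup F] [NormedSpace ℝ F] (B : (Fin n → ℝ) →L[ℝ] F)
    (x : Fin n → ℝ) : B x = ∑ i, x i • B (Pi.single i 1) := by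
  conv_lhs => rw [pi_eq_sum_univ' x]
  simp [map_sum]

lemma tr_dot (B : (Fin n → ℝ) →L[ℝ] (Fin n → ℝ)) (p x : Fin n → ℝ) :
    tr B p ⬝ᵥ x = p ⬝ᵥ B x := by
  rw [clm_eq_sum B x, dotProduct_sum, tr_apply, dotProduct]
  refine Finset.sum_congr rfl fun i _ => ?_
  rw [dotProduct_smul, smul_eq_mul, mul_comm]

lemma exists_adjoint {t₀ t₁ : ℝ} (ht : t₀ < t₁) (A : ℝ → (Fin n → ℝ) →L[ℝ] (Fin n → ℝ))
    (hA : StronglyMeasurable A) (L : ℝ) (hL : ∀ s ∈ Icc t₀ t₁, ‖A s‖ ≤ L) (pT : Fin n → ℝ) :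
    ∃ p : ℝ → Fin n → ℝ, Continuous p ∧ p t₁ = pT ∧
      IntervalIntegrable (fun s => tr (A s) (p s)) volume t₀ t₁ ∧
      ∀ t ∈ Icc t₀ t₁, p t = p t₀ - ∫ s in t₀..t, tr (A s) (p s) := by
  have hsub : Measurable fun σ : ℝ => t₀ + t₁ - σ := by fun_prop
  have hsm : StronglyMeasurable fun σ => tr (A (t₀ + t₁ - σ)) :=
    tr.continuous.comp_stronglyMeasurable (hA.comp_measurable hsub)
  have hmem : ∀ σ ∈ Icc t₀ t₁, t₀ + t₁ - σ ∈ Icc t₀ t₁ := fun σ h =>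
    ⟨by linarith [h.2], by linarith [h.1]⟩
  obtain ⟨K, S, hK, hS⟩ := volterra ht.le (fun σ => tr (A (t₀ + t₁ - σ))) hsm
    (‖(tr : _ →L[ℝ] ((Fin n → ℝ) →L[ℝ] (Fin n → ℝ)))‖ * L) (fun s hs => by
      refine (ContinuousLinearMap.le_opNorm _ _).trans ?_
      gcongr
      exact hL _ (hmem s hs))
  let q := S (ContinuousMap.const _ pT)
  have hq : ∀ t : Icc t₀ t₁, q t = pT + ∫ s in t₀..t, tr (A (t₀ + t₁ - s)) (ext ht.le q s) := by
    intro t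
    have := DFunLike.congr_fun (hS (ContinuousMap.const _ pT)) t
    rw [ContinuousMap.sub_apply, hK] at this
    rw [← sub_eq_iff_eq_add]
    exact this
  let p : ℝ → Fin n → ℝ := fun t => ext ht.le q (t₀ + t₁ - t)
  have hp : Continuous p := (ext_cont ht.le q).comp (by fun_prop)
  have hpi : IntervalIntegrable (fun s => tr (A s) (p s)) volume t₀ t₁ := by
    refine ii_of_bdd ht.le (sm_clm_apply (tr.continuous.comp_stronglyMeasurable hA)
      hp.stronglyMeasurable) (M := ‖(tr : _ →L[ℝ] ((Fin n → ℝ) →L[ℝ] (Fin n → ℝ)))‖ * L * ‖q‖) fun s hs => ?_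
    refine (ContinuousLinearMap.le_opNorm _ _).trans ?_
    refine mul_le_mul ?_ (norm_ext_le _ _ _) (norm_nonneg _) ?_
    · refine (ContinuousLinearMap.le_opNorm _ _).trans ?_
      gcongr
      exact hL _ hs
    · have := (norm_nonneg _).trans (hL _ hs)
      exact mul_nonneg (ContinuousLinearMap.opNorm_nonneg _) this
  have hpt : ∀ t ∈ Icc t₀ t₁, p t = pT + ∫ s in t..t₁, tr (A s) (p s) := by
    intro t htt
    have h1 : p t = q ⟨t₀ + t₁ - t, hmem t htt⟩ := ext_of_mem ht.le q (hmem t htt)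
    rw [h1, hq]
    congr 1
    have := intervalIntegral.integral_comp_sub_left (a := t) (b := t₁)
      (fun σ => tr (A (t₀ + t₁ - σ)) (ext ht.le q σ)) (t₀ + t₁)
    simp only [add_sub_cancel_right, sub_sub_cancel] at this
    exact this.symm
  have e0 := hpt t₀ ⟨le_rfl, ht.le⟩
  refine ⟨p, hp, ?_, hpi, fun t htt => ?_⟩
  · rw [hpt t₁ ⟨ht.le, le_rfl⟩, intervalIntegral.integral_same, add_zero]
  · have h2 := intervalIntegral.integral_add_adjacent_intervals (ii_sub hpi htt)
      (hpi.mono_set (by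
        rw [uIcc_of_le htt.2, uIcc_of_le ht.le]; exact Icc_subset_Icc_left htt.1))
    rw [hpt t htt, e0, ← h2]
    abel

lemma duality {t₀ t₁ : ℝ} (ht : t₀ < t₁) (A : ℝ → (Fin n → ℝ) →L[ℝ] (Fin n → ℝ))
    (p x ψ : ℝ → Fin n → ℝ) (a : Fin n → ℝ)
    (hpi : IntervalIntegrable (fun s => tr (A s) (p s)) volume t₀ t₁)
    (hp : ∀ t ∈ Icc t₀ t₁, p t = p t₀ - ∫ s in t₀..t, tr (A s) (p s))
    (hxi : IntervalIntegrable (fun s => A s (x s) + ψ s) volume t₀ t₁)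
    (hx : ∀ t ∈ Icc t₀ t₁, x t = a + ∫ s in t₀..t, (A s (x s) + ψ s))
    (hpc : Continuous p) (hxc : Continuous x) :
    p t₁ ⬝ᵥ x t₁ - p t₀ ⬝ᵥ a = ∫ s in t₀..t₁, p s ⬝ᵥ ψ s := by
  have hcomp : ∀ {w : ℝ → Fin n → ℝ} {b : ℝ}, IntervalIntegrable w volume t₀ b → ∀ i,
      (∫ s in t₀..b, w s) i = ∫ s in t₀..b, w s i := by
    intro w b hw i
    exact ((ContinuousLinearMap.proj (R := ℝ) (φ := fun _ : Fin n => ℝ) i).intervalIntegral_comp_comm hw).symm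
  have hci : ∀ {w : ℝ → Fin n → ℝ}, IntervalIntegrable w volume t₀ t₁ → ∀ i,
      IntervalIntegrable (fun s => w s i) volume t₀ t₁ := by
    intro w hw i
    have := (intervalIntegrable_iff_integrableOn_Ioc_of_le ht.le).1 hw
    rw [intervalIntegrable_iff_integrableOn_Ioc_of_le ht.le]
    exact (ContinuousLinearMap.proj (R := ℝ) (φ := fun _ : Fin n => ℝ) i).integrable_comp this
  have h1 : ∀ i, p t₁ i * x t₁ i - p t₀ i * x t₀ i =
      ∫ s in t₀..t₁, ((-(tr (A s) (p s) i)) * x s i + p s i * (A s (x s) + ψ s) i) := by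
    intro i
    refine by_parts (p := fun s => p s i) (x := fun s => x s i) (B := fun s => -(tr (A s) (p s) i))
      (C := fun s => (A s (x s) + ψ s) i) ht.le (p0 := p t₀ i) (x0 := a i) (hci hpi i).neg (hci hxi i) ?_ ?_
    · intro t htt
      rw [hp t htt]
      simp only [Pi.sub_apply]
      rw [hcomp (ii_sub hpi htt), intervalIntegral.integral_neg, sub_eq_add_neg]
    · intro t htt
      rw [hx t htt]
      simp only [Pi.add_apply]
      rw [hcomp (ii_sub hxi htt)]
      rfl
  have hx0 : x t₀ = a := by
    rw [hx t₀ ⟨le_rfl, ht.le⟩, intervalIntegral.integral_same, add_zero]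
  calc p t₁ ⬝ᵥ x t₁ - p t₀ ⬝ᵥ a = ∑ i, (p t₁ i * x t₁ i - p t₀ i * x t₀ i) := by
        rw [hx0, Finset.sum_sub_distrib]; rfl
    _ = ∫ s in t₀..t₁, ∑ i, ((-(tr (A s) (p s) i)) * x s i + p s i * (A s (x s) + ψ s) i) := by
        rw [intervalIntegral.integral_finsetSum]
        · exact Finset.sum_congr rfl fun i _ => h1 i
        · intro i _
          refine IntervalIntegrable.add ?_ ?_
          · exact (hci hpi i).neg.mul_continuousOn ((continuous_apply i).comp hxc).continuousOn
          · exact (hci hxi i).continuousOn_mul ((continuous_apply i).comp hpc).continuousOn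
    _ = ∫ s in t₀..t₁, p s ⬝ᵥ ψ s := by
        refine intervalIntegral.integral_congr fun s _ => ?_
        have h3 := tr_dot (A s) (p s) (x s)
        simp only [neg_mul, Finset.sum_add_distrib, Finset.sum_neg_distrib]
        change -(tr (A s) (p s) ⬝ᵥ x s) + p s ⬝ᵥ (A s (x s) + ψ s) = _
        rw [h3, dotProduct_add]
        ring

/-- endpoints -/
noncomputable def ends {t₀ t₁ : ℝ} (ht : t₀ ≤ t₁) :
    C(Icc t₀ t₁, Fin n → ℝ) →L[ℝ] (Fin n → ℝ) × (Fin n → ℝ) :=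
  (ContinuousMap.evalCLM ℝ (⟨t₀, le_rfl, ht⟩ : Icc t₀ t₁)).prod
    (ContinuousMap.evalCLM ℝ (⟨t₁, ht, le_rfl⟩ : Icc t₀ t₁))

lemma ends_apply {t₀ t₁ : ℝ} (ht : t₀ ≤ t₁) (ξ : C(Icc t₀ t₁, Fin n → ℝ)) :
    ends ht ξ = (ξ ⟨t₀, le_rfl, ht⟩, ξ ⟨t₁, ht, le_rfl⟩) := rfl

end adj

end ODEC

end Part5

section Part6

open Set Topology Filter MeasureTheory
open scoped Matrix
set_option linter.unusedSectionVars false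
set_option linter.unusedVariables false

namespace ODEC

section sep
variable {n r m₁ m₂ : ℕ}

/-- generator set -/
def gens {t₀ t₁ : ℝ} (ht : t₀ ≤ t₁) (U : Set (Fin r → ℝ))
    (S : C(Icc t₀ t₁, Fin n → ℝ) →L[ℝ] C(Icc t₀ t₁, Fin n → ℝ))
    (Φ : ℝ → (Fin r → ℝ) → Fin n → ℝ) (φh : ℝ → Fin n → ℝ)
    (f' : (Fin n → ℝ) × (Fin n → ℝ) →L[ℝ] (Fin m₁ → ℝ))
    (g' : (Fin n → ℝ) × (Fin n → ℝ) →L[ℝ] (Fin m₂ → ℝ)) (fh : Fin m₁ → ℝ) :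
    Set ((Fin m₁ → ℝ) × (Fin m₂ → ℝ)) :=
  {d | ∃ u ∈ U, ∃ E : Set ℝ, MeasurableSet E ∧ ∃ (a : Fin n → ℝ) (s : Fin m₁ → ℝ),
    (∀ i, fh i = 0 → 0 ≤ s i) ∧
    d = (f' (ends ht (S (ContinuousMap.const _ a + prim t₀ t₁ (E.indicator fun s => Φ s u - φh s)))) + s,
      g' (ends ht (S (ContinuousMap.const _ a + prim t₀ t₁ (E.indicator fun s => Φ s u - φh s)))))}

lemma functional_repr (l : (Fin m₁ → ℝ) × (Fin m₂ → ℝ) →L[ℝ] ℝ) :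
    ∃ (l₁ : Fin m₁ → ℝ) (l₂ : Fin m₂ → ℝ), ∀ x y, l (x, y) = l₁ ⬝ᵥ x + l₂ ⬝ᵥ y := by
  refine ⟨fun i => l (Pi.single i 1, 0), fun i => l (0, Pi.single i 1), fun x y => ?_⟩
  have h1 : l (x, y) = l.comp (ContinuousLinearMap.inl ℝ _ _) x +
      l.comp (ContinuousLinearMap.inr ℝ _ _) y := by
    simp [← map_add]
  rw [h1, clm_eq_sum _ x, clm_eq_sum _ y]
  simp [dotProduct, mul_comm]

lemma indicator_sm {w : ℝ → Fin n → ℝ} (hw : StronglyMeasurable w) {E : Set ℝ} (hE : MeasurableSet E) :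
    StronglyMeasurable (E.indicator w) := hw.indicator hE

lemma ae_nonpos {t₀ t₁ : ℝ} (ht : t₀ < t₁) {w : ℝ → ℝ} (hw : Measurable w) {M : ℝ}
    (hM : ∀ s ∈ Icc t₀ t₁, |w s| ≤ M)
    (hE : ∀ E : Set ℝ, MeasurableSet E → ∫ s in t₀..t₁, E.indicator w s ≤ 0) :
    ∀ᵐ t ∂(volume.restrict (Icc t₀ t₁)), w t ≤ 0 := by
  let E : Set ℝ := {s | 0 ≤ w s}
  have hEm : MeasurableSet E := measurableSet_le measurable_const hw
  have h0 : ∀ s, 0 ≤ E.indicator w s := fun s => indicator_nonneg (fun s hs => hs) s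
  have hi : IntegrableOn (E.indicator w) (Icc t₀ t₁) := by
    rw [← intervalIntegrable_iff_integrableOn_Icc_of_le ht.le]
    refine ii_of_bdd ht.le (hw.indicator hEm).stronglyMeasurable (M := M) fun s hs => ?_
    exact (norm_indicator_le_norm_self _ _).trans (hM s hs)
  have h1 := hE E hEm
  rw [intervalIntegral.integral_of_le ht.le, ← integral_Icc_eq_integral_Ioc] at h1
  have h2 : ∫ s in Icc t₀ t₁, E.indicator w s = 0 := le_antisymm h1 (integral_nonneg h0)
  have h3 := (integral_eq_zero_iff_of_nonneg h0 hi).1 h2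
  filter_upwards [h3] with s hs
  by_contra hc
  have h4 : s ∈ E := (not_le.1 hc).le
  rw [indicator_of_mem h4] at hs
  exact hc hs.le

theorem separation {t₀ t₁ : ℝ} (ht : t₀ < t₁) (U : Set (Fin r → ℝ)) (hUne : U.Nonempty)
    (A : ℝ → (Fin n → ℝ) →L[ℝ] (Fin n → ℝ)) (hA : StronglyMeasurable A) (L : ℝ)
    (hL : ∀ s ∈ Icc t₀ t₁, ‖A s‖ ≤ L)
    (K S : C(Icc t₀ t₁, Fin n → ℝ) →L[ℝ] C(Icc t₀ t₁, Fin n → ℝ))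
    (hK : ∀ ξ t, K ξ t = ∫ s in t₀..t, A s (ext ht.le ξ s)) (hS : ∀ η, S η - K (S η) = η)
    (Φ : ℝ → (Fin r → ℝ) → Fin n → ℝ) (hΦ : ∀ s, ContinuousOn (Φ s) U)
    (hΦm : ∀ u ∈ U, StronglyMeasurable fun s => Φ s u)
    (hΦb : ∀ u ∈ U, ∃ M, ∀ s ∈ Icc t₀ t₁, ‖Φ s u‖ ≤ M)
    (φh : ℝ → Fin n → ℝ) (hφh : StronglyMeasurable φh) (Mφ : ℝ) (hφb : ∀ s ∈ Icc t₀ t₁, ‖φh s‖ ≤ Mφ)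
    (Q : ℝ → Fin n → ℝ) (hQ : StronglyMeasurable Q) (MQ : ℝ) (hQb : ∀ s ∈ Icc t₀ t₁, ‖Q s‖ ≤ MQ)
    (f' : (Fin n → ℝ) × (Fin n → ℝ) →L[ℝ] (Fin m₁ → ℝ))
    (g' : (Fin n → ℝ) × (Fin n → ℝ) →L[ℝ] (Fin m₂ → ℝ)) (fh : Fin m₁ → ℝ)
    (bf : Fin m₁ → ℝ) (bg : Fin m₂ → ℝ)
    (hΛ : ¬ ∃ (p : ℝ → Fin n → ℝ) (l₁ : Fin m₁ → ℝ) (l₂ : Fin m₂ → ℝ),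
      (∀ i, 0 ≤ l₁ i) ∧ (l₁ ≠ 0 ∨ l₂ ≠ 0) ∧ Continuous p ∧
      IntervalIntegrable (fun s => (fun i => p s ⬝ᵥ A s (Pi.single i 1))) volume t₀ t₁ ∧
      (∀ t ∈ Icc t₀ t₁, p t = p t₀ - ∫ s in t₀..t, (fun i => p s ⬝ᵥ A s (Pi.single i 1))) ∧
      p t₀ = (fun i => l₁ ⬝ᵥ f' (Pi.single i 1, 0) + l₂ ⬝ᵥ g' (Pi.single i 1, 0)) ∧
      p t₁ = (fun i => -(l₁ ⬝ᵥ f' (0, Pi.single i 1)) - l₂ ⬝ᵥ g' (0, Pi.single i 1)) ∧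
      (∀ᵐ t ∂(volume.restrict (Icc t₀ t₁)), ∀ u ∈ U, p t ⬝ᵥ Φ t u ≤ p t ⬝ᵥ φh t) ∧
      l₁ ⬝ᵥ fh = 0 ∧
      0 ≤ -(∫ t in t₀..t₁, p t ⬝ᵥ Q t) + l₁ ⬝ᵥ bf + l₂ ⬝ᵥ bg) :
    -(((1/2:ℝ) • bf + f' (ends ht.le (S (prim t₀ t₁ fun s => (1/2:ℝ) • Q s))),
       (1/2:ℝ) • bg + g' (ends ht.le (S (prim t₀ t₁ fun s => (1/2:ℝ) • Q s)))) :
        (Fin m₁ → ℝ) × (Fin m₂ → ℝ)) ∈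
      interior (Submodule.span NNReal (gens ht.le U S Φ φh f' g' fh) : Set ((Fin m₁ → ℝ) × (Fin m₂ → ℝ))) := by
  by_contra hcon
  obtain ⟨l, hl0, hlC, hlw⟩ := cone_sep _ _ hcon
  obtain ⟨l₁, l₂, hl⟩ := functional_repr l
  let P0 : Fin n → ℝ := fun i => l₁ ⬝ᵥ f' (Pi.single i 1, 0) + l₂ ⬝ᵥ g' (Pi.single i 1, 0)
  let P1 : Fin n → ℝ := fun i => -(l₁ ⬝ᵥ f' (0, Pi.single i 1)) - l₂ ⬝ᵥ g' (0, Pi.single i 1)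
  have hP : ∀ x y : Fin n → ℝ, l (f' (x, y), g' (x, y)) = P0 ⬝ᵥ x - P1 ⬝ᵥ y := by
    intro x y
    have h1 : l (f' (x, y), g' (x, y)) =
        (l.comp (f'.prod g')).comp (ContinuousLinearMap.inl ℝ _ _) x +
        (l.comp (f'.prod g')).comp (ContinuousLinearMap.inr ℝ _ _) y := by
      have h2 : ((x, y) : (Fin n → ℝ) × (Fin n → ℝ)) = (x, 0) + (0, y) := by simp
      have h3 : l (f' (x, y), g' (x, y)) = (l.comp (f'.prod g')) (x, y) := rfl
      rw [h3, h2, map_add]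
      rfl
    rw [h1, clm_eq_sum _ x, clm_eq_sum _ y]
    simp only [ContinuousLinearMap.comp_apply, ContinuousLinearMap.prod_apply, hl, P0, P1, dotProduct,
      smul_eq_mul, ContinuousLinearMap.inl_apply, ContinuousLinearMap.inr_apply]
    rw [sub_eq_add_neg, ← Finset.sum_neg_distrib]
    congr 1 <;> refine Finset.sum_congr rfl fun i _ => ?_
    · ring
    · ring
  obtain ⟨p, hpc, hpT, hpi, hp⟩ := exists_adjoint ht A hA L hL P1
  have hdual : ∀ (a : Fin n → ℝ) (ψ : ℝ → Fin n → ℝ), StronglyMeasurable ψ →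
      (∃ M, ∀ s ∈ Icc t₀ t₁, ‖ψ s‖ ≤ M) →
      l (f' (ends ht.le (S (ContinuousMap.const _ a + prim t₀ t₁ ψ))),
         g' (ends ht.le (S (ContinuousMap.const _ a + prim t₀ t₁ ψ)))) =
        (P0 - p t₀) ⬝ᵥ a - ∫ s in t₀..t₁, p s ⬝ᵥ ψ s := by
    rintro a ψ hψ ⟨M, hM⟩
    set ξ := S (ContinuousMap.const _ a + prim t₀ t₁ ψ) with hξ
    have hψi : IntervalIntegrable ψ volume t₀ t₁ := ii_of_bdd ht.le hψ hM
    have hAi : IntervalIntegrable (fun s => A s (ext ht.le ξ s)) volume t₀ t₁ := by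
      refine ii_of_bdd ht.le (sm_clm_apply hA (ext_cont ht.le ξ).stronglyMeasurable)
        (M := L * ‖ξ‖) fun s hs => ?_
      exact (ContinuousLinearMap.le_of_opNorm_le_of_le _ (hL s hs) (norm_ext_le _ _ _))
    have hx : ∀ t ∈ Icc t₀ t₁, ext ht.le ξ t = a + ∫ s in t₀..t, (A s (ext ht.le ξ s) + ψ s) := by
      intro t htt
      have h1 := DFunLike.congr_fun (hS (ContinuousMap.const _ a + prim t₀ t₁ ψ)) ⟨t, htt⟩
      rw [← hξ, ContinuousMap.sub_apply, hK, ContinuousMap.add_apply, prim_apply hψi] at h1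
      rw [ext_of_mem _ _ htt, intervalIntegral.integral_add (ii_sub hAi htt) (ii_sub hψi htt)]
      rw [sub_eq_iff_eq_add] at h1
      rw [h1]
      show a + _ + _ = _
      abel
    have hd := duality ht A p (ext ht.le ξ) ψ a hpi hp (hAi.add hψi) hx hpc (ext_cont _ _)
    have e0 : ξ ⟨t₀, le_rfl, ht.le⟩ = a := by
      rw [← ext_of_mem ht.le ξ ⟨le_rfl, ht.le⟩, hx t₀ ⟨le_rfl, ht.le⟩,
        intervalIntegral.integral_same, add_zero]
    have e1 : ext ht.le ξ t₁ = ξ ⟨t₁, ht.le, le_rfl⟩ := ext_of_mem ht.le ξ ⟨ht.le, le_rfl⟩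
    rw [e1, hpT] at hd
    rw [ends_apply, hP, e0, ← hd, sub_dotProduct]
    ring
  obtain ⟨u₀, hu₀⟩ := hUne
  have hgen : ∀ u ∈ U, ∀ E : Set ℝ, MeasurableSet E → ∀ (a : Fin n → ℝ) (s : Fin m₁ → ℝ),
      (∀ i, fh i = 0 → 0 ≤ s i) →
      0 ≤ (P0 - p t₀) ⬝ᵥ a - (∫ t in t₀..t₁, p t ⬝ᵥ (E.indicator (fun s => Φ s u - φh s) t)) + l₁ ⬝ᵥ s := by
    intro u hu E hE a s hs
    have h1 := hlC _ (Submodule.subset_span (show _ ∈ gens ht.le U S Φ φh f' g' fh from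
      ⟨u, hu, E, hE, a, s, hs, rfl⟩))
    obtain ⟨Mu, hMu⟩ := hΦb u hu
    have h2 := hdual a (E.indicator fun s => Φ s u - φh s)
      (((hΦm u hu).sub hφh).indicator hE) ⟨Mu + Mφ, fun s hs => by
        refine (norm_indicator_le_norm_self _ _).trans ((norm_sub_le _ _).trans ?_)
        exact add_le_add (hMu s hs) (hφb s hs)⟩
    rw [← h2]
    rw [hl] at h1 ⊢
    rw [dotProduct_add] at h1
    linarith
  have hgen0 : ∀ (a : Fin n → ℝ) (s : Fin m₁ → ℝ), (∀ i, fh i = 0 → 0 ≤ s i) →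
      0 ≤ (P0 - p t₀) ⬝ᵥ a + l₁ ⬝ᵥ s := by
    intro a s hs
    have := hgen u₀ hu₀ ∅ MeasurableSet.empty a s hs
    simpa using this
  have hp0 : p t₀ = P0 := by
    have h1 := hgen0 (-(P0 - p t₀)) 0 (fun _ _ => le_rfl)
    simp only [dotProduct_zero, add_zero, dotProduct_neg] at h1
    have h2 : (P0 - p t₀) ⬝ᵥ (P0 - p t₀) = 0 := by
      refine le_antisymm (by linarith) ?_
      exact Finset.sum_nonneg fun i _ => mul_self_nonneg _
    exact (sub_eq_zero.1 (dotProduct_self_eq_zero.1 h2)).symm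
  have hl1 : ∀ i, 0 ≤ l₁ i := by
    intro i
    have := hgen0 0 (Pi.single i 1) (fun j _ => by
      rcases eq_or_ne j i with rfl | hj
      · simp
      · simp [hj])
    simpa using this
  have hl1' : ∀ i, fh i ≠ 0 → l₁ i = 0 := by
    intro i hi
    have := hgen0 0 (-Pi.single i 1) (fun j hj => by
      have : j ≠ i := fun h => hi (h ▸ hj)
      simp [this])
    simp at this
    exact le_antisymm this (hl1 i)
  refine hΛ ⟨p, l₁, l₂, hl1, ?_, hpc, hpi, hp, hp0, hpT, ?_, ?_, ?_⟩
  · by_contra hc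
    push Not at hc
    apply hl0
    ext x
    · have := hl x 0
      rw [hc.1, hc.2] at this
      simpa using this
    · have := hl 0 x
      rw [hc.1, hc.2] at this
      simpa using this
  · -- maximum condition
    have hmax : ∀ u ∈ U, ∀ᵐ t ∂(volume.restrict (Icc t₀ t₁)), p t ⬝ᵥ (Φ t u - φh t) ≤ 0 := by
      intro u hu
      obtain ⟨Mu, hMu⟩ := hΦb u hu
      obtain ⟨Mp, hMp⟩ := isCompact_Icc.exists_bound_of_continuousOn (s := Icc t₀ t₁) hpc.continuousOn
      have hm : Measurable fun t => p t ⬝ᵥ (Φ t u - φh t) := by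
        have h1 := ((hΦm u hu).sub hφh).measurable
        have h2 := hpc.measurable
        refine Finset.measurable_sum _ fun i _ => ?_
        exact ((measurable_pi_apply i).comp h2).mul ((measurable_pi_apply i).comp h1)
      refine ae_nonpos ht hm (M := n * (Mp * (Mu + Mφ))) ?_ ?_
      · intro s hs
        have h1 : ∀ i ∈ (Finset.univ : Finset (Fin n)), |p s i * (Φ s u - φh s) i| ≤ Mp * (Mu + Mφ) := by
          intro i _
          rw [abs_mul]
          have h3 : |p s i| ≤ Mp := (norm_le_pi_norm (p s) i).trans (hMp s hs)
          have h4 : |(Φ s u - φh s) i| ≤ Mu + Mφ := (norm_le_pi_norm (Φ s u - φh s) i).trans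
            ((norm_sub_le _ _).trans (add_le_add (hMu s hs) (hφb s hs)))
          exact mul_le_mul h3 h4 (abs_nonneg _) ((abs_nonneg _).trans h3)
        refine (Finset.abs_sum_le_sum_abs _ _).trans ((Finset.sum_le_sum h1).trans ?_)
        simp
      · intro E hE
        have h1 := hgen u hu E hE 0 0 (fun _ _ => le_rfl)
        simp only [dotProduct_zero, zero_sub, add_zero] at h1
        have h2 : ∀ t, E.indicator (fun t => p t ⬝ᵥ (Φ t u - φh t)) t =
            p t ⬝ᵥ (E.indicator (fun s => Φ s u - φh s) t) := by
          intro t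
          by_cases h : t ∈ E <;> simp [h]
        simp_rw [h2]
        linarith
    obtain ⟨T, hTc, hTd⟩ := TopologicalSpace.exists_countable_dense U
    have hall : ∀ᵐ t ∂(volume.restrict (Icc t₀ t₁)), ∀ u ∈ T, p t ⬝ᵥ (Φ t u - φh t) ≤ 0 :=
      (ae_ball_iff hTc).2 fun u _ => hmax u u.2
    filter_upwards [hall] with t htall u hu
    have hcont : Continuous fun u : U => p t ⬝ᵥ (Φ t u - φh t) := by
      have := continuousOn_iff_continuous_domRestrict.1 (hΦ t)
      exact continuous_const.dotProduct (this.sub continuous_const)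
    have hcl : IsClosed {u : U | p t ⬝ᵥ (Φ t u - φh t) ≤ 0} := isClosed_le hcont continuous_const
    have h2 := closure_minimal (fun u hu => htall u hu) hcl (hTd ⟨u, hu⟩)
    have h3 : p t ⬝ᵥ (Φ t u - φh t) ≤ 0 := h2
    rw [dotProduct_sub] at h3
    linarith
  · refine Finset.sum_eq_zero fun i _ => ?_
    by_cases h : fh i = 0
    · rw [h, mul_zero]
    · rw [hl1' i h, zero_mul]
  · have h1 := hdual 0 (fun s => (1/2:ℝ) • Q s) (hQ.const_smul (1/2:ℝ) :) ⟨(1/2:ℝ) * MQ, fun s hs => by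
      rw [norm_smul]; simp only [Real.norm_eq_abs, abs_of_pos (by norm_num : (0:ℝ) < 1/2)]
      exact mul_le_mul_of_nonneg_left (hQb s hs) (by norm_num)⟩
    have h0 : (ContinuousMap.const (Icc t₀ t₁) (0 : Fin n → ℝ)) = 0 := rfl
    rw [h0, zero_add] at h1
    simp only [dotProduct_zero, zero_sub, dotProduct_smul, smul_eq_mul,
      intervalIntegral.integral_const_mul] at h1
    rw [map_neg, hl, dotProduct_add, dotProduct_add, dotProduct_smul, dotProduct_smul] at hlw
    rw [hl] at h1
    simp only [smul_eq_mul] at hlw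
    linarith

end sep
end ODEC

end Part6

section Part7

open Set Topology Filter MeasureTheory
set_option linter.unusedSectionVars false
set_option linter.unusedVariables false

namespace ODEC

lemma chi_sub {a b c : ℝ} (hab : a ≤ b) (hbc : b ≤ c) (x : ℝ) :
    chi a c x - chi a b x = chi b c x := by
  unfold chi
  by_cases h1 : a ≤ x <;> by_cases h2 : x < c <;> by_cases h3 : x < b <;> by_cases h4 : b ≤ x <;>
    simp [h1, h2, h3, h4] <;> linarith

lemma surj_quant {X Y : Type*} [NormedAddCommGroup X] [NormedSpace ℝ X] [CompleteSpace X]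
    [NormedAddCommGroup Y] [NormedSpace ℝ Y] (L : X →L[ℝ] Y) (RI : Y →L[ℝ] X)
    (hRI : ∀ y, L (RI y) = y) :
    ∃ c > (0:ℝ), ∀ (b : X) (R : ℝ) (Ψ : X → Y), 0 ≤ R →
      (∀ x ∈ Metric.closedBall b R, ∀ x' ∈ Metric.closedBall b R,
        ‖Ψ x - Ψ x' - L (x - x')‖ ≤ c * ‖x - x'‖) →
      ∀ y, ‖y - Ψ b‖ ≤ c * R → ∃ x ∈ Metric.closedBall b R, Ψ x = y := by
  let N : NNReal := ‖RI‖₊ + 1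
  have hN : (0:ℝ) < N := by positivity
  let I : L.NonlinearRightInverse :=
    { toFun := RI
      nnnorm := N
      bound' := fun y => by
        refine (RI.le_opNorm y).trans ?_
        gcongr
        simp [N]
      right_inv' := hRI }
  let c : NNReal := (2 * N)⁻¹
  have hc : (0:ℝ) < c := by positivity
  refine ⟨c, hc, fun b R Ψ hR h y hy => ?_⟩
  have hap : ApproximatesLinearOn Ψ L (Metric.closedBall b R) c := fun x hx x' hx' => h x hx x' hx'
  have := hap.surjOn_closedBall_of_nonlinearRightInverse I hR (subset_refl _)
  refine this ?_
  rw [Metric.mem_closedBall, dist_eq_norm]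
  refine hy.trans (le_of_eq ?_)
  congr 1
  show ((2 * N)⁻¹ : NNReal) = (N : ℝ)⁻¹ - ((2 * N)⁻¹ : NNReal)
  push_cast
  field_simp
  norm_num

section term
variable {F : Type} [NormedAddCommGroup F] [NormedSpace ℝ F] [CompleteSpace F]

lemma theta_bounds {t₀ t₁ : ℝ} (ht : t₀ < t₁) {m : ℝ → ℝ} (hm : Measurable m) {ψ : ℝ → F}
    (hψi : IntervalIntegrable ψ volume t₀ t₁) {κ : ℝ}
    (hmix : ∀ a b : ℝ, 0 ≤ a → a ≤ b → b ≤ 1 →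
      (∫ s in t₀..t₁, chi a b (m s)) = (b - a) * (t₁ - t₀) ∧
      ∀ t ∈ Icc t₀ t₁, ‖(∫ s in t₀..t, chi a b (m s) • ψ s) - (b - a) • ∫ s in t₀..t, ψ s‖
        ≤ κ * (b - a))
    {a b b' : ℝ} (ha : 0 ≤ a) (hb : a ≤ b) (hb' : a ≤ b') (hb1 : b ≤ 1) (hb1' : b' ≤ 1) :
    (∫ s in t₀..t₁, |chi a b (m s) - chi a b' (m s)|) = |b - b'| * (t₁ - t₀) ∧
    ∀ t ∈ Icc t₀ t₁, ‖(∫ s in t₀..t, (chi a b (m s) - chi a b' (m s)) • ψ s) -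
        (b - b') • ∫ s in t₀..t, ψ s‖ ≤ κ * |b - b'| := by
  rcases le_total b' b with h | h
  · have h1 := hmix b' b (ha.trans hb') h hb1
    simp_rw [chi_sub hb' h, abs_of_nonneg (chi_nonneg _ _ _), abs_of_nonneg (sub_nonneg.2 h)]
    exact h1
  · have h1 := hmix b b' (ha.trans hb) h hb1'
    have e : ∀ s, chi a b (m s) - chi a b' (m s) = -(chi b b' (m s)) := fun s => by
      rw [← chi_sub hb h]; ring
    have e2 : |b - b'| = b' - b := by rw [abs_sub_comm, abs_of_nonneg (sub_nonneg.2 h)]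
    simp_rw [e, abs_neg, abs_of_nonneg (chi_nonneg _ _ _), e2]
    refine ⟨h1.1, fun t htt => ?_⟩
    have h2 := h1.2 t htt
    rw [← norm_neg] at h2
    have e3 : (∫ s in t₀..t, (-(chi b b' (m s))) • ψ s) - (b - b') • ∫ s in t₀..t, ψ s =
        -((∫ s in t₀..t, chi b b' (m s) • ψ s) - (b' - b) • ∫ s in t₀..t, ψ s) := by
      simp only [neg_smul, intervalIntegral.integral_neg, sub_smul]
      abel
    rw [e3]
    exact h2

lemma chi_term {t₀ t₁ : ℝ} (ht : t₀ < t₁) {m : ℝ → ℝ} (hm : Measurable m) {ψ : ℝ → F}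
    (hψi : IntervalIntegrable ψ volume t₀ t₁) {κ : ℝ}
    (hmix : ∀ a b : ℝ, 0 ≤ a → a ≤ b → b ≤ 1 →
      (∫ s in t₀..t₁, chi a b (m s)) = (b - a) * (t₁ - t₀) ∧
      ∀ t ∈ Icc t₀ t₁, ‖(∫ s in t₀..t, chi a b (m s) • ψ s) - (b - a) • ∫ s in t₀..t, ψ s‖
        ≤ κ * (b - a))
    {w w' : ℝ → F} (hwi : IntervalIntegrable w volume t₀ t₁) (hwi' : IntervalIntegrable w' volume t₀ t₁)
    {η d : ℝ} (hη : 0 ≤ η) (hd : 0 ≤ d) (h1 : ∀ s ∈ Icc t₀ t₁, ‖w' s - ψ s‖ ≤ η)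
    (h2 : ∀ s ∈ Icc t₀ t₁, ‖w s - w' s‖ ≤ η * d)
    {a e α α' : ℝ} (he : 0 < e) (ha : 0 ≤ a) (hα : 0 ≤ α) (hα' : 0 ≤ α') (hb : a + e * α ≤ 1)
    (hb' : a + e * α' ≤ 1) (t : ℝ) (htt : t ∈ Icc t₀ t₁) :
    ‖(∫ s in t₀..t, (e⁻¹ * chi a (a + e * α) (m s)) • w s) -
      (∫ s in t₀..t, (e⁻¹ * chi a (a + e * α') (m s)) • w' s) - (α - α') • ∫ s in t₀..t, ψ s‖ ≤
      α * (t₁ - t₀) * η * d + |α - α'| * ((t₁ - t₀) * η + κ) := by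
  have hcm : ∀ b, Measurable fun s => chi a b (m s) := fun b => (measurable_chi a b).comp hm
  have hcabs : ∀ b s, |chi a b (m s)| ≤ 1 := fun b s => by
    rw [abs_of_nonneg (chi_nonneg _ _ _)]; exact chi_le_one _ _ _
  -- integrability of products
  have hprod : ∀ {x : ℝ → F} (b : ℝ), IntervalIntegrable x volume t₀ t₁ →
      IntervalIntegrable (fun s => chi a b (m s) • x s) volume t₀ t₁ := by
    intro x b hx
    rw [intervalIntegrable_iff_integrableOn_Ioc_of_le ht.le] at hx ⊢
    exact Integrable.bdd_smul hx 1 (hcm b).aestronglyMeasurable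
      (Eventually.of_forall fun s => hcabs b s)
  have hci : ∀ b, IntervalIntegrable (fun s => chi a b (m s)) volume t₀ t₁ := fun b =>
    ii_of_bdd ht.le (hcm b).stronglyMeasurable (M := 1) fun s _ => hcabs b s
  set b := a + e * α with hbdef
  set b' := a + e * α' with hbdef'
  have hab : a ≤ b := by have := mul_nonneg he.le hα; linarith
  have hab' : a ≤ b' := by have := mul_nonneg he.le hα'; linarith
  have hbb : b - b' = e * (α - α') := by rw [hbdef, hbdef']; ring
  obtain ⟨q1, q2⟩ := theta_bounds ht hm hψi hmix ha hab hab' hb hb'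
  have q0 := (hmix a b ha hab hb).1
  have hT := sub_pos.2 ht
  -- the three pieces
  have P1 : ‖∫ s in t₀..t, chi a b (m s) • (w s - w' s)‖ ≤ e * α * (t₁ - t₀) * (η * d) := by
    calc ‖∫ s in t₀..t, chi a b (m s) • (w s - w' s)‖ ≤ ∫ s in t₀..t, chi a b (m s) * (η * d) := by
          refine intervalIntegral.norm_integral_le_of_norm_le htt.1 ?_
            ((ii_sub (hci b) htt).mul_const _)
          refine Eventually.of_forall fun s hs => ?_
          rw [norm_smul, Real.norm_eq_abs, abs_of_nonneg (chi_nonneg _ _ _)]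
          exact mul_le_mul_of_nonneg_left (h2 s ⟨hs.1.le, hs.2.trans htt.2⟩) (chi_nonneg _ _ _)
      _ = (∫ s in t₀..t, chi a b (m s)) * (η * d) := intervalIntegral.integral_mul_const _ _
      _ ≤ (∫ s in t₀..t₁, chi a b (m s)) * (η * d) := by
          gcongr
          exact intervalIntegral.integral_mono_interval le_rfl htt.1 htt.2
            (Eventually.of_forall fun s => chi_nonneg _ _ _) (hci b)
      _ = _ := by rw [q0, hbdef]; ring
  have P2 : ‖∫ s in t₀..t, (chi a b (m s) - chi a b' (m s)) • (w' s - ψ s)‖ ≤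
      e * |α - α'| * (t₁ - t₀) * η := by
    have hi : IntervalIntegrable (fun s => |chi a b (m s) - chi a b' (m s)|) volume t₀ t₁ :=
      ((hci b).sub (hci b')).abs
    calc ‖∫ s in t₀..t, (chi a b (m s) - chi a b' (m s)) • (w' s - ψ s)‖
        ≤ ∫ s in t₀..t, |chi a b (m s) - chi a b' (m s)| * η := by
          refine intervalIntegral.norm_integral_le_of_norm_le htt.1 ?_
            ((ii_sub hi htt).mul_const _)
          refine Eventually.of_forall fun s hs => ?_
          rw [norm_smul, Real.norm_eq_abs]
          exact mul_le_mul_of_nonneg_left (h1 s ⟨hs.1.le, hs.2.trans htt.2⟩) (abs_nonneg _)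
      _ = (∫ s in t₀..t, |chi a b (m s) - chi a b' (m s)|) * η := intervalIntegral.integral_mul_const _ _
      _ ≤ (∫ s in t₀..t₁, |chi a b (m s) - chi a b' (m s)|) * η := by
          gcongr
          exact intervalIntegral.integral_mono_interval le_rfl htt.1 htt.2
            (Eventually.of_forall fun s => abs_nonneg _) hi
      _ = _ := by rw [q1, hbb, abs_mul, abs_of_pos he]
  have P3 := q2 t htt
  rw [hbb, abs_mul, abs_of_pos he] at P3
  have hs1 := ii_sub hwi htt
  have key : (∫ s in t₀..t, (e⁻¹ * chi a b (m s)) • w s) -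
      (∫ s in t₀..t, (e⁻¹ * chi a b' (m s)) • w' s) - (α - α') • ∫ s in t₀..t, ψ s =
      e⁻¹ • ((∫ s in t₀..t, chi a b (m s) • (w s - w' s)) +
        (∫ s in t₀..t, (chi a b (m s) - chi a b' (m s)) • (w' s - ψ s)) +
        ((∫ s in t₀..t, (chi a b (m s) - chi a b' (m s)) • ψ s) -
          (e * (α - α')) • ∫ s in t₀..t, ψ s)) := by
    have i1 := ii_sub (hprod b hwi) htt
    have i2 := ii_sub (hprod b hwi') htt
    have i3 := ii_sub (hprod b' hwi') htt
    have i4 := ii_sub (hprod b hψi) htt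
    have i5 := ii_sub (hprod b' hψi) htt
    simp only [mul_smul, smul_sub, sub_smul]
    rw [intervalIntegral.integral_smul, intervalIntegral.integral_smul,
      intervalIntegral.integral_sub i1 i2, intervalIntegral.integral_sub (i2.sub i3) (i4.sub i5),
      intervalIntegral.integral_sub i2 i3, intervalIntegral.integral_sub i4 i5]
    simp only [smul_sub, smul_add, smul_smul]
    rw [inv_mul_cancel_left₀ he.ne', inv_mul_cancel_left₀ he.ne']
    abel
  rw [key, norm_smul, Real.norm_eq_abs, abs_of_pos (inv_pos.2 he)]
  have htot := norm_add₃_le.trans (add_le_add (add_le_add P1 P2) P3)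
  calc _ ≤ e⁻¹ * (e * α * (t₁ - t₀) * (η * d) + e * |α - α'| * (t₁ - t₀) * η + κ * (e * |α - α'|)) := by
        gcongr
    _ = _ := by field_simp; ring

end term
end ODEC

end Part7

section Part8

open Set Topology Filter MeasureTheory
set_option linter.unusedSectionVars false
set_option linter.unusedVariables false

namespace ODEC

lemma solve_abstract {X Z : Type*} [NormedAddCommGroup X] [NormedSpace ℝ X] [CompleteSpace X]
    [NormedAddCommGroup Z] [NormedSpace ℝ Z] [CompleteSpace Z] (K S : X →L[ℝ] X)
    (hS : ∀ η, S η - K (S η) = η) (W : Z →L[ℝ] X) (e : X →L[ℝ] Z) (he : ∀ z, e (S (W z)) = z) :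
    ∃ c > (0:ℝ), ∀ (ξ₀ : X) (R : ℝ) (Ψ : X → Z → X) (G : X → Z), 0 ≤ R →
      (∀ ξ z ξ' z', ‖ξ - ξ₀‖ ≤ R → ‖z‖ ≤ R → ‖ξ' - ξ₀‖ ≤ R → ‖z'‖ ≤ R →
        ‖Ψ ξ z - Ψ ξ' z' - ((ξ - ξ') - K (ξ - ξ') - W (z - z'))‖ ≤ c * max ‖ξ - ξ'‖ ‖z - z'‖ ∧
        ‖G ξ - G ξ' - e (ξ - ξ')‖ ≤ c * ‖ξ - ξ'‖) →
      ∀ y, ‖Ψ ξ₀ 0‖ ≤ c * R → ‖y - G ξ₀‖ ≤ c * R →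
        ∃ ξ z, ‖ξ - ξ₀‖ ≤ R ∧ ‖z‖ ≤ R ∧ Ψ ξ z = 0 ∧ G ξ = y := by
  let L : X × Z →L[ℝ] X × Z :=
    ((ContinuousLinearMap.fst ℝ X Z - K.comp (ContinuousLinearMap.fst ℝ X Z)) -
      W.comp (ContinuousLinearMap.snd ℝ X Z)).prod (e.comp (ContinuousLinearMap.fst ℝ X Z))
  let zz : X × Z →L[ℝ] Z := ContinuousLinearMap.snd ℝ X Z - (e.comp S).comp (ContinuousLinearMap.fst ℝ X Z)
  let RI : X × Z →L[ℝ] X × Z :=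
    (S.comp (ContinuousLinearMap.fst ℝ X Z + W.comp zz)).prod zz
  have hL : ∀ ξ z, L (ξ, z) = (ξ - K ξ - W z, e ξ) := fun ξ z => rfl
  have hRI' : ∀ η y, RI (η, y) = (S (η + W (y - e (S η))), y - e (S η)) := fun ξ z => rfl
  have hRI : ∀ y, L (RI y) = y := by
    rintro ⟨η, y⟩
    rw [hRI', hL, hS]
    ext1
    · simp
    · simp [he]
  obtain ⟨c, hc, H⟩ := surj_quant L RI hRI
  refine ⟨c, hc, fun ξ₀ R Ψ G hR h y h1 h2 => ?_⟩
  have hball : ∀ x : X × Z, x ∈ Metric.closedBall ((ξ₀, 0) : X × Z) R → ‖x.1 - ξ₀‖ ≤ R ∧ ‖x.2‖ ≤ R := by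
    intro x hx
    rw [Metric.mem_closedBall, dist_eq_norm, Prod.norm_def] at hx
    have := max_le_iff.1 hx
    exact ⟨this.1, by simpa using this.2⟩
  obtain ⟨x, hx, hxy⟩ := H (ξ₀, 0) R (fun x => (Ψ x.1 x.2, G x.1)) hR (by
    intro x hx x' hx'
    have b1 := hball x hx
    have b2 := hball x' hx'
    have h3 := h x.1 x.2 x'.1 x'.2 b1.1 b1.2 b2.1 b2.2
    have e1 : x - x' = (x.1 - x'.1, x.2 - x'.2) := rfl
    rw [e1, hL, Prod.norm_def, Prod.norm_def]
    refine max_le h3.1 (h3.2.trans ?_)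
    exact mul_le_mul_of_nonneg_left (le_max_left _ _) hc.le) (0, y) (by
    rw [Prod.norm_def]
    refine max_le ?_ h2
    simpa using h1)
  have b1 := hball x hx
  exact ⟨x.1, x.2, b1.1, b1.2, congrArg Prod.fst hxy, congrArg Prod.snd hxy⟩

section NNs
variable {n k : ℕ}

/-- the rescaled right hand side -/
noncomputable def NN (m : ℝ → ℝ) (e : ℝ) (Θ : ℝ → (Fin n → ℝ) → Fin n → ℝ)
    (ω : Fin k → ℝ → (Fin n → ℝ) → Fin n → ℝ) (α : Fin k → ℝ) (x : ℝ → Fin n → ℝ) (s : ℝ) : Fin n → ℝ :=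
  Θ s (x s) + ∑ i : Fin k, (e⁻¹ * chi ((i : ℝ) / k) ((i : ℝ) / k + e * α i) (m s)) • ω i s (x s)

/-- the mixing property -/
def Mix (t₀ t₁ : ℝ) (m : ℝ → ℝ) (ψ : Fin k → ℝ → Fin n → ℝ) (κ : ℝ) : Prop :=
  ∀ i, ∀ a b : ℝ, 0 ≤ a → a ≤ b → b ≤ 1 →
      (∫ s in t₀..t₁, chi a b (m s)) = (b - a) * (t₁ - t₀) ∧
      ∀ t ∈ Icc t₀ t₁, ‖(∫ s in t₀..t, chi a b (m s) • ψ i s) - (b - a) • ∫ s in t₀..t, ψ i s‖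
        ≤ κ * (b - a)

/-- the analytic estimates for the rescaled right hand side -/
structure Est (t₀ t₁ : ℝ) (A : ℝ → (Fin n → ℝ) →L[ℝ] (Fin n → ℝ)) (Q2 : ℝ → Fin n → ℝ)
    (ψ : Fin k → ℝ → Fin n → ℝ) (ρ η : ℝ)
    (Θ : ℝ → (Fin n → ℝ) → Fin n → ℝ) (ω : Fin k → ℝ → (Fin n → ℝ) → Fin n → ℝ) : Prop where
  hΘm : ∀ x : ℝ → Fin n → ℝ, Continuous x → StronglyMeasurable fun s => Θ s (x s)
  hωm : ∀ i, ∀ x : ℝ → Fin n → ℝ, Continuous x → StronglyMeasurable fun s => ω i s (x s)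
  hF1 : ∀ s ∈ Icc t₀ t₁, ∀ x x', ‖x‖ ≤ ρ → ‖x'‖ ≤ ρ →
    ‖Θ s x - Θ s x' - A s (x - x')‖ ≤ η * ‖x - x'‖
  hF2 : ∀ s ∈ Icc t₀ t₁, ∀ x, ‖x‖ ≤ ρ → ‖Θ s x - A s x - Q2 s‖ ≤ η
  hF3 : ∀ i, ∀ s ∈ Icc t₀ t₁, ∀ x, ‖x‖ ≤ ρ → ‖ω i s x - ψ i s‖ ≤ η
  hF4 : ∀ i, ∀ s ∈ Icc t₀ t₁, ∀ x x', ‖x‖ ≤ ρ → ‖x'‖ ≤ ρ →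
    ‖ω i s x - ω i s x'‖ ≤ η * ‖x - x'‖

/-- integrability from closeness -/
lemma ii_of_close {F : Type} [NormedAddCommGroup F] {t₀ t₁ : ℝ} (ht : t₀ < t₁) {w w' : ℝ → F}
    (hw : StronglyMeasurable w)
    (hi : IntervalIntegrable w' volume t₀ t₁)
    {M : ℝ} (hM : ∀ s ∈ Icc t₀ t₁, ‖w s - w' s‖ ≤ M) : IntervalIntegrable w volume t₀ t₁ := by
  rw [intervalIntegrable_iff_integrableOn_Icc_of_le ht.le] at hi ⊢
  have hsm : AEStronglyMeasurable w (volume.restrict (Icc t₀ t₁)) := hw.aestronglyMeasurable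
  have h1 : Integrable (fun s => w s - w' s) (volume.restrict (Icc t₀ t₁)) := by
    refine Integrable.of_bound (C := M) (hsm.sub hi.aestronglyMeasurable) ?_
    exact (ae_restrict_iff' measurableSet_Icc).2 (Eventually.of_forall hM)
  have h2 : w = (fun s => w s - w' s) + w' := by funext s; simp
  rw [h2]
  exact h1.add hi

lemma chi_self (a x : ℝ) : chi a a x = 0 := by
  have := chi_sub (le_refl a) (le_refl a) x
  linarith

variable {t₀ t₁ : ℝ}

/-- integrability and expansion of the integral of `NN` -/
lemma NN_int (ht : t₀ < t₁) {m : ℝ → ℝ} (hm : Measurable m)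
    {ψ : Fin k → ℝ → Fin n → ℝ} (hψi : ∀ i, IntervalIntegrable (ψ i) volume t₀ t₁)
    {A : ℝ → (Fin n → ℝ) →L[ℝ] (Fin n → ℝ)} (hA : StronglyMeasurable A) {L : ℝ}
    (hL : ∀ s ∈ Icc t₀ t₁, ‖A s‖ ≤ L)
    {Q2 : ℝ → Fin n → ℝ} (hQi : IntervalIntegrable Q2 volume t₀ t₁)
    {Θ : ℝ → (Fin n → ℝ) → Fin n → ℝ} {ω : Fin k → ℝ → (Fin n → ℝ) → Fin n → ℝ} {ρ η : ℝ} (e : ℝ)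
    (hE : Est t₀ t₁ A Q2 ψ ρ η Θ ω) (α : Fin k → ℝ)
    (ξ : C(Icc t₀ t₁, Fin n → ℝ)) (hξ : ‖ξ‖ ≤ ρ) :
    IntervalIntegrable (fun s => A s (ext ht.le ξ s)) volume t₀ t₁ ∧
    IntervalIntegrable (fun s => Θ s (ext ht.le ξ s)) volume t₀ t₁ ∧
    (∀ i, IntervalIntegrable (fun s => ω i s (ext ht.le ξ s)) volume t₀ t₁) ∧
    IntervalIntegrable (NN m e Θ ω α (ext ht.le ξ)) volume t₀ t₁ ∧
    ∀ t ∈ Icc t₀ t₁, (∫ s in t₀..t, NN m e Θ ω α (ext ht.le ξ) s) =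
      (∫ s in t₀..t, Θ s (ext ht.le ξ s)) + ∑ i : Fin k,
        ∫ s in t₀..t, (e⁻¹ * chi ((i : ℝ) / k) ((i : ℝ) / k + e * α i) (m s)) • ω i s (ext ht.le ξ s) := by
  have hx := ext_cont ht.le ξ
  have hxn : ∀ s, ‖ext ht.le ξ s‖ ≤ ρ := fun s => (norm_ext_le ht.le ξ s).trans hξ
  have hL0 : 0 ≤ L := (norm_nonneg _).trans (hL t₀ ⟨le_rfl, ht.le⟩)
  have h1 : IntervalIntegrable (fun s => A s (ext ht.le ξ s)) volume t₀ t₁ := by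
    refine ii_of_bdd ht.le (sm_clm_apply hA hx.stronglyMeasurable) (M := L * ρ) fun s hs => ?_
    exact ((A s).le_of_opNorm_le (hL s hs) _).trans (mul_le_mul_of_nonneg_left (hxn s) hL0)
  have h2 : IntervalIntegrable (fun s => Θ s (ext ht.le ξ s)) volume t₀ t₁ := by
    refine ii_of_close ht (hE.hΘm _ hx) (h1.add hQi) (M := η) fun s hs => ?_
    have := hE.hF2 s hs _ (hxn s)
    rwa [sub_sub] at this
  have h3 : ∀ i, IntervalIntegrable (fun s => ω i s (ext ht.le ξ s)) volume t₀ t₁ := fun i =>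
    ii_of_close ht (hE.hωm i _ hx) (hψi i) (M := η) fun s hs => hE.hF3 i s hs _ (hxn s)
  have h4 : ∀ i : Fin k, IntervalIntegrable (fun s => (e⁻¹ * chi ((i : ℝ) / k) ((i : ℝ) / k + e * α i) (m s)) •
      ω i s (ext ht.le ξ s)) volume t₀ t₁ := by
    intro i
    have hx := h3 i
    rw [intervalIntegrable_iff_integrableOn_Ioc_of_le ht.le] at hx ⊢
    refine Integrable.bdd_smul hx |e⁻¹|
      (((measurable_chi _ _).comp hm).const_mul _).aestronglyMeasurable
      (Eventually.of_forall fun s => ?_)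
    rw [Real.norm_eq_abs, abs_mul, Function.comp_apply, abs_of_nonneg (chi_nonneg _ _ _)]
    exact mul_le_of_le_one_right (abs_nonneg _) (chi_le_one _ _ _)
  have h5 : IntervalIntegrable (fun s => ∑ i : Fin k, (e⁻¹ * chi ((i : ℝ) / k) ((i : ℝ) / k + e * α i) (m s)) •
      ω i s (ext ht.le ξ s)) volume t₀ t₁ := by
    have := IntervalIntegrable.sum Finset.univ fun i _ => h4 i
    have e5 : (fun s => ∑ i : Fin k, (e⁻¹ * chi ((i : ℝ) / k) ((i : ℝ) / k + e * α i) (m s)) •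
      ω i s (ext ht.le ξ s)) = ∑ i : Fin k, fun s => (e⁻¹ * chi ((i : ℝ) / k) ((i : ℝ) / k + e * α i) (m s)) •
      ω i s (ext ht.le ξ s) := by
      funext s
      simp
    rw [e5]
    exact this
  refine ⟨h1, h2, h3, h2.add h5, fun t htt => ?_⟩
  unfold NN
  rw [intervalIntegral.integral_add (ii_sub h2 htt) (ii_sub h5 htt),
    intervalIntegral.integral_finsetSum fun i _ => ii_sub (h4 i) htt]

lemma cell_bound (i : Fin k) {e a αm : ℝ} (he : 0 < e) (heα : e * αm ≤ (1:ℝ) / k) (ha : a ≤ αm) :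
    (i : ℝ) / k + e * a ≤ 1 := by
  have hk : (0:ℝ) < k := by exact_mod_cast i.pos
  have h1 : ((i:ℝ) + 1) ≤ k := by exact_mod_cast i.2
  have h2 : e * a ≤ 1 / k := (mul_le_mul_of_nonneg_left ha he.le).trans heα
  calc (i : ℝ) / k + e * a ≤ (i : ℝ) / k + 1 / k := by linarith
    _ = ((i:ℝ) + 1) / k := by ring
    _ ≤ 1 := by rw [div_le_one hk]; exact h1

lemma NN_diff (ht : t₀ < t₁) {m : ℝ → ℝ} (hm : Measurable m)
    {ψ : Fin k → ℝ → Fin n → ℝ} (hψi : ∀ i, IntervalIntegrable (ψ i) volume t₀ t₁) {κ : ℝ}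
    (hmix : Mix t₀ t₁ m ψ κ)
    {A : ℝ → (Fin n → ℝ) →L[ℝ] (Fin n → ℝ)} (hA : StronglyMeasurable A) {L : ℝ}
    (hL : ∀ s ∈ Icc t₀ t₁, ‖A s‖ ≤ L)
    {K : C(Icc t₀ t₁, Fin n → ℝ) →L[ℝ] C(Icc t₀ t₁, Fin n → ℝ)}
    (hK : ∀ ξ t, K ξ t = ∫ s in t₀..t, A s (ext ht.le ξ s))
    {Q2 : ℝ → Fin n → ℝ} (hQi : IntervalIntegrable Q2 volume t₀ t₁)
    {Θ : ℝ → (Fin n → ℝ) → Fin n → ℝ} {ω : Fin k → ℝ → (Fin n → ℝ) → Fin n → ℝ} {ρ η e αm : ℝ}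
    (hη : 0 ≤ η) (hκ : 0 ≤ κ) (he : 0 < e) (heα : e * αm ≤ (1:ℝ) / k)
    (hE : Est t₀ t₁ A Q2 ψ ρ η Θ ω) (α α' : Fin k → ℝ) (hα : ∀ i, 0 ≤ α i ∧ α i ≤ αm)
    (hα' : ∀ i, 0 ≤ α' i ∧ α' i ≤ αm)
    (ξ ξ' : C(Icc t₀ t₁, Fin n → ℝ)) (hξ : ‖ξ‖ ≤ ρ) (hξ' : ‖ξ'‖ ≤ ρ) :
    ‖prim t₀ t₁ (NN m e Θ ω α (ext ht.le ξ)) - prim t₀ t₁ (NN m e Θ ω α' (ext ht.le ξ')) - K (ξ - ξ')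
      - ∑ i, (α i - α' i) • prim t₀ t₁ (ψ i)‖ ≤ (t₁ - t₀) * η * ‖ξ - ξ'‖ +
        ∑ i, (αm * (t₁ - t₀) * η * ‖ξ - ξ'‖ + |α i - α' i| * ((t₁ - t₀) * η + κ)) := by
  obtain ⟨a1, a2, a3, a4, a5⟩ := NN_int ht hm hψi hA hL hQi e hE α ξ hξ
  obtain ⟨b1, b2, b3, b4, b5⟩ := NN_int ht hm hψi hA hL hQi e hE α' ξ' hξ'
  have hT : 0 ≤ t₁ - t₀ := (sub_pos.2 ht).le
  have hd : ∀ s, ‖ext ht.le ξ s - ext ht.le ξ' s‖ ≤ ‖ξ - ξ'‖ := fun s => norm_ext_le ht.le (ξ - ξ') s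
  have hxn : ∀ s, ‖ext ht.le ξ s‖ ≤ ρ := fun s => (norm_ext_le ht.le ξ s).trans hξ
  have hxn' : ∀ s, ‖ext ht.le ξ' s‖ ≤ ρ := fun s => (norm_ext_le ht.le ξ' s).trans hξ'
  refine (ContinuousMap.norm_le _ ?_).2 fun t => ?_
  · refine add_nonneg (by positivity) (Finset.sum_nonneg fun i _ => ?_)
    have : 0 ≤ αm := (hα i).1.trans (hα i).2
    positivity
  have T1 : ‖(∫ s in t₀..t, Θ s (ext ht.le ξ s)) - (∫ s in t₀..t, Θ s (ext ht.le ξ' s)) -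
      ((∫ s in t₀..t, A s (ext ht.le ξ s)) - ∫ s in t₀..t, A s (ext ht.le ξ' s))‖ ≤
      (t₁ - t₀) * η * ‖ξ - ξ'‖ := by
    rw [← intervalIntegral.integral_sub (ii_sub a2 t.2) (ii_sub b2 t.2),
      ← intervalIntegral.integral_sub (ii_sub a1 t.2) (ii_sub b1 t.2),
      ← intervalIntegral.integral_sub ((ii_sub a2 t.2).sub (ii_sub b2 t.2))
        ((ii_sub a1 t.2).sub (ii_sub b1 t.2))]
    refine (intervalIntegral.norm_integral_le_of_norm_le_const (C := η * ‖ξ - ξ'‖) fun s hs => ?_).trans ?_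
    · rw [uIoc_of_le t.2.1] at hs
      have h := hE.hF1 s ⟨hs.1.le, hs.2.trans t.2.2⟩ _ _ (hxn s) (hxn' s)
      rw [map_sub] at h
      exact h.trans (mul_le_mul_of_nonneg_left (hd s) hη)
    · rw [abs_of_nonneg (sub_nonneg.2 t.2.1)]
      have : (t:ℝ) - t₀ ≤ t₁ - t₀ := by linarith [t.2.2]
      calc η * ‖ξ - ξ'‖ * (t - t₀) ≤ η * ‖ξ - ξ'‖ * (t₁ - t₀) := by gcongr
        _ = _ := by ring
  have T2 : ∀ i : Fin k, ‖(∫ s in t₀..t, (e⁻¹ * chi ((i : ℝ) / k) ((i : ℝ) / k + e * α i) (m s)) • ω i s (ext ht.le ξ s)) -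
      (∫ s in t₀..t, (e⁻¹ * chi ((i : ℝ) / k) ((i : ℝ) / k + e * α' i) (m s)) • ω i s (ext ht.le ξ' s)) -
        (α i - α' i) • ∫ s in t₀..t, ψ i s‖ ≤
      αm * (t₁ - t₀) * η * ‖ξ - ξ'‖ + |α i - α' i| * ((t₁ - t₀) * η + κ) := by
    intro i
    have h := chi_term ht hm (hψi i) (hmix i) (a3 i) (b3 i) hη (norm_nonneg (ξ - ξ'))
      (fun s hs => hE.hF3 i s hs _ (hxn' s))
      (fun s hs => (hE.hF4 i s hs _ _ (hxn s) (hxn' s)).trans (mul_le_mul_of_nonneg_left (hd s) hη))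
      he (a := (i:ℝ)/k) (by positivity) (hα i).1 (hα' i).1 (cell_bound i he heα (hα i).2)
      (cell_bound i he heα (hα' i).2) t t.2
    refine h.trans ?_
    gcongr
    exact (hα i).2
  have hKs : K (ξ - ξ') t = (∫ s in t₀..t, A s (ext ht.le ξ s)) - ∫ s in t₀..t, A s (ext ht.le ξ' s) := by
    rw [map_sub, ContinuousMap.sub_apply, hK, hK]
  have e1 : (prim t₀ t₁ (NN m e Θ ω α (ext ht.le ξ)) - prim t₀ t₁ (NN m e Θ ω α' (ext ht.le ξ')) - K (ξ - ξ')
      - ∑ i, (α i - α' i) • prim t₀ t₁ (ψ i)) t =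
      ((∫ s in t₀..t, Θ s (ext ht.le ξ s)) - (∫ s in t₀..t, Θ s (ext ht.le ξ' s)) -
      ((∫ s in t₀..t, A s (ext ht.le ξ s)) - ∫ s in t₀..t, A s (ext ht.le ξ' s))) +
      ∑ i : Fin k, ((∫ s in t₀..t, (e⁻¹ * chi ((i : ℝ) / k) ((i : ℝ) / k + e * α i) (m s)) • ω i s (ext ht.le ξ s)) -
      (∫ s in t₀..t, (e⁻¹ * chi ((i : ℝ) / k) ((i : ℝ) / k + e * α' i) (m s)) • ω i s (ext ht.le ξ' s)) -
        (α i - α' i) • ∫ s in t₀..t, ψ i s) := by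
    simp only [ContinuousMap.sub_apply, ContinuousMap.coe_sum, Finset.sum_apply, ContinuousMap.coe_smul,
      Pi.smul_apply]
    rw [← ContinuousMap.sub_apply, ← ContinuousMap.sub_apply]
    simp only [ContinuousMap.sub_apply]
    rw [hKs, prim_apply a4, prim_apply b4, a5 t t.2, b5 t t.2, Finset.sum_sub_distrib, Finset.sum_sub_distrib]
    simp only [prim_apply (hψi _)]
    abel
  rw [e1]
  refine (norm_add_le _ _).trans (add_le_add T1 ((norm_sum_le _ _).trans (Finset.sum_le_sum fun i _ => T2 i)))

lemma NN_base (ht : t₀ < t₁) {m : ℝ → ℝ} (hm : Measurable m)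
    {ψ : Fin k → ℝ → Fin n → ℝ} (hψi : ∀ i, IntervalIntegrable (ψ i) volume t₀ t₁) {κ : ℝ}
    (hmix : Mix t₀ t₁ m ψ κ)
    {A : ℝ → (Fin n → ℝ) →L[ℝ] (Fin n → ℝ)} (hA : StronglyMeasurable A) {L : ℝ}
    (hL : ∀ s ∈ Icc t₀ t₁, ‖A s‖ ≤ L)
    {K : C(Icc t₀ t₁, Fin n → ℝ) →L[ℝ] C(Icc t₀ t₁, Fin n → ℝ)}
    (hK : ∀ ξ t, K ξ t = ∫ s in t₀..t, A s (ext ht.le ξ s))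
    {Q2 : ℝ → Fin n → ℝ} (hQi : IntervalIntegrable Q2 volume t₀ t₁)
    {Θ : ℝ → (Fin n → ℝ) → Fin n → ℝ} {ω : Fin k → ℝ → (Fin n → ℝ) → Fin n → ℝ} {ρ η e αm : ℝ}
    (hη : 0 ≤ η) (hκ : 0 ≤ κ) (he : 0 < e) (heα : e * αm ≤ (1:ℝ) / k)
    (hE : Est t₀ t₁ A Q2 ψ ρ η Θ ω) (α : Fin k → ℝ) (hα : ∀ i, 0 ≤ α i ∧ α i ≤ αm)
    (ξ : C(Icc t₀ t₁, Fin n → ℝ)) (hξ : ‖ξ‖ ≤ ρ) :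
    ‖prim t₀ t₁ (NN m e Θ ω α (ext ht.le ξ)) - K ξ - prim t₀ t₁ Q2
      - ∑ i, α i • prim t₀ t₁ (ψ i)‖ ≤ (t₁ - t₀) * η +
        ∑ i : Fin k, (αm * ((t₁ - t₀) * η + κ)) := by
  obtain ⟨a1, a2, a3, a4, a5⟩ := NN_int ht hm hψi hA hL hQi e hE α ξ hξ
  have hT : 0 ≤ t₁ - t₀ := (sub_pos.2 ht).le
  have hxn : ∀ s, ‖ext ht.le ξ s‖ ≤ ρ := fun s => (norm_ext_le ht.le ξ s).trans hξ
  refine (ContinuousMap.norm_le _ ?_).2 fun t => ?_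
  · refine add_nonneg (by positivity) (Finset.sum_nonneg fun i _ => ?_)
    have : 0 ≤ αm := (hα i).1.trans (hα i).2
    positivity
  have T1 : ‖(∫ s in t₀..t, Θ s (ext ht.le ξ s)) -
      (∫ s in t₀..t, A s (ext ht.le ξ s)) - ∫ s in t₀..t, Q2 s‖ ≤
      (t₁ - t₀) * η := by
    rw [← intervalIntegral.integral_sub (ii_sub a2 t.2) (ii_sub a1 t.2),
      ← intervalIntegral.integral_sub ((ii_sub a2 t.2).sub (ii_sub a1 t.2)) (ii_sub hQi t.2)]
    refine (intervalIntegral.norm_integral_le_of_norm_le_const (C := η) fun s hs => ?_).trans ?_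
    · rw [uIoc_of_le t.2.1] at hs
      exact hE.hF2 s ⟨hs.1.le, hs.2.trans t.2.2⟩ _ (hxn s)
    · rw [abs_of_nonneg (sub_nonneg.2 t.2.1)]
      have : (t:ℝ) - t₀ ≤ t₁ - t₀ := by linarith [t.2.2]
      calc η * (t - t₀) ≤ η * (t₁ - t₀) := by gcongr
        _ = _ := by ring
  have T2 : ∀ i : Fin k, ‖(∫ s in t₀..t, (e⁻¹ * chi ((i : ℝ) / k) ((i : ℝ) / k + e * α i) (m s)) • ω i s (ext ht.le ξ s)) -
        α i • ∫ s in t₀..t, ψ i s‖ ≤ αm * ((t₁ - t₀) * η + κ) := by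
    intro i
    have h := chi_term ht hm (hψi i) (hmix i) (a3 i) (a3 i) hη (le_refl 0)
      (fun s hs => hE.hF3 i s hs _ (hxn s))
      (fun s hs => by simp)
      he (a := (i:ℝ)/k) (by positivity) (hα i).1 (le_refl 0) (cell_bound i he heα (hα i).2)
      (cell_bound i he heα ((hα i).1.trans (hα i).2)) t t.2
    simp only [mul_zero, add_zero, chi_self, zero_smul, intervalIntegral.integral_zero, sub_zero,
      abs_of_nonneg (hα i).1, zero_add] at h
    refine h.trans ?_
    gcongr
    exact (hα i).2
  have e1 : (prim t₀ t₁ (NN m e Θ ω α (ext ht.le ξ)) - K ξ - prim t₀ t₁ Q2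
      - ∑ i, α i • prim t₀ t₁ (ψ i)) t =
      ((∫ s in t₀..t, Θ s (ext ht.le ξ s)) -
      (∫ s in t₀..t, A s (ext ht.le ξ s)) - ∫ s in t₀..t, Q2 s) +
      ∑ i : Fin k, ((∫ s in t₀..t, (e⁻¹ * chi ((i : ℝ) / k) ((i : ℝ) / k + e * α i) (m s)) • ω i s (ext ht.le ξ s)) -
        α i • ∫ s in t₀..t, ψ i s) := by
    simp only [ContinuousMap.sub_apply, ContinuousMap.coe_sum, Finset.sum_apply, ContinuousMap.coe_smul,
      Pi.smul_apply]
    rw [hK, prim_apply a4, prim_apply hQi, a5 t t.2, Finset.sum_sub_distrib]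
    simp only [prim_apply (hψi _)]
    abel
  rw [e1]
  refine (norm_add_le _ _).trans (add_le_add T1 ((norm_sum_le _ _).trans (Finset.sum_le_sum fun i _ => T2 i)))

end NNs
end ODEC

end Part8

section Part9

open Set Topology Filter MeasureTheory
set_option linter.unusedSectionVars false
set_option linter.unusedVariables false

namespace ODEC
section solve
variable {n k m₁ m₂ : ℕ} {t₀ t₁ : ℝ}

lemma exists_mix (ht : t₀ < t₁) (ψ : Fin k → ℝ → Fin n → ℝ) (hψ : ∀ i, Measurable (ψ i)) (M : ℝ)
    (hM : ∀ i, ∀ s ∈ Icc t₀ t₁, ‖ψ i s‖ ≤ M) {κ : ℝ} (hκ : 0 < κ) :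
    ∃ m : ℝ → ℝ, Measurable m ∧ Mix t₀ t₁ m ψ κ := by
  have hM' : ∀ s ∈ Icc t₀ t₁, ‖(fun i => ψ i s : Fin k → Fin n → ℝ)‖ ≤ max M 0 := fun s hs =>
    (pi_norm_le_iff_of_nonneg (le_max_right _ _)).2 fun i => (hM i s hs).trans (le_max_left _ _)
  obtain ⟨m, hm, H⟩ := mix ht (fun s i => ψ i s : ℝ → Fin k → Fin n → ℝ)
    (measurable_pi_lambda _ hψ) (max M 0) hM' hκ
  refine ⟨m, hm, fun i a b ha hab hb => ⟨(H a b ha hab hb).1, fun t htt => ?_⟩⟩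
  have h := (norm_le_pi_norm _ i).trans ((H a b ha hab hb).2 t htt)
  have hsm : StronglyMeasurable (fun s i => ψ i s : ℝ → Fin k → Fin n → ℝ) :=
    (measurable_pi_lambda _ hψ).stronglyMeasurable
  have hi : IntervalIntegrable (fun s i => ψ i s : ℝ → Fin k → Fin n → ℝ) volume t₀ t₁ :=
    ii_of_bdd ht.le hsm hM'
  have hi2 : IntervalIntegrable (fun s => chi a b (m s) • (fun i => ψ i s : Fin k → Fin n → ℝ)) volume t₀ t₁ := by
    refine ii_of_bdd ht.le (M := max M 0)
      (((measurable_chi a b).comp hm).stronglyMeasurable.smul hsm) fun s hs => ?_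
    rw [norm_smul, Real.norm_eq_abs, abs_of_nonneg (chi_nonneg _ _ _)]
    exact (mul_le_of_le_one_left (norm_nonneg _) (chi_le_one _ _ _)).trans (hM' s hs)
  have e1 := (ContinuousLinearMap.proj (R := ℝ) (φ := fun _ : Fin k => Fin n → ℝ) i).intervalIntegral_comp_comm
    (ii_sub hi htt)
  have e2 := (ContinuousLinearMap.proj (R := ℝ) (φ := fun _ : Fin k => Fin n → ℝ) i).intervalIntegral_comp_comm
    (ii_sub hi2 htt)
  simp only [ContinuousLinearMap.proj_apply, Pi.smul_apply] at e1 e2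
  rw [Pi.sub_apply, Pi.smul_apply, ← e1, ← e2] at h
  exact h

lemma ends_norm (ht : t₀ ≤ t₁) (ξ : C(Icc t₀ t₁, Fin n → ℝ)) : ‖ends ht ξ‖ ≤ ‖ξ‖ := by
  rw [ends_apply, Prod.norm_def]
  exact max_le (ξ.norm_coe_le_norm _) (ξ.norm_coe_le_norm _)

set_option maxHeartbeats 2000000 in
lemma solve (ht : t₀ < t₁) {A : ℝ → (Fin n → ℝ) →L[ℝ] (Fin n → ℝ)} (hA : StronglyMeasurable A) {L : ℝ}
    (hL : ∀ s ∈ Icc t₀ t₁, ‖A s‖ ≤ L)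
    {K S : C(Icc t₀ t₁, Fin n → ℝ) →L[ℝ] C(Icc t₀ t₁, Fin n → ℝ)}
    (hK : ∀ ξ t, K ξ t = ∫ s in t₀..t, A s (ext ht.le ξ s)) (hS : ∀ η, S η - K (S η) = η)
    {Q2 : ℝ → Fin n → ℝ} (hQi : IntervalIntegrable Q2 volume t₀ t₁)
    (ψ : Fin k → ℝ → Fin n → ℝ) (hψ : ∀ i, Measurable (ψ i)) (M : ℝ)
    (hM : ∀ i, ∀ s ∈ Icc t₀ t₁, ‖ψ i s‖ ≤ M)
    (f' : (Fin n → ℝ) × (Fin n → ℝ) →L[ℝ] (Fin m₁ → ℝ))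
    (g' : (Fin n → ℝ) × (Fin n → ℝ) →L[ℝ] (Fin m₂ → ℝ)) (act : Fin m₁ → Prop)
    (bf : Fin m₁ → ℝ) (bg : Fin m₂ → ℝ) (a : Fin k → Fin n → ℝ) (sl : Fin k → Fin m₁ → ℝ)
    (hsl : ∀ i j, act j → 0 ≤ sl i j) (β : Fin k → ℝ)
    (B : (Fin m₁ → ℝ) × (Fin m₂ → ℝ) →L[ℝ] (Fin k → ℝ)) {ρc δ : ℝ} (hρc : 0 < ρc) (hδ : 0 < δ)
    (hpos : ∀ z, ‖z‖ ≤ ρc → ∀ i, 0 ≤ β i + B z i)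
    (hid : ∀ z, ∑ i, (β i + B z i) •
      ((f' (ends ht.le (S (ContinuousMap.const _ (a i) + prim t₀ t₁ (ψ i)))) + sl i,
        g' (ends ht.le (S (ContinuousMap.const _ (a i) + prim t₀ t₁ (ψ i))))) :
          (Fin m₁ → ℝ) × (Fin m₂ → ℝ)) =
      -((1/2:ℝ) • bf + f' (ends ht.le (S (prim t₀ t₁ Q2))) + (fun _ => δ),
        (1/2:ℝ) • bg + g' (ends ht.le (S (prim t₀ t₁ Q2)))) + z) :
    ∃ αm ρ η σ : ℝ, 0 ≤ αm ∧ 0 < ρ ∧ 0 < η ∧ 0 < σ ∧ ∃ m : ℝ → ℝ, Measurable m ∧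
      ∀ (e : ℝ) (Θ : ℝ → (Fin n → ℝ) → Fin n → ℝ) (ω : Fin k → ℝ → (Fin n → ℝ) → Fin n → ℝ)
        (G : (Fin n → ℝ) × (Fin n → ℝ) → Fin m₂ → ℝ), 0 < e → e * αm ≤ (1:ℝ) / k →
        Est t₀ t₁ A Q2 ψ ρ η Θ ω →
        (∀ E E', ‖E‖ ≤ ρ → ‖E'‖ ≤ ρ → ‖G E - G E' - g' (E - E')‖ ≤ η * ‖E - E'‖) →
        (∀ E, ‖E‖ ≤ ρ → ‖G E - g' E - (1/2:ℝ) • bg‖ ≤ η) →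
        ∀ y, ‖y‖ ≤ σ → ∃ (ξ : C(Icc t₀ t₁, Fin n → ℝ)) (α : Fin k → ℝ), ‖ξ‖ ≤ ρ ∧
          (∀ i, 0 ≤ α i ∧ α i ≤ αm) ∧
          IntervalIntegrable (NN m e Θ ω α (ext ht.le ξ)) volume t₀ t₁ ∧
          (∃ a₀, ∀ t : Icc t₀ t₁, ξ t = a₀ + ∫ s in t₀..t, NN m e Θ ω α (ext ht.le ξ) s) ∧
          G (ends ht.le ξ) = y ∧
          ∀ j, act j → (f' (ends ht.le ξ) + (1/2:ℝ) • bf) j ≤ -(δ/2) := by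
  have hψi : ∀ i, IntervalIntegrable (ψ i) volume t₀ t₁ := fun i =>
    ii_of_bdd ht.le (hψ i).stronglyMeasurable (hM i)
  set c : Fin k → C(Icc t₀ t₁, Fin n → ℝ) := fun i => ContinuousMap.const _ (a i) + prim t₀ t₁ (ψ i) with hcdef
  have hid1 : ∀ z, ∑ i, (β i + B z i) • (f' (ends ht.le (S (c i))) + sl i) =
      -((1/2:ℝ) • bf + f' (ends ht.le (S (prim t₀ t₁ Q2))) + (fun _ => δ)) + z.1 := fun z => by
    have := congrArg Prod.fst (hid z)
    rw [Prod.fst_sum] at this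
    exact this
  have hid2 : ∀ z, ∑ i, (β i + B z i) • (g' (ends ht.le (S (c i)))) =
      -((1/2:ℝ) • bg + g' (ends ht.le (S (prim t₀ t₁ Q2)))) + z.2 := fun z => by
    have := congrArg Prod.snd (hid z)
    rw [Prod.snd_sum] at this
    exact this
  let Bz : (Fin m₂ → ℝ) →L[ℝ] (Fin k → ℝ) := B.comp (ContinuousLinearMap.inr ℝ _ _)
  have hBz : ∀ z, Bz z = B (0, z) := fun z => rfl
  let W : (Fin m₂ → ℝ) →L[ℝ] C(Icc t₀ t₁, Fin n → ℝ) :=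
    ∑ i, ((ContinuousLinearMap.proj (R := ℝ) (φ := fun _ : Fin k => ℝ) i).comp Bz).smulRight (c i)
  have hW : ∀ z, W z = ∑ i, Bz z i • c i := fun z => by
    simp [W]
  have he : ∀ z, (g'.comp (ends ht.le)) (S (W z)) = z := by
    intro z
    have h1 := hid2 (0, z)
    have h0 := hid2 0
    simp only [add_smul, Finset.sum_add_distrib, map_zero, Pi.zero_apply, zero_smul,
      Finset.sum_const_zero, add_zero, Prod.snd_zero] at h1 h0
    rw [h0] at h1
    rw [hW, map_sum, map_sum]
    simp only [map_smul, ContinuousLinearMap.comp_apply, hBz]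
    exact add_left_cancel h1
  obtain ⟨cc, hcc, Hs⟩ := solve_abstract K S hS W (g'.comp (ends ht.le)) he
  set ξ₀ := S (∑ i, β i • c i + prim t₀ t₁ Q2) with hξ₀
  have hξ₀K : ξ₀ - K ξ₀ = ∑ i, β i • c i + prim t₀ t₁ Q2 := hS _
  set F := f'.comp (ends ht.le) with hF
  have hF0 : ∀ j, act j → (F ξ₀ + (1/2:ℝ) • bf) j ≤ -δ := by
    intro j hj
    have h0 := congrFun (hid1 0) j
    simp only [map_zero, Pi.zero_apply, add_zero, Prod.fst_zero, smul_add, Finset.sum_add_distrib] at h0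
    have e1 : F ξ₀ = ∑ i, β i • f' (ends ht.le (S (c i))) + f' (ends ht.le (S (prim t₀ t₁ Q2))) := by
      rw [hξ₀, map_add, map_add, map_sum, map_sum]
      simp only [map_smul, hF, ContinuousLinearMap.comp_apply]
    have h2 : 0 ≤ (∑ i, β i • sl i) j := by
      rw [Finset.sum_apply]
      refine Finset.sum_nonneg fun i _ => ?_
      have := hpos 0 (by simpa using hρc.le) i
      simp only [map_zero, Pi.zero_apply, add_zero] at this
      exact mul_nonneg this (hsl i j hj)
    rw [e1]
    simp only [Pi.add_apply, Pi.neg_apply] at h0 ⊢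
    linarith
  have hG0 : g' (ends ht.le ξ₀) + (1/2:ℝ) • bg = 0 := by
    have h0 := hid2 0
    simp only [map_zero, Pi.zero_apply, add_zero, Prod.snd_zero] at h0
    have e1 : g' (ends ht.le ξ₀) = ∑ i, β i • g' (ends ht.le (S (c i))) + g' (ends ht.le (S (prim t₀ t₁ Q2))) := by
      rw [hξ₀, map_add, map_add, map_add, map_sum, map_sum, map_sum]
      simp only [map_smul]
    rw [e1, h0]
    abel
  set R := min ρc (δ / 2 / (‖F‖ + 1)) with hR
  have hF1 : 0 < ‖F‖ + 1 := by positivity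
  have hRpos : 0 < R := lt_min hρc (by positivity)
  have hRF : ‖F‖ * R ≤ δ / 2 := by
    have h1 : R ≤ δ / 2 / (‖F‖ + 1) := min_le_right _ _
    rw [le_div_iff₀ hF1] at h1
    nlinarith [norm_nonneg F]
  set αm := ‖β‖ + ‖Bz‖ * R with hαm
  have hαm0 : 0 ≤ αm := by positivity
  set T := t₁ - t₀ with hT
  have hT0 : 0 < T := sub_pos.2 ht
  set Mt := T + k * (αm * T + ‖Bz‖ * (T + 1) + αm * (T + 1)) + 2 with hMt
  have hMt0 : 0 < Mt := by positivity
  set η := min cc (cc * R) / Mt with hη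
  have hη0 : 0 < η := div_pos (lt_min hcc (by positivity)) hMt0
  have hηM : η * Mt = min cc (cc * R) := div_mul_cancel₀ _ hMt0.ne'
  obtain ⟨m, hm, hmix⟩ := exists_mix ht ψ hψ M hM hη0
  refine ⟨αm, ‖ξ₀‖ + R, η, η, hαm0, by positivity, hη0, hη0, m, hm, ?_⟩
  intro e Θ ω G he0 heα hE hG1 hG2 y hy
  let al : (Fin m₂ → ℝ) → Fin k → ℝ := fun z i => β i + Bz z i
  have hal : ∀ z, ‖z‖ ≤ R → ∀ i, 0 ≤ al z i ∧ al z i ≤ αm := by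
    intro z hz i
    refine ⟨hpos (0, z) ?_ i, ?_⟩
    · rw [Prod.norm_def]
      exact max_le (by simpa using hρc.le) (hz.trans (min_le_left _ _))
    · have h1 : β i ≤ ‖β‖ := (le_abs_self _).trans (norm_le_pi_norm β i)
      have h2 : Bz z i ≤ ‖Bz‖ * R := (le_abs_self _).trans ((norm_le_pi_norm (Bz z) i).trans
        ((Bz.le_opNorm z).trans (by gcongr)))
      exact add_le_add h1 h2
  have hnorm : ∀ ξ : C(Icc t₀ t₁, Fin n → ℝ), ‖ξ - ξ₀‖ ≤ R → ‖ξ‖ ≤ ‖ξ₀‖ + R := fun ξ h => by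
    have := norm_add_le ξ₀ (ξ - ξ₀)
    rw [add_sub_cancel] at this
    linarith
  let Ψ : C(Icc t₀ t₁, Fin n → ℝ) → (Fin m₂ → ℝ) → C(Icc t₀ t₁, Fin n → ℝ) := fun ξ z =>
    ξ - ∑ i, al z i • ContinuousMap.const _ (a i) - prim t₀ t₁ (NN m e Θ ω (al z) (ext ht.le ξ))
  obtain ⟨ξ, z, h1, h2, h3, h4⟩ := Hs ξ₀ R Ψ (fun ξ => G (ends ht.le ξ)) hRpos.le (by
    intro ξ z ξ' z' b1 b2 b3 b4
    constructor
    · have hd := NN_diff ht hm hψi hmix hA hL hK hQi hη0.le hη0.le he0 heα hE (al z) (al z')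
        (hal z b2) (hal z' b4) ξ ξ' (hnorm ξ b1) (hnorm ξ' b3)
      have e1 : Ψ ξ z - Ψ ξ' z' - ((ξ - ξ') - K (ξ - ξ') - W (z - z')) =
          -(prim t₀ t₁ (NN m e Θ ω (al z) (ext ht.le ξ)) - prim t₀ t₁ (NN m e Θ ω (al z') (ext ht.le ξ'))
            - K (ξ - ξ') - ∑ i, (al z i - al z' i) • prim t₀ t₁ (ψ i)) := by
        have : ∀ i, al z i - al z' i = Bz (z - z') i := fun i => by
          simp only [al, map_sub, Pi.sub_apply]; ring
        have e2 : W (z - z') = (∑ i, al z i • ContinuousMap.const _ (a i) -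
            ∑ i, al z' i • ContinuousMap.const _ (a i)) + ∑ i, (al z i - al z' i) • prim t₀ t₁ (ψ i) := by
          rw [hW, ← Finset.sum_sub_distrib, ← Finset.sum_add_distrib]
          refine Finset.sum_congr rfl fun i _ => ?_
          rw [← this, hcdef, smul_add, sub_smul, sub_smul]
        rw [e2]
        simp only [Ψ]
        abel
      rw [e1, norm_neg]
      refine hd.trans ?_
      set D := max ‖ξ - ξ'‖ ‖z - z'‖ with hD
      have hD0 : 0 ≤ D := le_max_of_le_left (norm_nonneg _)
      have hs : ∀ i ∈ Finset.univ, αm * T * η * ‖ξ - ξ'‖ + |al z i - al z' i| * (T * η + η) ≤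
          αm * T * η * D + (‖Bz‖ * D) * (T * η + η) := by
        intro i _
        have : |al z i - al z' i| ≤ ‖Bz‖ * D := by
          have e3 : al z i - al z' i = Bz (z - z') i := by
            simp only [al, map_sub, Pi.sub_apply]; ring
          rw [e3]
          exact (norm_le_pi_norm (Bz (z - z')) i).trans ((Bz.le_opNorm _).trans
            (mul_le_mul_of_nonneg_left (le_max_right _ _) (norm_nonneg _)))
        gcongr
        exact le_max_left _ _
      have h5 : T * η * ‖ξ - ξ'‖ ≤ T * η * D := by gcongr; exact le_max_left _ _
      have h6 := Finset.sum_le_sum hs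
      rw [Finset.sum_const, Finset.card_univ, Fintype.card_fin, nsmul_eq_mul] at h6
      have h7 : η * Mt ≤ cc := hηM ▸ min_le_left _ _
      calc _ ≤ T * η * D + k * (αm * T * η * D + ‖Bz‖ * D * (T * η + η)) := add_le_add h5 h6
        _ = (η * (T + k * (αm * T + ‖Bz‖ * (T + 1)))) * D := by ring
        _ ≤ (η * Mt) * D := by
          gcongr
          rw [hMt]
          have : 0 ≤ (k:ℝ) * (αm * (T + 1)) := by positivity
          nlinarith
        _ ≤ cc * D := by gcongr
    · have := hG1 (ends ht.le ξ) (ends ht.le ξ') ((ends_norm _ _).trans (hnorm ξ b1))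
        ((ends_norm _ _).trans (hnorm ξ' b3))
      rw [← map_sub] at this
      refine this.trans ?_
      have h7 : η * Mt ≤ cc := hηM ▸ min_le_left _ _
      have h8 : η ≤ cc := by
        have : 1 ≤ Mt := by
          have : 0 ≤ (k:ℝ) * (αm * T + ‖Bz‖ * (T + 1) + αm * (T + 1)) := by positivity
          linarith
        nlinarith
      exact mul_le_mul h8 (ends_norm _ _) (norm_nonneg _) hcc.le) y (by
    have hb := NN_base ht hm hψi hmix hA hL hK hQi hη0.le hη0.le he0 heα hE (al 0)
        (hal 0 (by simpa using hRpos.le)) ξ₀ (hnorm ξ₀ (by simpa using hRpos.le))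
    have e1 : Ψ ξ₀ 0 = -(prim t₀ t₁ (NN m e Θ ω (al 0) (ext ht.le ξ₀)) - K ξ₀ - prim t₀ t₁ Q2
      - ∑ i, al 0 i • prim t₀ t₁ (ψ i)) := by
      have ha0 : ∀ i, al 0 i = β i := fun i => by simp [al]
      have e2 : ξ₀ = K ξ₀ + (∑ i, al 0 i • ContinuousMap.const _ (a i) + ∑ i, al 0 i • prim t₀ t₁ (ψ i))
          + prim t₀ t₁ Q2 := by
        rw [← Finset.sum_add_distrib]
        have : ∑ i, (al 0 i • ContinuousMap.const _ (a i) + al 0 i • prim t₀ t₁ (ψ i)) = ∑ i, β i • c i :=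
          Finset.sum_congr rfl fun i _ => by rw [← smul_add, ha0]
        rw [this, add_assoc, ← hξ₀K]
        abel
      simp only [Ψ]
      generalize prim t₀ t₁ (NN m e Θ ω (al 0) (ext ht.le ξ₀)) = P
      calc _ = (K ξ₀ + (∑ i, al 0 i • ContinuousMap.const _ (a i) + ∑ i, al 0 i • prim t₀ t₁ (ψ i))
          + prim t₀ t₁ Q2) - ∑ i, al 0 i • ContinuousMap.const _ (a i) - P := by rw [← e2]
        _ = _ := by abel
    rw [e1, norm_neg]
    refine hb.trans ?_
    rw [Finset.sum_const, Finset.card_univ, Fintype.card_fin, nsmul_eq_mul]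
    have h7 : η * Mt ≤ cc * R := hηM ▸ min_le_right _ _
    refine le_trans ?_ h7
    have h9 : 0 ≤ (k:ℝ) * (αm * T + ‖Bz‖ * (T + 1)) := by positivity
    calc T * η + k * (αm * (T * η + η)) = η * (T + k * (αm * (T + 1))) := by ring
      _ ≤ η * Mt := by
        gcongr
        rw [hMt]
        nlinarith) (by
    have hb := hG2 (ends ht.le ξ₀) ((ends_norm _ _).trans (hnorm ξ₀ (by simpa using hRpos.le)))
    have e1 : y - G (ends ht.le ξ₀) = y - (G (ends ht.le ξ₀) - g' (ends ht.le ξ₀) - (1/2:ℝ) • bg) -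
        (g' (ends ht.le ξ₀) + (1/2:ℝ) • bg) := by abel
    rw [e1, hG0, sub_zero]
    have h7 : η * Mt ≤ cc * R := hηM ▸ min_le_right _ _
    refine (norm_sub_le _ _).trans (le_trans ?_ h7)
    have h9 : 0 ≤ (k:ℝ) * (αm * T + ‖Bz‖ * (T + 1) + αm * (T + 1)) := by positivity
    nlinarith)
  obtain ⟨_, _, _, i4, _⟩ := NN_int ht hm hψi hA hL hQi e hE (al z) ξ (hnorm ξ h1)
  refine ⟨ξ, al z, hnorm ξ h1, hal z h2, i4, ⟨∑ i, al z i • a i, fun t => ?_⟩, h4, fun j hj => ?_⟩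
  · have h5 : ξ = ∑ i, al z i • ContinuousMap.const _ (a i) + prim t₀ t₁ (NN m e Θ ω (al z) (ext ht.le ξ)) := by
      have : ξ - (∑ i, al z i • ContinuousMap.const _ (a i) + prim t₀ t₁ (NN m e Θ ω (al z) (ext ht.le ξ))) = 0 := by
        rw [← sub_sub]; exact h3
      exact sub_eq_zero.1 this
    have h6 := congrArg (fun x : C(Icc t₀ t₁, Fin n → ℝ) => x t) h5
    simp only [ContinuousMap.add_apply, ContinuousMap.coe_sum, Finset.sum_apply, ContinuousMap.coe_smul,
      Pi.smul_apply, ContinuousMap.const_apply] at h6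
    rw [h6, prim_apply i4]
  · have h5 : F ξ = F ξ₀ + F (ξ - ξ₀) := by rw [← map_add, add_sub_cancel]
    have h6 : F (ξ - ξ₀) j ≤ δ / 2 := (le_abs_self _).trans ((norm_le_pi_norm (F (ξ - ξ₀)) j).trans
      ((F.le_opNorm _).trans ((mul_le_mul_of_nonneg_left h1 (norm_nonneg _)).trans hRF)))
    have h7 := hF0 j hj
    change (F ξ + (1/2:ℝ) • bf) j ≤ _
    rw [h5]
    simp only [Pi.add_apply] at h7 ⊢
    linarith

end solve
end ODEC

end Part9

section Part10

open Set Topology Filter MeasureTheory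
set_option linter.unusedSectionVars false
set_option linter.unusedVariables false

namespace ODEC
section taylor
variable {P E : Type*} [NormedAddCommGroup P] [NormedSpace ℝ P] [NormedAddCommGroup E] [NormedSpace ℝ E]

lemma taylor1 {F : P → E} {w₀ : P} {r η : ℝ} (hd : ∀ w ∈ Metric.closedBall w₀ r, DifferentiableAt ℝ F w)
    (hη : ∀ w ∈ Metric.closedBall w₀ r, ‖fderiv ℝ F w - fderiv ℝ F w₀‖ ≤ η) {w w' : P}
    (hw : w ∈ Metric.closedBall w₀ r) (hw' : w' ∈ Metric.closedBall w₀ r) :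
    ‖F w - F w' - fderiv ℝ F w₀ (w - w')‖ ≤ η * ‖w - w'‖ :=
  (convex_closedBall w₀ r).norm_image_sub_le_of_norm_fderiv_le' hd hη hw' hw

lemma taylor2 {F : P → E} {w₀ : P} {r η : ℝ} (hd : ∀ w ∈ Metric.closedBall w₀ r, DifferentiableAt ℝ F w)
    (hd2 : ∀ w ∈ Metric.closedBall w₀ r, DifferentiableAt ℝ (fderiv ℝ F) w)
    (hη : ∀ w ∈ Metric.closedBall w₀ r, ‖fderiv ℝ (fderiv ℝ F) w - fderiv ℝ (fderiv ℝ F) w₀‖ ≤ η) {k : P}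
    (hk : ‖k‖ ≤ r) :
    ‖F (w₀ + k) - F w₀ - fderiv ℝ F w₀ k - (1/2:ℝ) • fderiv ℝ (fderiv ℝ F) w₀ k k‖ ≤ η * ‖k‖ ^ 2 := by
  have hr : 0 ≤ r := (norm_nonneg _).trans hk
  have hη0 : 0 ≤ η := le_trans (norm_nonneg (fderiv ℝ (fderiv ℝ F) w₀ - fderiv ℝ (fderiv ℝ F) w₀)) (hη w₀ (Metric.mem_closedBall_self hr))
  have hmem : ∀ τ ∈ Icc (0:ℝ) 1, w₀ + τ • k ∈ Metric.closedBall w₀ r := by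
    intro τ hτ
    rw [Metric.mem_closedBall, dist_eq_norm, add_sub_cancel_left, norm_smul, Real.norm_eq_abs,
      abs_of_nonneg hτ.1]
    exact (mul_le_of_le_one_left (norm_nonneg _) hτ.2).trans hk
  let φ : ℝ → E := fun τ => F (w₀ + τ • k) - τ • fderiv ℝ F w₀ k - (τ ^ 2 / 2) • fderiv ℝ (fderiv ℝ F) w₀ k k
  let φ' : ℝ → E := fun τ => fderiv ℝ F (w₀ + τ • k) k - fderiv ℝ F w₀ k - τ • fderiv ℝ (fderiv ℝ F) w₀ k k
  have hder : ∀ τ ∈ Icc (0:ℝ) 1, HasDerivWithinAt φ (φ' τ) (Icc 0 1) τ := by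
    intro τ hτ
    have h1 : HasDerivAt (fun τ : ℝ => w₀ + τ • k) k τ := by
      simpa using ((hasDerivAt_id τ).smul_const k).const_add w₀
    have h2 : HasDerivAt (fun τ : ℝ => F (w₀ + τ • k)) (fderiv ℝ F (w₀ + τ • k) k) τ :=
      (hd _ (hmem τ hτ)).hasFDerivAt.comp_hasDerivAt τ h1
    have h3 : HasDerivAt (fun τ : ℝ => τ • fderiv ℝ F w₀ k) (fderiv ℝ F w₀ k) τ := by
      simpa using (hasDerivAt_id τ).smul_const (fderiv ℝ F w₀ k)
    have h4 : HasDerivAt (fun τ : ℝ => (τ ^ 2 / 2) • fderiv ℝ (fderiv ℝ F) w₀ k k)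
        (τ • fderiv ℝ (fderiv ℝ F) w₀ k k) τ := by
      have : HasDerivAt (fun τ : ℝ => τ ^ 2 / 2) τ τ := by
        have h5 := (hasDerivAt_pow 2 τ).div_const 2
        have e : τ = ((2:ℕ):ℝ) * τ ^ (2 - 1) / 2 := by norm_num
        exact h5.congr_deriv e.symm
      exact this.smul_const _
    exact ((h2.sub h3).sub h4).hasDerivWithinAt
  have hb : ∀ τ ∈ Ico (0:ℝ) 1, ‖φ' τ‖ ≤ η * ‖k‖ ^ 2 := by
    intro τ hτ
    have hτ' : τ ∈ Icc (0:ℝ) 1 := ⟨hτ.1, hτ.2.le⟩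
    have h1 := taylor1 (F := fderiv ℝ F) hd2 hη (hmem τ hτ') (Metric.mem_closedBall_self hr)
    rw [add_sub_cancel_left] at h1
    have e1 : φ' τ = (fderiv ℝ F (w₀ + τ • k) - fderiv ℝ F w₀ - fderiv ℝ (fderiv ℝ F) w₀ (τ • k)) k := by
      simp [φ']
    rw [e1]
    refine (ContinuousLinearMap.le_opNorm _ _).trans ?_
    have h2 : ‖τ • k‖ ≤ ‖k‖ := by
      rw [norm_smul, Real.norm_eq_abs, abs_of_nonneg hτ.1]
      exact mul_le_of_le_one_left (norm_nonneg _) hτ.2.le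
    calc _ ≤ (η * ‖τ • k‖) * ‖k‖ := by gcongr
      _ ≤ (η * ‖k‖) * ‖k‖ := by gcongr
      _ = _ := by ring
  have h := norm_image_sub_le_of_norm_deriv_le_segment_01' hder hb
  have e : φ 1 - φ 0 = F (w₀ + k) - F w₀ - fderiv ℝ F w₀ k - (1/2:ℝ) • fderiv ℝ (fderiv ℝ F) w₀ k k := by
    simp [φ]
    abel
  rwa [e] at h

/-- the ball condition -/
lemma scaled_mem {w₀ q ζ : P} {ε Cq ρ r : ℝ} (hε : 0 < ε) (hε1 : ε ≤ 1) (hq : ‖q‖ ≤ Cq) (hζ : ‖ζ‖ ≤ ρ)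
    (hr : ε * (Cq + ρ) ≤ r) : ‖ε • q + ε ^ 2 • ζ‖ ≤ ε * (Cq + ρ) ∧
      w₀ + (ε • q + ε ^ 2 • ζ) ∈ Metric.closedBall w₀ r := by
  have hρ : 0 ≤ ρ := (norm_nonneg _).trans hζ
  have h1 : ‖ε • q + ε ^ 2 • ζ‖ ≤ ε * (Cq + ρ) := by
    refine (norm_add_le _ _).trans ?_
    rw [norm_smul, norm_smul, Real.norm_eq_abs, Real.norm_eq_abs, abs_of_pos hε, abs_of_pos (pow_pos hε 2)]
    have h2 : ε ^ 2 ≤ ε := by nlinarith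
    calc ε * ‖q‖ + ε ^ 2 * ‖ζ‖ ≤ ε * Cq + ε * ρ := by gcongr
      _ = _ := by ring
  refine ⟨h1, ?_⟩
  rw [Metric.mem_closedBall, dist_eq_norm, add_sub_cancel_left]
  exact h1.trans hr

lemma scaled1 {F : P → E} {w₀ : P} {r η : ℝ} (hd : ∀ w ∈ Metric.closedBall w₀ r, DifferentiableAt ℝ F w)
    (hη : ∀ w ∈ Metric.closedBall w₀ r, ‖fderiv ℝ F w - fderiv ℝ F w₀‖ ≤ η)
    {q ζ ζ' : P} {ε Cq ρ : ℝ} (hε : 0 < ε) (hε1 : ε ≤ 1) (hq : ‖q‖ ≤ Cq) (hζ : ‖ζ‖ ≤ ρ) (hζ' : ‖ζ'‖ ≤ ρ)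
    (hr : ε * (Cq + ρ) ≤ r) :
    ‖F (w₀ + (ε • q + ε ^ 2 • ζ)) - F (w₀ + (ε • q + ε ^ 2 • ζ')) - ε ^ 2 • fderiv ℝ F w₀ (ζ - ζ')‖
      ≤ ε ^ 2 * (η * ‖ζ - ζ'‖) := by
  have h := taylor1 hd hη (scaled_mem (w₀ := w₀) hε hε1 hq hζ hr).2 (scaled_mem (w₀ := w₀) hε hε1 hq hζ' hr).2
  have e1 : w₀ + (ε • q + ε ^ 2 • ζ) - (w₀ + (ε • q + ε ^ 2 • ζ')) = ε ^ 2 • (ζ - ζ') := by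
    rw [smul_sub]; abel
  rw [e1, map_smul, norm_smul, Real.norm_eq_abs, abs_of_pos (pow_pos hε 2)] at h
  linarith

lemma scaled2 {F : P → E} {w₀ : P} {r η M : ℝ} (hd : ∀ w ∈ Metric.closedBall w₀ r, DifferentiableAt ℝ F w)
    (hd2 : ∀ w ∈ Metric.closedBall w₀ r, DifferentiableAt ℝ (fderiv ℝ F) w)
    (hη : ∀ w ∈ Metric.closedBall w₀ r, ‖fderiv ℝ (fderiv ℝ F) w - fderiv ℝ (fderiv ℝ F) w₀‖ ≤ η)
    (hM : ‖fderiv ℝ (fderiv ℝ F) w₀‖ ≤ M)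
    {q ζ : P} {ε Cq ρ : ℝ} (hε : 0 < ε) (hε1 : ε ≤ 1) (hq : ‖q‖ ≤ Cq) (hζ : ‖ζ‖ ≤ ρ)
    (hr : ε * (Cq + ρ) ≤ r) :
    ‖F (w₀ + (ε • q + ε ^ 2 • ζ)) - F w₀ - ε • fderiv ℝ F w₀ q - ε ^ 2 • fderiv ℝ F w₀ ζ -
        ε ^ 2 • (1/2:ℝ) • fderiv ℝ (fderiv ℝ F) w₀ q q‖
      ≤ ε ^ 2 * ((η + ε * M) * (Cq + ρ) ^ 2) := by
  have hs := scaled_mem (w₀ := w₀) hε hε1 hq hζ hr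
  have hCq : 0 ≤ Cq := (norm_nonneg _).trans hq
  have hρ : 0 ≤ ρ := (norm_nonneg _).trans hζ
  have hr0 : 0 ≤ r := le_trans (by positivity) hr
  have hM0 : 0 ≤ M := le_trans (norm_nonneg (fderiv ℝ (fderiv ℝ F) w₀)) hM
  have hη0 : 0 ≤ η := le_trans (norm_nonneg (fderiv ℝ (fderiv ℝ F) w₀ - fderiv ℝ (fderiv ℝ F) w₀)) (hη w₀ (Metric.mem_closedBall_self hr0))
  have h := taylor2 hd hd2 hη (hs.1.trans hr)
  set D := fderiv ℝ (fderiv ℝ F) w₀ with hD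
  set k := ε • q + ε ^ 2 • ζ with hk
  have hDb : ∀ a b, ‖D a b‖ ≤ M * ‖a‖ * ‖b‖ := fun a b =>
    (D.le_opNorm₂ a b).trans (by gcongr)
  have e1 : F (w₀ + k) - F w₀ - ε • fderiv ℝ F w₀ q - ε ^ 2 • fderiv ℝ F w₀ ζ -
        ε ^ 2 • (1/2:ℝ) • D q q = (F (w₀ + k) - F w₀ - fderiv ℝ F w₀ k - (1/2:ℝ) • D k k) +
        ((ε ^ 3 / 2) • (D q ζ + D ζ q) + (ε ^ 4 / 2) • D ζ ζ) := by
    rw [hk]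
    simp only [map_add, map_smul, _root_.add_apply, _root_.smul_apply]
    module
  rw [e1]
  have n1 : ‖(ε ^ 3 / 2) • (D q ζ + D ζ q)‖ ≤ ε ^ 3 * (M * (Cq * ρ)) := by
    rw [norm_smul, Real.norm_eq_abs, abs_of_pos (by positivity)]
    have a1 : ‖D q ζ‖ ≤ M * (Cq * ρ) := (hDb q ζ).trans (by rw [mul_assoc]; gcongr)
    have a2 : ‖D ζ q‖ ≤ M * (Cq * ρ) := (hDb ζ q).trans (by rw [mul_assoc, mul_comm Cq]; gcongr)
    calc ε ^ 3 / 2 * ‖D q ζ + D ζ q‖ ≤ ε ^ 3 / 2 * (M * (Cq * ρ) + M * (Cq * ρ)) := by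
          gcongr; exact (norm_add_le _ _).trans (add_le_add a1 a2)
      _ = _ := by ring
  have n2 : ‖(ε ^ 4 / 2) • D ζ ζ‖ ≤ ε ^ 3 * (M * ρ ^ 2) := by
    rw [norm_smul, Real.norm_eq_abs, abs_of_pos (by positivity)]
    have a1 : ‖D ζ ζ‖ ≤ M * ρ ^ 2 := (hDb ζ ζ).trans (by rw [mul_assoc, pow_two]; gcongr)
    have : ε ^ 4 / 2 ≤ ε ^ 3 := by
      have : ε ^ 4 ≤ ε ^ 3 := pow_le_pow_of_le_one hε.le hε1 (by norm_num)
      have := pow_pos hε 3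
      linarith
    gcongr
  have n3 : η * ‖k‖ ^ 2 ≤ η * (ε * (Cq + ρ)) ^ 2 := by
    gcongr
    exact hs.1
  calc _ ≤ η * (ε * (Cq + ρ)) ^ 2 + (ε ^ 3 * (M * (Cq * ρ)) + ε ^ 3 * (M * ρ ^ 2)) :=
        (norm_add_le _ _).trans (add_le_add (h.trans n3) ((norm_add_le _ _).trans (add_le_add n1 n2)))
    _ ≤ _ := by
      have : 0 ≤ ε ^ 3 * (M * (Cq ^ 2 + Cq * ρ)) := by positivity
      nlinarith

end taylor

/-- uniform closeness near a compact set -/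
lemma unif_near {α β : Type*} [PseudoMetricSpace α] [NormedAddCommGroup β] {D C : Set α} (hD : IsOpen D)
    (hC : IsCompact C) (hCD : C ⊆ D) {f : α → β} (hf : ContinuousOn f D) {η : ℝ} (hη : 0 < η) :
    ∃ r > (0:ℝ), ∀ p ∈ C, ∀ q, dist q p ≤ r → q ∈ D ∧ ‖f q - f p‖ ≤ η := by
  have h1 := hC.uniformContinuousAt_of_continuousAt f
    (fun a ha => (hf a (hCD ha)).continuousAt (hD.mem_nhds (hCD ha))) (Metric.dist_mem_uniformity hη)
  obtain ⟨r₁, hr₁, H1⟩ := Metric.mem_uniformity_dist.1 h1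
  obtain ⟨r₂, hr₂, H2⟩ := hC.exists_cthickening_subset_open hD hCD
  refine ⟨min (r₁ / 2) r₂, by positivity, fun p hp q hq => ⟨H2 ?_, ?_⟩⟩
  · exact Metric.mem_cthickening_of_dist_le q p _ _ hp (hq.trans (min_le_right _ _))
  · have h2 : dist p q < r₁ := by
      rw [dist_comm]
      have := hq.trans (min_le_left _ _)
      linarith
    have := H1 h2 hp
    simp only [mem_ofPred_eq] at this
    rw [dist_comm, dist_eq_norm] at this
    exact this.le
end ODEC

end Part10

section Part11

open Set Topology Filter MeasureTheory
set_option linter.unusedSectionVars false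
set_option linter.unusedVariables false

namespace ODEC

lemma sm_comp {α β : Type*} [TopologicalSpace α] [MeasurableSpace α] [OpensMeasurableSpace α]
    [SecondCountableTopology α] [TopologicalSpace β] [TopologicalSpace.PseudoMetrizableSpace β]
    {D : Set α} {F : α → β} (hF : ContinuousOn F D)
    {γ : ℝ → α} (hγ : Measurable γ) (hD : ∀ s, γ s ∈ D) : StronglyMeasurable fun s => F (γ s) := by
  have h1 : Continuous (D.domRestrict F) := continuousOn_iff_continuous_domRestrict.1 hF
  have h2 : Measurable fun s => (⟨γ s, hD s⟩ : D) := hγ.subtype_mk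
  exact h1.stronglyMeasurable.comp_measurable h2

section loc
variable {P E : Type*} [NormedAddCommGroup P] [NormedSpace ℝ P] [NormedAddCommGroup E] [NormedSpace ℝ E]

set_option maxHeartbeats 1000000 in
lemma loc_est (F : ℝ → P → E) {D C : Set (ℝ × P)} (hD : IsOpen D) (hC : IsCompact C) (hCD : C ⊆ D)
    (h0 : ContinuousOn (fun p : ℝ × P => F p.1 p.2) D)
    (h1 : ContinuousOn (fun p : ℝ × P => fderiv ℝ (F p.1) p.2) D)
    (h2 : ContinuousOn (fun p : ℝ × P => fderiv ℝ (fderiv ℝ (F p.1)) p.2) D)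
    (hd : ∀ p ∈ D, DifferentiableAt ℝ (F p.1) p.2)
    (hd2 : ∀ p ∈ D, DifferentiableAt ℝ (fderiv ℝ (F p.1)) p.2)
    {Cq ρ η : ℝ} (hCq : 0 ≤ Cq) (hρ : 0 ≤ ρ) (hη : 0 < η) :
    ∃ ε₀ > (0:ℝ), ε₀ ≤ 1 ∧ ∀ ε, 0 < ε → ε < ε₀ → ∀ p ∈ C, ∀ q, ‖q‖ ≤ Cq → ∀ ζ, ‖ζ‖ ≤ ρ →
      (p.1, p.2 + (ε • q + ε ^ 2 • ζ)) ∈ D ∧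
      ‖F p.1 (p.2 + (ε • q + ε ^ 2 • ζ)) - F p.1 p.2‖ ≤ η ∧
      ‖F p.1 (p.2 + (ε • q + ε ^ 2 • ζ)) - F p.1 p.2 - ε • fderiv ℝ (F p.1) p.2 q
        - ε ^ 2 • fderiv ℝ (F p.1) p.2 ζ - ε ^ 2 • (1/2:ℝ) • fderiv ℝ (fderiv ℝ (F p.1)) p.2 q q‖ ≤ ε ^ 2 * η ∧
      ∀ ζ', ‖ζ'‖ ≤ ρ →
        ‖F p.1 (p.2 + (ε • q + ε ^ 2 • ζ)) - F p.1 (p.2 + (ε • q + ε ^ 2 • ζ'))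
          - ε ^ 2 • fderiv ℝ (F p.1) p.2 (ζ - ζ')‖ ≤ ε ^ 2 * (η * ‖ζ - ζ'‖) ∧
        ‖F p.1 (p.2 + (ε • q + ε ^ 2 • ζ)) - F p.1 (p.2 + (ε • q + ε ^ 2 • ζ'))‖ ≤ η * ‖ζ - ζ'‖ := by
  obtain ⟨M1, hM1⟩ := hC.exists_bound_of_continuousOn (h1.mono hCD)
  have hM2' : ∃ M2, ∀ p ∈ C, ‖fderiv ℝ (fderiv ℝ (F p.1)) p.2‖ ≤ M2 :=
    IsCompact.exists_bound_of_continuousOn (E := P →L[ℝ] P →L[ℝ] E) hC (h2.mono hCD)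
  obtain ⟨M2, hM2⟩ := hM2'
  set N1 := max M1 0 with hN1
  set N2 := max M2 0 with hN2
  have hN10 : 0 ≤ N1 := le_max_right _ _
  have hN20 : 0 ≤ N2 := le_max_right _ _
  set S := (Cq + ρ) ^ 2 + 1 with hS
  have hS0 : 0 < S := by positivity
  obtain ⟨r0, hr0, H0⟩ := unif_near hD hC hCD h0 hη
  obtain ⟨r1, hr1, H1⟩ := unif_near hD hC hCD h1 hη
  obtain ⟨r2, hr2, H2⟩ := unif_near (β := P →L[ℝ] P →L[ℝ] E) hD hC hCD h2 (η := η / (2 * S)) (by positivity)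
  set r := min r0 (min r1 r2) with hr
  have hrpos : 0 < r := lt_min hr0 (lt_min hr1 hr2)
  refine ⟨min 1 (min (r / (Cq + ρ + 1)) (min (η / (2 * (N2 + 1) * S)) (η / (N1 + η)))), ?_, min_le_left _ _, ?_⟩
  · refine lt_min one_pos (lt_min ?_ (lt_min ?_ ?_)) <;> positivity
  intro ε hε hεlt p hp q hq ζ hζ
  simp only [lt_min_iff] at hεlt
  obtain ⟨hε1, hε2, hε3, hε4⟩ := hεlt
  rw [lt_div_iff₀ (by positivity)] at hε2 hε3 hε4
  have hball : ε * (Cq + ρ) ≤ r := by nlinarith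
  have hdist : ∀ w ∈ Metric.closedBall p.2 r, dist ((p.1, w) : ℝ × P) p ≤ r := by
    intro w hw
    rw [Prod.dist_eq]
    exact max_le (by simpa using hrpos.le) hw
  have K0 : ∀ w ∈ Metric.closedBall p.2 r, (p.1, w) ∈ D ∧ ‖F p.1 w - F p.1 p.2‖ ≤ η := fun w hw =>
    H0 p hp (p.1, w) ((hdist w hw).trans (min_le_left _ _))
  have K1 : ∀ w ∈ Metric.closedBall p.2 r, ‖fderiv ℝ (F p.1) w - fderiv ℝ (F p.1) p.2‖ ≤ η := fun w hw =>
    (H1 p hp (p.1, w) ((hdist w hw).trans ((min_le_right _ _).trans (min_le_left _ _)))).2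
  have K2 : ∀ w ∈ Metric.closedBall p.2 r,
      ‖fderiv ℝ (fderiv ℝ (F p.1)) w - fderiv ℝ (fderiv ℝ (F p.1)) p.2‖ ≤ η / (2 * S) := fun w hw =>
    (H2 p hp (p.1, w) ((hdist w hw).trans ((min_le_right _ _).trans (min_le_right _ _)))).2
  have D1 : ∀ w ∈ Metric.closedBall p.2 r, DifferentiableAt ℝ (F p.1) w := fun w hw => hd _ (K0 w hw).1
  have D2 : ∀ w ∈ Metric.closedBall p.2 r, DifferentiableAt ℝ (fderiv ℝ (F p.1)) w := fun w hw => hd2 _ (K0 w hw).1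
  have hmem := (scaled_mem (w₀ := p.2) hε hε1.le hq hζ hball).2
  refine ⟨(K0 _ hmem).1, (K0 _ hmem).2, ?_, fun ζ' hζ' => ?_⟩
  · refine (scaled2 D1 D2 K2 ((hM2 p hp).trans (le_max_left _ _) : _ ≤ N2) hε hε1.le hq hζ hball).trans ?_
    refine mul_le_mul_of_nonneg_left ?_ (by positivity)
    have a1 : (Cq + ρ) ^ 2 ≤ S := by linarith
    have a2 : ε * N2 * S ≤ η / 2 := by
      have : 0 ≤ ε * S := by positivity
      nlinarith
    have a3 : η / (2 * S) * S = η / 2 := by field_simp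
    have a4 : 0 ≤ η / (2 * S) + ε * N2 := by positivity
    calc (η / (2 * S) + ε * N2) * (Cq + ρ) ^ 2 ≤ (η / (2 * S) + ε * N2) * S := by gcongr
      _ = η / (2 * S) * S + ε * N2 * S := by ring
      _ ≤ η := by rw [a3]; linarith
  · have s1 := scaled1 D1 K1 hε hε1.le hq hζ hζ' hball
    refine ⟨s1, ?_⟩
    have a1 : ‖ε ^ 2 • fderiv ℝ (F p.1) p.2 (ζ - ζ')‖ ≤ ε ^ 2 * (N1 * ‖ζ - ζ'‖) := by
      rw [norm_smul, Real.norm_eq_abs, abs_of_pos (by positivity)]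
      refine mul_le_mul_of_nonneg_left ?_ (by positivity)
      exact (ContinuousLinearMap.le_of_opNorm_le _ ((hM1 p hp).trans (le_max_left _ _)) _)
    have a2 := norm_add_le (F p.1 (p.2 + (ε • q + ε ^ 2 • ζ)) - F p.1 (p.2 + (ε • q + ε ^ 2 • ζ'))
          - ε ^ 2 • fderiv ℝ (F p.1) p.2 (ζ - ζ')) (ε ^ 2 • fderiv ℝ (F p.1) p.2 (ζ - ζ'))
    rw [sub_add_cancel] at a2
    refine a2.trans ((add_le_add s1 a1).trans ?_)
    have a3 : ε ^ 2 * (N1 + η) ≤ η := by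
      have : ε ^ 2 ≤ ε := by nlinarith
      nlinarith
    calc _ = ε ^ 2 * (N1 + η) * ‖ζ - ζ'‖ := by ring
      _ ≤ η * ‖ζ - ζ'‖ := by gcongr

end loc

section est
variable {n r k : ℕ} {t₀ t₁ : ℝ}

/-- rescaled right hand side, smooth part -/
noncomputable def Th (F : ℝ → (Fin n → ℝ) × (Fin r → ℝ) → Fin n → ℝ) (w₀ q : ℝ → (Fin n → ℝ) × (Fin r → ℝ)) (ε : ℝ)
    (s : ℝ) (x : Fin n → ℝ) : Fin n → ℝ :=
  (ε ^ 2)⁻¹ • (F s (w₀ s + (ε • q s + ε ^ 2 • (x, 0))) - F s (w₀ s) - ε • fderiv ℝ (F s) (w₀ s) (q s))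

/-- rescaled right hand side, jumps -/
noncomputable def Om (F : ℝ → (Fin n → ℝ) × (Fin r → ℝ) → Fin n → ℝ) (w₀ q : ℝ → (Fin n → ℝ) × (Fin r → ℝ)) (ε : ℝ)
    (Es : Fin k → Set ℝ) (us : Fin k → Fin r → ℝ) (i : Fin k) (s : ℝ) (x : Fin n → ℝ) : Fin n → ℝ :=
  (Es i).indicator (fun s => F s (((w₀ s).1, us i) + (ε • ((q s).1, 0) + ε ^ 2 • (x, 0)))
    - F s (w₀ s + (ε • q s + ε ^ 2 • (x, 0)))) s

set_option maxHeartbeats 1000000 in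
lemma est_exists (U : Set (Fin r → ℝ)) (hU : IsOpen U)
    (F : ℝ → (Fin n → ℝ) × (Fin r → ℝ) → Fin n → ℝ)
    (h0 : ContinuousOn (fun p : ℝ × (Fin n → ℝ) × (Fin r → ℝ) => F p.1 p.2) {p | p.2.2 ∈ U})
    (h1 : ContinuousOn (fun p : ℝ × (Fin n → ℝ) × (Fin r → ℝ) => fderiv ℝ (F p.1) p.2) {p | p.2.2 ∈ U})
    (h2 : ContinuousOn (fun p : ℝ × (Fin n → ℝ) × (Fin r → ℝ) => fderiv ℝ (fderiv ℝ (F p.1)) p.2) {p | p.2.2 ∈ U})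
    (hd : ∀ p : ℝ × (Fin n → ℝ) × (Fin r → ℝ), p.2.2 ∈ U → DifferentiableAt ℝ (F p.1) p.2)
    (hd2 : ∀ p : ℝ × (Fin n → ℝ) × (Fin r → ℝ), p.2.2 ∈ U → DifferentiableAt ℝ (fderiv ℝ (F p.1)) p.2)
    (Kc : Set (Fin r → ℝ)) (hKc : IsCompact Kc) (hKU : Kc ⊆ U)
    (xh h : ℝ → Fin n → ℝ) (uh v : ℝ → Fin r → ℝ) (hx : Continuous xh) (hh : Continuous h)
    (hu : Measurable uh) (hv : Measurable v) (huK : ∀ s, uh s ∈ Kc) {Cq : ℝ} (hCq : 0 ≤ Cq)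
    (hvb : ∀ s, ‖v s‖ ≤ Cq) (hhb : ∀ s ∈ Icc t₀ t₁, ‖h s‖ ≤ Cq)
    (Es : Fin k → Set ℝ) (hEs : ∀ i, MeasurableSet (Es i)) (us : Fin k → Fin r → ℝ) (hus : ∀ i, us i ∈ U)
    {ρ η : ℝ} (hρ : 0 ≤ ρ) (hη : 0 < η) :
    ∃ ε₀ > (0:ℝ), ε₀ ≤ 1 ∧ ∀ ε, 0 < ε → ε < ε₀ → (∀ s, uh s + ε • v s ∈ U) ∧ 
      Est t₀ t₁ (fun s => (fderiv ℝ (F s) (xh s, uh s)).comp (ContinuousLinearMap.inl ℝ _ _))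
        (fun s => (1/2:ℝ) • fderiv ℝ (fderiv ℝ (F s)) (xh s, uh s) (h s, v s) (h s, v s))
        (fun i => (Es i).indicator fun s => F s (xh s, us i) - F s (xh s, uh s)) ρ η
        (Th F (fun s => (xh s, uh s)) (fun s => (h s, v s)) ε)
        (Om F (fun s => (xh s, uh s)) (fun s => (h s, v s)) ε Es us) := by
  have hD : IsOpen {p : ℝ × (Fin n → ℝ) × (Fin r → ℝ) | p.2.2 ∈ U} :=
    hU.preimage (continuous_snd.comp continuous_snd)
  set C : Set (ℝ × (Fin n → ℝ) × (Fin r → ℝ)) := Icc t₀ t₁ ×ˢ ((xh '' Icc t₀ t₁) ×ˢ (Kc ∪ range us)) with hC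
  have hCc : IsCompact C := isCompact_Icc.prod ((isCompact_Icc.image hx).prod
    (hKc.union (finite_range us).isCompact))
  have hCD : C ⊆ {p : ℝ × (Fin n → ℝ) × (Fin r → ℝ) | p.2.2 ∈ U} := by
    rintro p ⟨_, _, hp | ⟨i, hp⟩⟩
    · exact hKU hp
    · show p.2.2 ∈ U
      rw [← hp]; exact hus i
  obtain ⟨e1, he1, he1', H⟩ := loc_est F hD hCc hCD h0 h1 h2 (fun p hp => hd p hp) (fun p hp => hd2 p hp)
    hCq hρ (half_pos hη)
  obtain ⟨r0, hr0, Hr⟩ := unif_near hU hKc hKU (f := fun u => u) continuousOn_id one_pos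
  refine ⟨min e1 (r0 / (Cq + 1)), lt_min he1 (by positivity), (min_le_left _ _).trans he1', ?_⟩
  intro ε hε hεlt
  obtain ⟨hε1, hε2⟩ := lt_min_iff.1 hεlt
  rw [lt_div_iff₀ (by positivity)] at hε2
  have hUv : ∀ s, uh s + ε • v s ∈ U := by
    intro s
    refine (Hr (uh s) (huK s) _ ?_).1
    rw [dist_eq_norm, add_sub_cancel_left, norm_smul, Real.norm_eq_abs, abs_of_pos hε]
    have := mul_le_mul_of_nonneg_left (hvb s) hε.le
    nlinarith
  have hz : ∀ x : Fin n → ℝ, ‖((x, 0) : (Fin n → ℝ) × (Fin r → ℝ))‖ = ‖x‖ := fun x => by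
    rw [Prod.norm_def]; simp
  have hzs : ∀ x x' : Fin n → ℝ, ((x, 0) : (Fin n → ℝ) × (Fin r → ℝ)) - (x', 0) = (x - x', 0) := fun x x' => by
    simp
  have hp1 : ∀ s ∈ Icc t₀ t₁, ((s, xh s, uh s) : ℝ × (Fin n → ℝ) × (Fin r → ℝ)) ∈ C := fun s hs =>
    ⟨hs, ⟨s, hs, rfl⟩, Or.inl (huK s)⟩
  have hp2 : ∀ i, ∀ s ∈ Icc t₀ t₁, ((s, xh s, us i) : ℝ × (Fin n → ℝ) × (Fin r → ℝ)) ∈ C := fun i s hs =>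
    ⟨hs, ⟨s, hs, rfl⟩, Or.inr ⟨i, rfl⟩⟩
  have hq1 : ∀ s ∈ Icc t₀ t₁, ‖((h s, v s) : (Fin n → ℝ) × (Fin r → ℝ))‖ ≤ Cq := fun s hs => by
    rw [Prod.norm_def]; exact max_le (hhb s hs) (hvb s)
  have hq2 : ∀ s ∈ Icc t₀ t₁, ‖((h s, 0) : (Fin n → ℝ) × (Fin r → ℝ))‖ ≤ Cq := fun s hs => by
    rw [hz]; exact hhb s hs
  have hinv : ∀ (X : Fin n → ℝ) (b : ℝ), ‖X‖ ≤ ε ^ 2 * b → ‖(ε ^ 2)⁻¹ • X‖ ≤ b := by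
    intro X b hX
    rw [norm_smul, Real.norm_eq_abs, abs_of_pos (by positivity), inv_mul_le_iff₀ (by positivity)]
    exact hX
  have hεε : ε ^ 2 ≠ 0 := by positivity
  -- measurability
  have hmw : Measurable fun s => ((s, xh s, uh s) : ℝ × (Fin n → ℝ) × (Fin r → ℝ)) :=
    measurable_id.prodMk (hx.measurable.prodMk hu)
  have hm0 : StronglyMeasurable fun s => F s (xh s, uh s) := sm_comp h0 hmw fun s => hKU (huK s)
  have hm1 : StronglyMeasurable fun s => fderiv ℝ (F s) (xh s, uh s) := sm_comp h1 hmw fun s => hKU (huK s)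
  have hmq : StronglyMeasurable fun s => ((h s, v s) : (Fin n → ℝ) × (Fin r → ℝ)) :=
    (hh.measurable.prodMk hv).stronglyMeasurable
  have hmp : ∀ x : ℝ → Fin n → ℝ, Continuous x → StronglyMeasurable fun s =>
      F s ((xh s, uh s) + (ε • (h s, v s) + ε ^ 2 • (x s, 0))) := by
    intro x hxc
    have hmw2 : Measurable fun s => ((s, (xh s, uh s) + (ε • (h s, v s) + ε ^ 2 • (x s, 0))) :
        ℝ × (Fin n → ℝ) × (Fin r → ℝ)) := by
      have a1 := hx.measurable
      have a2 := hh.measurable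
      have a3 := hxc.measurable
      fun_prop
    refine sm_comp h0 hmw2 fun s => ?_
    show uh s + (ε • v s + ε ^ 2 • (0 : Fin r → ℝ)) ∈ U
    rw [smul_zero, add_zero]
    exact hUv s
  have hmi : ∀ i, ∀ x : ℝ → Fin n → ℝ, Continuous x → StronglyMeasurable fun s =>
      F s ((xh s, us i) + (ε • (h s, 0) + ε ^ 2 • (x s, 0))) := by
    intro i x hxc
    have hmw2 : Measurable fun s => ((s, (xh s, us i) + (ε • (h s, 0) + ε ^ 2 • (x s, 0))) :
        ℝ × (Fin n → ℝ) × (Fin r → ℝ)) := by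
      have a1 := hx.measurable
      have a2 := hh.measurable
      have a3 := hxc.measurable
      fun_prop
    refine sm_comp h0 hmw2 fun s => ?_
    show us i + (ε • (0 : Fin r → ℝ) + ε ^ 2 • (0 : Fin r → ℝ)) ∈ U
    rw [smul_zero, smul_zero, add_zero, add_zero]
    exact hus i
  refine ⟨hUv, ⟨?_, ?_, ?_, ?_, ?_, ?_⟩⟩
  · intro x hxc
    have := (((hmp x hxc).sub hm0).sub ((sm_clm_apply hm1 hmq).const_smul ε)).const_smul ((ε ^ 2)⁻¹)
    exact this
  · intro i x hxc
    have := ((hmi i x hxc).sub (hmp x hxc)).indicator (hEs i)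
    convert this using 1
    funext s
    by_cases hs : s ∈ Es i
    · simp only [Om, indicator_of_mem hs, Pi.sub_apply]
    · simp only [Om, indicator_of_notMem hs]
  · intro s hs x x' hxn hxn'
    have H1 := ((H ε hε hε1 _ (hp1 s hs) _ (hq1 s hs) (x, 0) (by rw [hz]; exact hxn)).2.2.2 (x', 0)
      (by rw [hz]; exact hxn')).1
    rw [hzs, hz] at H1
    have e2 : Th F (fun s => (xh s, uh s)) (fun s => (h s, v s)) ε s x -
        Th F (fun s => (xh s, uh s)) (fun s => (h s, v s)) ε s x' -
        ((fderiv ℝ (F s) (xh s, uh s)).comp (ContinuousLinearMap.inl ℝ _ _)) (x - x') =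
        (ε ^ 2)⁻¹ • (F s ((xh s, uh s) + (ε • (h s, v s) + ε ^ 2 • (x, 0))) -
          F s ((xh s, uh s) + (ε • (h s, v s) + ε ^ 2 • (x', 0))) -
          ε ^ 2 • fderiv ℝ (F s) (xh s, uh s) (x - x', 0)) := by
      simp only [Th, ContinuousLinearMap.comp_apply, ContinuousLinearMap.inl_apply, smul_sub, smul_smul,
        inv_mul_cancel₀ hεε, one_smul]
      abel
    rw [e2]
    refine (hinv _ _ H1).trans ?_
    gcongr
    linarith
  · intro s hs x hxn
    have H1 := (H ε hε hε1 _ (hp1 s hs) _ (hq1 s hs) (x, 0) (by rw [hz]; exact hxn)).2.2.1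
    have e2 : Th F (fun s => (xh s, uh s)) (fun s => (h s, v s)) ε s x -
        ((fderiv ℝ (F s) (xh s, uh s)).comp (ContinuousLinearMap.inl ℝ _ _)) x -
        (1/2:ℝ) • fderiv ℝ (fderiv ℝ (F s)) (xh s, uh s) (h s, v s) (h s, v s) =
        (ε ^ 2)⁻¹ • (F s ((xh s, uh s) + (ε • (h s, v s) + ε ^ 2 • (x, 0))) -
          F s (xh s, uh s) - ε • fderiv ℝ (F s) (xh s, uh s) (h s, v s) -
          ε ^ 2 • fderiv ℝ (F s) (xh s, uh s) (x, 0) -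
          ε ^ 2 • (1/2:ℝ) • fderiv ℝ (fderiv ℝ (F s)) (xh s, uh s) (h s, v s) (h s, v s)) := by
      simp only [Th, ContinuousLinearMap.comp_apply, ContinuousLinearMap.inl_apply, smul_sub,
        inv_smul_smul₀ hεε]
    rw [e2]
    refine (hinv _ _ H1).trans ?_
    linarith
  · intro i s hs x hxn
    have H1 := (H ε hε hε1 _ (hp1 s hs) _ (hq1 s hs) (x, 0) (by rw [hz]; exact hxn)).2.1
    have H2 := (H ε hε hε1 _ (hp2 i s hs) _ (hq2 s hs) (x, 0) (by rw [hz]; exact hxn)).2.1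
    by_cases hsE : s ∈ Es i
    · simp only [Om, indicator_of_mem hsE]
      have := norm_sub_le (F s ((xh s, us i) + (ε • (h s, 0) + ε ^ 2 • (x, 0))) - F s (xh s, us i))
        (F s ((xh s, uh s) + (ε • (h s, v s) + ε ^ 2 • (x, 0))) - F s (xh s, uh s))
      rw [show ∀ a b c d : Fin n → ℝ, a - b - (c - d) = a - c - (b - d) from fun a b c d => by abel] at this
      refine this.trans ((add_le_add H2 H1).trans ?_)
      linarith
    · simp only [Om, indicator_of_notMem hsE, sub_zero, norm_zero]
      exact hη.le
  · intro i s hs x x' hxn hxn'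
    have H1 := ((H ε hε hε1 _ (hp1 s hs) _ (hq1 s hs) (x, 0) (by rw [hz]; exact hxn)).2.2.2 (x', 0)
      (by rw [hz]; exact hxn')).2
    have H2 := ((H ε hε hε1 _ (hp2 i s hs) _ (hq2 s hs) (x, 0) (by rw [hz]; exact hxn)).2.2.2 (x', 0)
      (by rw [hz]; exact hxn')).2
    rw [hzs, hz] at H1 H2
    by_cases hsE : s ∈ Es i
    · simp only [Om, indicator_of_mem hsE]
      have := norm_sub_le (F s ((xh s, us i) + (ε • (h s, 0) + ε ^ 2 • (x, 0))) -
          F s ((xh s, us i) + (ε • (h s, 0) + ε ^ 2 • (x', 0))))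
        (F s ((xh s, uh s) + (ε • (h s, v s) + ε ^ 2 • (x, 0))) -
          F s ((xh s, uh s) + (ε • (h s, v s) + ε ^ 2 • (x', 0))))
      rw [show ∀ a b c d : Fin n → ℝ, a - b - (c - d) = a - c - (b - d) from fun a b c d => by abel] at this
      refine this.trans ((add_le_add H2 H1).trans ?_)
      linarith
    · simp only [Om, indicator_of_notMem hsE, sub_zero, norm_zero]
      positivity

end est
end ODEC

end Part11

section Part12

open Set Topology Filter MeasureTheory
set_option linter.unusedSectionVars false
set_option linter.unusedVariables false

namespace ODEC
section ctrl
variable {n r k : ℕ}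

lemma chi_disj {k : ℕ} {i j : Fin k} (hij : j ≠ i) {e αm x : ℝ} {α : Fin k → ℝ} (he : 0 < e)
    (heα : e * αm ≤ (1:ℝ) / k) (hα : ∀ i, α i ≤ αm)
    (hi : (i : ℝ) / k ≤ x ∧ x < (i : ℝ) / k + e * α i) :
    chi ((j : ℝ) / k) ((j : ℝ) / k + e * α j) x = 0 := by
  unfold chi
  rw [if_neg]
  rintro ⟨h1, h2⟩
  apply hij
  have hk : (0:ℝ) < k := by exact_mod_cast i.pos
  have hb : ∀ l : Fin k, (l : ℝ) / k + e * α l ≤ ((l : ℝ) + 1) / k := by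
    intro l
    rw [add_div]
    have := mul_le_mul_of_nonneg_left (hα l) he.le
    linarith
  have a1 : (i : ℝ) / k < ((j : ℝ) + 1) / k := by linarith [hb j, hi.1]
  have a2 : (j : ℝ) / k < ((i : ℝ) + 1) / k := by linarith [hb i, hi.2]
  rw [div_lt_div_iff_of_pos_right hk] at a1 a2
  have b1 : (i : ℕ) < j + 1 := by exact_mod_cast a1
  have b2 : (j : ℕ) < i + 1 := by exact_mod_cast a2
  ext
  omega

/-- the perturbed control -/
noncomputable def uu (m : ℝ → ℝ) (e : ℝ) (α : Fin k → ℝ) (u₀ : ℝ → Fin r → ℝ)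
    (Es : Fin k → Set ℝ) (us : Fin k → Fin r → ℝ) (s : ℝ) : Fin r → ℝ :=
  u₀ s + ∑ i : Fin k, chi ((i : ℝ) / k) ((i : ℝ) / k + e * α i) (m s) • (Es i).indicator (fun s => us i - u₀ s) s

lemma uu_cases {m : ℝ → ℝ} {e αm : ℝ} {α : Fin k → ℝ} (u₀ : ℝ → Fin r → ℝ)
    (Es : Fin k → Set ℝ) (us : Fin k → Fin r → ℝ) (he : 0 < e)
    (heα : e * αm ≤ (1:ℝ) / k) (hα : ∀ i, α i ≤ αm) (s : ℝ) :
    (uu m e α u₀ Es us s = u₀ s ∧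
      ∀ W : Fin k → Fin n → ℝ, ∑ i : Fin k, (e⁻¹ * chi ((i : ℝ) / k) ((i : ℝ) / k + e * α i) (m s)) •
        (Es i).indicator (fun _ => W i) s = 0) ∨
    ∃ i, uu m e α u₀ Es us s = us i ∧
      ∀ W : Fin k → Fin n → ℝ, ∑ i : Fin k, (e⁻¹ * chi ((i : ℝ) / k) ((i : ℝ) / k + e * α i) (m s)) •
        (Es i).indicator (fun _ => W i) s = e⁻¹ • W i := by
  by_cases hex : ∃ i : Fin k, (i : ℝ) / k ≤ m s ∧ m s < (i : ℝ) / k + e * α i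
  · obtain ⟨i, hi⟩ := hex
    have h0 : ∀ j, j ≠ i → chi ((j : ℝ) / k) ((j : ℝ) / k + e * α j) (m s) = 0 := fun j hj =>
      chi_disj hj he heα hα hi
    have h1 : chi ((i : ℝ) / k) ((i : ℝ) / k + e * α i) (m s) = 1 := by
      unfold chi; rw [if_pos hi]
    have hu : uu m e α u₀ Es us s = u₀ s + (Es i).indicator (fun s => us i - u₀ s) s := by
      unfold uu
      rw [Finset.sum_eq_single i (fun j _ hj => by rw [h0 j hj, zero_smul]) (by simp), h1, one_smul]
    have hW : ∀ W : Fin k → Fin n → ℝ,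
        ∑ i : Fin k, (e⁻¹ * chi ((i : ℝ) / k) ((i : ℝ) / k + e * α i) (m s)) •
        (Es i).indicator (fun _ => W i) s = e⁻¹ • (Es i).indicator (fun _ => W i) s := by
      intro W
      rw [Finset.sum_eq_single i (fun j _ hj => by rw [h0 j hj, mul_zero, zero_smul]) (by simp), h1, mul_one]
    by_cases hs : s ∈ Es i
    · right
      refine ⟨i, ?_, fun W => ?_⟩
      · rw [hu, indicator_of_mem hs]; simp
      · rw [hW, indicator_of_mem hs]
    · left
      refine ⟨?_, fun W => ?_⟩
      · rw [hu, indicator_of_notMem hs, add_zero]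
      · rw [hW, indicator_of_notMem hs, smul_zero]
  · left
    push Not at hex
    have h0 : ∀ j : Fin k, chi ((j : ℝ) / k) ((j : ℝ) / k + e * α j) (m s) = 0 := by
      intro j
      unfold chi
      rw [if_neg]
      rintro ⟨h1, h2⟩
      exact absurd h2 (not_lt.2 (hex j h1))
    refine ⟨?_, fun W => ?_⟩
    · unfold uu; simp [h0]
    · simp [h0]

lemma uu_meas {m : ℝ → ℝ} (hm : Measurable m) (e : ℝ) (α : Fin k → ℝ) {u₀ : ℝ → Fin r → ℝ} (hu : Measurable u₀)
    {Es : Fin k → Set ℝ} (hEs : ∀ i, MeasurableSet (Es i)) (us : Fin k → Fin r → ℝ) :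
    Measurable (uu m e α u₀ Es us) := by
  unfold uu
  refine hu.add ?_
  refine Finset.measurable_fun_sum _ fun i _ => ?_
  exact ((measurable_chi _ _).comp hm).smul ((measurable_const.sub hu).indicator (hEs i))

lemma uu_dyn (F : ℝ → (Fin n → ℝ) × (Fin r → ℝ) → Fin n → ℝ) {m : ℝ → ℝ} {ε αm : ℝ} {α : Fin k → ℝ}
    (xh h : ℝ → Fin n → ℝ) (uh v : ℝ → Fin r → ℝ) (x : ℝ → Fin n → ℝ)
    (Es : Fin k → Set ℝ) (us : Fin k → Fin r → ℝ) (he : 0 < ε)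
    (heα : ε ^ 2 * αm ≤ (1:ℝ) / k) (hα : ∀ i, α i ≤ αm) (s : ℝ) :
    F s (xh s + (ε • h s + ε ^ 2 • x s), uu m (ε ^ 2) α (fun s => uh s + ε • v s) Es us s) =
      F s (xh s, uh s) + ε • fderiv ℝ (F s) (xh s, uh s) (h s, v s) +
      ε ^ 2 • NN m (ε ^ 2) (Th F (fun s => (xh s, uh s)) (fun s => (h s, v s)) ε)
        (Om F (fun s => (xh s, uh s)) (fun s => (h s, v s)) ε Es us) α x s := by
  have hε2 : (0:ℝ) < ε ^ 2 := by positivity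
  have hne : ε ^ 2 ≠ 0 := hε2.ne'
  set W : Fin k → Fin n → ℝ := fun i => F s (((xh s), us i) + (ε • ((h s), 0) + ε ^ 2 • (x s, 0)))
    - F s ((xh s, uh s) + (ε • (h s, v s) + ε ^ 2 • (x s, 0))) with hW
  have hOm : ∀ i, Om F (fun s => (xh s, uh s)) (fun s => (h s, v s)) ε Es us i s (x s) =
      (Es i).indicator (fun _ => W i) s := by
    intro i
    by_cases hs : s ∈ Es i
    · simp only [Om, indicator_of_mem hs, hW]
    · simp only [Om, indicator_of_notMem hs]
  have e1 : ((xh s, uh s) + (ε • (h s, v s) + ε ^ 2 • (x s, 0)) : (Fin n → ℝ) × (Fin r → ℝ)) =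
      (xh s + (ε • h s + ε ^ 2 • x s), uh s + ε • v s) := by
    ext <;> simp
  have e2 : ∀ i, ((xh s, us i) + (ε • (h s, 0) + ε ^ 2 • (x s, 0)) : (Fin n → ℝ) × (Fin r → ℝ)) =
      (xh s + (ε • h s + ε ^ 2 • x s), us i) := by
    intro i; ext <;> simp
  have hTh : ε ^ 2 • Th F (fun s => (xh s, uh s)) (fun s => (h s, v s)) ε s (x s) =
      F s (xh s + (ε • h s + ε ^ 2 • x s), uh s + ε • v s) - F s (xh s, uh s)
      - ε • fderiv ℝ (F s) (xh s, uh s) (h s, v s) := by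
    simp only [Th]
    rw [smul_inv_smul₀ hne, e1]
  unfold NN
  simp only [hOm]
  rcases uu_cases (n := n) (m := m) (α := α) (fun s => uh s + ε • v s) Es us hε2 heα hα s with ⟨h1, h2⟩ | ⟨i, h1, h2⟩
  · rw [h1, h2, add_zero, hTh]
    abel
  · rw [h1, h2, smul_add, hTh, smul_inv_smul₀ hne, hW]
    simp only [e1, e2]
    abel

lemma bdry {m : ℕ} {P : Type} [NormedAddCommGroup P] [NormedSpace ℝ P] {g : P → Fin m → ℝ}
    (hg : ContDiff ℝ 2 g) (E0 η0 : P) {ρ η : ℝ} (hρ : 0 ≤ ρ) (hη : 0 < η) :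
    ∃ ε₀ > (0:ℝ), ε₀ ≤ 1 ∧ ∀ ε, 0 < ε → ε < ε₀ → ∀ E, ‖E‖ ≤ ρ → 
      ‖g (E0 + (ε • η0 + ε ^ 2 • E)) - g E0‖ ≤ η ∧
      ‖g (E0 + (ε • η0 + ε ^ 2 • E)) - g E0 - ε • fderiv ℝ g E0 η0
        - ε ^ 2 • fderiv ℝ g E0 E - ε ^ 2 • (1/2:ℝ) • fderiv ℝ (fderiv ℝ g) E0 η0 η0‖ ≤ ε ^ 2 * η ∧
      ∀ E', ‖E'‖ ≤ ρ →
        ‖g (E0 + (ε • η0 + ε ^ 2 • E)) - g (E0 + (ε • η0 + ε ^ 2 • E'))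
          - ε ^ 2 • fderiv ℝ g E0 (E - E')‖ ≤ ε ^ 2 * (η * ‖E - E'‖) := by
  have c1 : ContDiff ℝ 1 (fderiv ℝ g) := hg.fderiv_right (by norm_num)
  have c2 : Continuous (fderiv ℝ (fderiv ℝ g)) := (c1.fderiv_right (m := 0) (by norm_num)).continuous
  obtain ⟨e, he, he1, H⟩ := loc_est (fun _ => g) (D := univ) (C := {((0:ℝ), E0)}) isOpen_univ isCompact_singleton
    (subset_univ _) (hg.continuous.comp continuous_snd).continuousOn
    (c1.continuous.comp continuous_snd).continuousOn (c2.comp continuous_snd).continuousOn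
    (fun p _ => (hg.differentiable (by norm_num)) _) (fun p _ => (c1.differentiable (by norm_num)) _)
    (norm_nonneg η0) hρ hη
  refine ⟨e, he, he1, fun ε h1 h2 E hE => ?_⟩
  have := H ε h1 h2 _ rfl η0 le_rfl E hE
  exact ⟨this.2.1, this.2.2.1, fun E' hE' => (this.2.2.2 E' hE').1⟩

end ctrl
end ODEC

end Part12

section Part13

open Set Topology Filter MeasureTheory
open scoped Matrix
set_option linter.unusedSectionVars false
set_option linter.unusedVariables false

namespace ODEC

lemma bd_comp {α β : Type*} [TopologicalSpace α] [NormedAddCommGroup β] {C : Set α} {G : α → β} {I : Set ℝ}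
    (hC : IsCompact C) (hG : ContinuousOn G C) {γ : ℝ → α} (hγ : ∀ s ∈ I, γ s ∈ C) :
    ∃ M, ∀ s ∈ I, ‖G (γ s)‖ ≤ M := by
  obtain ⟨M, hM⟩ := hC.exists_bound_of_continuousOn hG
  exact ⟨M, fun s hs => hM _ (hγ s hs)⟩

lemma int3 {n : ℕ} {a b c : ℝ → Fin n → ℝ} {p q : ℝ} (ε e : ℝ) (ha : IntervalIntegrable a volume p q)
    (hb : IntervalIntegrable b volume p q) (hc : IntervalIntegrable c volume p q) :
    ∫ s in p..q, (a s + ε • b s + e • c s) = (∫ s in p..q, a s) + ε • (∫ s in p..q, b s) + e • ∫ s in p..q, c s := by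
  have hb' : IntervalIntegrable (fun s => ε • b s) volume p q := hb.smul ε
  have hc' : IntervalIntegrable (fun s => e • c s) volume p q := hc.smul e
  have hab : IntervalIntegrable (fun s => a s + ε • b s) volume p q := ha.add hb'
  rw [intervalIntegral.integral_add hab hc', intervalIntegral.integral_add ha hb',
    intervalIntegral.integral_smul, intervalIntegral.integral_smul]

section core
variable {n r m₁ m₂ : ℕ} {t₀ t₁ : ℝ}

set_option maxHeartbeats 2000000 in
theorem core1 (ht : t₀ < t₁) (U : Set (Fin r → ℝ)) (hU : IsOpen U)
    (F : ℝ → (Fin n → ℝ) × (Fin r → ℝ) → Fin n → ℝ)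
    (h0 : ContinuousOn (fun p : ℝ × (Fin n → ℝ) × (Fin r → ℝ) => F p.1 p.2) {p | p.2.2 ∈ U})
    (h1 : ContinuousOn (fun p : ℝ × (Fin n → ℝ) × (Fin r → ℝ) => fderiv ℝ (F p.1) p.2) {p | p.2.2 ∈ U})
    (h2 : ContinuousOn (fun p : ℝ × (Fin n → ℝ) × (Fin r → ℝ) => fderiv ℝ (fderiv ℝ (F p.1)) p.2) {p | p.2.2 ∈ U})
    (hd : ∀ p : ℝ × (Fin n → ℝ) × (Fin r → ℝ), p.2.2 ∈ U → DifferentiableAt ℝ (F p.1) p.2)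
    (hd2 : ∀ p : ℝ × (Fin n → ℝ) × (Fin r → ℝ), p.2.2 ∈ U → DifferentiableAt ℝ (fderiv ℝ (F p.1)) p.2)
    (f : (Fin n → ℝ) × (Fin n → ℝ) → Fin m₁ → ℝ)
    (g : (Fin n → ℝ) × (Fin n → ℝ) → Fin m₂ → ℝ)
    (hf : ContDiff ℝ 2 f) (hg : ContDiff ℝ 2 g)
    (Kc : Set (Fin r → ℝ)) (hKc : IsCompact Kc) (hKU : Kc ⊆ U)
    (xh h : ℝ → Fin n → ℝ) (uh v : ℝ → Fin r → ℝ) (hx : Continuous xh) (hh : Continuous h)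
    (hu : Measurable uh) (hv : Measurable v) (huK : ∀ s, uh s ∈ Kc) {Cq : ℝ} (hCq : 0 ≤ Cq)
    (hvb : ∀ s, ‖v s‖ ≤ Cq) (hhb : ∀ s ∈ Icc t₀ t₁, ‖h s‖ ≤ Cq)
    (hode : ∀ t ∈ Icc t₀ t₁, xh t = xh t₀ + ∫ s in t₀..t, F s (xh s, uh s))
    (hbf : ∀ i, f (xh t₀, xh t₁) i ≤ 0)
    (hbg : g (xh t₀, xh t₁) = 0)
    (hlin : ∀ t ∈ Icc t₀ t₁, h t = h t₀ + ∫ s in t₀..t, fderiv ℝ (F s) (xh s, uh s) (h s, v s))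
    (hqf : ∀ i, fderiv ℝ f (xh t₀, xh t₁) (h t₀, h t₁) i ≤ 0)
    (hqg : fderiv ℝ g (xh t₀, xh t₁) (h t₀, h t₁) = 0)
    (hΛ : ¬ ∃ (p : ℝ → Fin n → ℝ) (l₁ : Fin m₁ → ℝ) (l₂ : Fin m₂ → ℝ),
      (∀ i, 0 ≤ l₁ i) ∧ (l₁ ≠ 0 ∨ l₂ ≠ 0) ∧ Continuous p ∧
      IntervalIntegrable (fun s => (fun i => p s ⬝ᵥ fderiv ℝ (F s) (xh s, uh s) (Pi.single i 1, 0))) volume t₀ t₁ ∧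
      (∀ t ∈ Icc t₀ t₁, p t = p t₀ - ∫ s in t₀..t, (fun i => p s ⬝ᵥ fderiv ℝ (F s) (xh s, uh s) (Pi.single i 1, 0))) ∧
      p t₀ = (fun i => l₁ ⬝ᵥ fderiv ℝ f (xh t₀, xh t₁) (Pi.single i 1, 0)
                     + l₂ ⬝ᵥ fderiv ℝ g (xh t₀, xh t₁) (Pi.single i 1, 0)) ∧
      p t₁ = (fun i => -(l₁ ⬝ᵥ fderiv ℝ f (xh t₀, xh t₁) (0, Pi.single i 1))
                     - l₂ ⬝ᵥ fderiv ℝ g (xh t₀, xh t₁) (0, Pi.single i 1)) ∧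
      (∀ᵐ t ∂(volume.restrict (Icc t₀ t₁)), ∀ u ∈ U, p t ⬝ᵥ F t (xh t, u) ≤ p t ⬝ᵥ F t (xh t, uh t)) ∧
      l₁ ⬝ᵥ f (xh t₀, xh t₁) = 0 ∧
      0 ≤ -(∫ t in t₀..t₁, p t ⬝ᵥ (fderiv ℝ (fderiv ℝ (F t)) (xh t, uh t) (h t, v t) (h t, v t)))
          + l₁ ⬝ᵥ fderiv ℝ (fderiv ℝ f) (xh t₀, xh t₁) (h t₀, h t₁) (h t₀, h t₁)
          + l₂ ⬝ᵥ fderiv ℝ (fderiv ℝ g) (xh t₀, xh t₁) (h t₀, h t₁) (h t₀, h t₁)) :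
    ∃ σ > (0:ℝ), ∃ ρ > (0:ℝ), ∃ ε₀ > (0:ℝ), ε₀ ≤ 1 ∧ ∀ ε, 0 < ε → ε < ε₀ →
      ∀ (y₁ : Fin m₁ → ℝ) (y₂ : Fin m₂ → ℝ), (y₁, y₂) ≠ 0 →
        ‖((y₁, y₂) : (Fin m₁ → ℝ) × (Fin m₂ → ℝ))‖ ≤ ε ^ 2 * σ →
        ∃ (x : ℝ → Fin n → ℝ) (u : ℝ → Fin r → ℝ), Continuous x ∧ Measurable u ∧
          (∃ C : ℝ, ∀ t, ‖u t‖ ≤ C) ∧ (∀ t, u t ∈ U) ∧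
          IntervalIntegrable (fun s => F s (x s, u s)) volume t₀ t₁ ∧
          (∀ t ∈ Icc t₀ t₁, x t = x t₀ + ∫ s in t₀..t, F s (x s, u s)) ∧
          (∀ i, f (x t₀, x t₁) i ≤ y₁ i) ∧ g (x t₀, x t₁) = y₂ ∧
          (∀ t ∈ Icc t₀ t₁, ‖x t - xh t‖ ≤ ε * (Cq + ρ)) := by
  set E0 : (Fin n → ℝ) × (Fin n → ℝ) := (xh t₀, xh t₁) with hE0
  set η0 : (Fin n → ℝ) × (Fin n → ℝ) := (h t₀, h t₁) with hη0
  -- measurability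
  have hmw : Measurable fun s => ((s, xh s, uh s) : ℝ × (Fin n → ℝ) × (Fin r → ℝ)) :=
    measurable_id.prodMk (hx.measurable.prodMk hu)
  have hm0 : StronglyMeasurable fun s => F s (xh s, uh s) := sm_comp h0 hmw fun s => hKU (huK s)
  have hm1 : StronglyMeasurable fun s => fderiv ℝ (F s) (xh s, uh s) := sm_comp h1 hmw fun s => hKU (huK s)
  have hm2 : StronglyMeasurable fun s => fderiv ℝ (fderiv ℝ (F s)) (xh s, uh s) :=
    sm_comp h2 hmw fun s => hKU (huK s)
  have hmq : StronglyMeasurable fun s => ((h s, v s) : (Fin n → ℝ) × (Fin r → ℝ)) :=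
    (hh.measurable.prodMk hv).stronglyMeasurable
  have hq1 : ∀ s ∈ Icc t₀ t₁, ‖((h s, v s) : (Fin n → ℝ) × (Fin r → ℝ))‖ ≤ Cq := fun s hs => by
    rw [Prod.norm_def]; exact max_le (hhb s hs) (hvb s)
  have hmu : ∀ u ∈ U, StronglyMeasurable fun s => F s (xh s, u) := fun u hu' =>
    sm_comp h0 (γ := fun s => ((s, xh s, u) : ℝ × (Fin n → ℝ) × (Fin r → ℝ)))
      (measurable_id.prodMk (hx.measurable.prodMk measurable_const)) fun s => hu'
  have hcomp : ∀ T : Set (Fin r → ℝ), IsCompact T →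
      IsCompact (Icc t₀ t₁ ×ˢ ((xh '' Icc t₀ t₁) ×ˢ T)) := fun T hT =>
    isCompact_Icc.prod ((isCompact_Icc.image hx).prod hT)
  have hsubU : ∀ T : Set (Fin r → ℝ), T ⊆ U →
      (Icc t₀ t₁ ×ˢ ((xh '' Icc t₀ t₁) ×ˢ T)) ⊆ {p : ℝ × (Fin n → ℝ) × (Fin r → ℝ) | p.2.2 ∈ U} :=
    fun T hT p hp => hT hp.2.2
  have hp1 : ∀ s ∈ Icc t₀ t₁, ((s, xh s, uh s) : ℝ × (Fin n → ℝ) × (Fin r → ℝ)) ∈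
      Icc t₀ t₁ ×ˢ ((xh '' Icc t₀ t₁) ×ˢ Kc) := fun s hs => ⟨hs, ⟨s, hs, rfl⟩, huK s⟩
  have hb0 : ∃ M, ∀ s ∈ Icc t₀ t₁, ‖F s (xh s, uh s)‖ ≤ M :=
    bd_comp (G := fun p : ℝ × (Fin n → ℝ) × (Fin r → ℝ) => F p.1 p.2)
      (γ := fun s => (s, xh s, uh s)) (hcomp Kc hKc) (h0.mono (hsubU Kc hKU)) hp1
  have hb1 : ∃ M, ∀ s ∈ Icc t₀ t₁, ‖fderiv ℝ (F s) (xh s, uh s)‖ ≤ M :=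
    bd_comp (G := fun p : ℝ × (Fin n → ℝ) × (Fin r → ℝ) => fderiv ℝ (F p.1) p.2)
      (γ := fun s => (s, xh s, uh s)) (hcomp Kc hKc) (h1.mono (hsubU Kc hKU)) hp1
  have hb2 : ∃ M, ∀ s ∈ Icc t₀ t₁, ‖fderiv ℝ (fderiv ℝ (F s)) (xh s, uh s)‖ ≤ M :=
    bd_comp (β := (Fin n → ℝ) × (Fin r → ℝ) →L[ℝ] (Fin n → ℝ) × (Fin r → ℝ) →L[ℝ] (Fin n → ℝ))
      (G := fun p : ℝ × (Fin n → ℝ) × (Fin r → ℝ) => fderiv ℝ (fderiv ℝ (F p.1)) p.2)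
      (γ := fun s => (s, xh s, uh s)) (hcomp Kc hKc) (h2.mono (hsubU Kc hKU)) hp1
  obtain ⟨M0, hM0⟩ := hb0
  obtain ⟨M1, hM1⟩ := hb1
  obtain ⟨M2, hM2⟩ := hb2
  set A : ℝ → (Fin n → ℝ) →L[ℝ] (Fin n → ℝ) := fun s =>
    (fderiv ℝ (F s) (xh s, uh s)).comp (ContinuousLinearMap.inl ℝ (Fin n → ℝ) (Fin r → ℝ)) with hAdef
  have hA : StronglyMeasurable A := by
    have hc : Continuous fun T : (Fin n → ℝ) × (Fin r → ℝ) →L[ℝ] (Fin n → ℝ) =>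
        T.comp (ContinuousLinearMap.inl ℝ (Fin n → ℝ) (Fin r → ℝ)) := continuous_id.clm_comp continuous_const
    exact hc.comp_stronglyMeasurable hm1
  have hL : ∀ s ∈ Icc t₀ t₁, ‖A s‖ ≤ M1 * ‖ContinuousLinearMap.inl ℝ (Fin n → ℝ) (Fin r → ℝ)‖ := fun s hs =>
    (ContinuousLinearMap.opNorm_comp_le _ _).trans (mul_le_mul_of_nonneg_right (hM1 s hs) (norm_nonneg _))
  obtain ⟨K, S, hK, hS⟩ := volterra ht.le A hA _ hL
  set Q : ℝ → Fin n → ℝ := fun s => fderiv ℝ (fderiv ℝ (F s)) (xh s, uh s) (h s, v s) (h s, v s) with hQdef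
  have hQm : StronglyMeasurable Q := sm_clm_apply (sm_clm_apply hm2 hmq) hmq
  have hM20 : 0 ≤ M2 := le_trans (norm_nonneg (fderiv ℝ (fderiv ℝ (F t₀)) (xh t₀, uh t₀)))
    (hM2 t₀ (left_mem_Icc.2 ht.le))
  have hM10 : 0 ≤ M1 := le_trans (norm_nonneg (fderiv ℝ (F t₀) (xh t₀, uh t₀)))
    (hM1 t₀ (left_mem_Icc.2 ht.le))
  have hQb : ∀ s ∈ Icc t₀ t₁, ‖Q s‖ ≤ M2 * Cq * Cq := by
    intro s hs
    refine (ContinuousLinearMap.le_opNorm₂ _ _ _).trans ?_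
    have := hM2 s hs
    have := hq1 s hs
    gcongr
  have hlb : ∀ s ∈ Icc t₀ t₁, ‖fderiv ℝ (F s) (xh s, uh s) (h s, v s)‖ ≤ M1 * Cq := by
    intro s hs
    refine (ContinuousLinearMap.le_opNorm _ _).trans ?_
    have := hM1 s hs
    have := hq1 s hs
    gcongr
  have i0 : IntervalIntegrable (fun s => F s (xh s, uh s)) volume t₀ t₁ := ii_of_bdd ht.le hm0 hM0
  have i1 : IntervalIntegrable (fun s => fderiv ℝ (F s) (xh s, uh s) (h s, v s)) volume t₀ t₁ :=
    ii_of_bdd ht.le (sm_clm_apply hm1 hmq) hlb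
  set f' := fderiv ℝ f E0 with hf'
  set g' := fderiv ℝ g E0 with hg'
  set bf := fderiv ℝ (fderiv ℝ f) E0 η0 η0 with hbfdef
  set bg := fderiv ℝ (fderiv ℝ g) E0 η0 η0 with hbgdef
  have hsep := separation ht U ⟨uh t₀, hKU (huK t₀)⟩ A hA _ hL K S hK hS (fun s u => F s (xh s, u))
    (fun s => h0.comp (f := fun u => ((s, xh s, u) : ℝ × (Fin n → ℝ) × (Fin r → ℝ)))
      (by fun_prop) (fun u hu' => hu')) hmu
    (fun u hu' => by
      obtain ⟨M, hM⟩ := (hcomp {u} isCompact_singleton).exists_bound_of_continuousOn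
        (h0.mono (hsubU {u} (singleton_subset_iff.2 hu')))
      exact ⟨M, fun s hs => hM (s, xh s, u) ⟨hs, ⟨s, hs, rfl⟩, rfl⟩⟩)
    (fun s => F s (xh s, uh s)) hm0 M0 hM0 Q hQm _ hQb f' g' (f E0) bf bg hΛ
  -- choose δ
  obtain ⟨r₀, hr₀, hball⟩ := Metric.isOpen_iff.1 isOpen_interior _ hsep
  set δ := r₀ / 2 with hδdef
  have hδ : 0 < δ := half_pos hr₀
  set Q2 : ℝ → Fin n → ℝ := fun s => (1/2:ℝ) • Q s with hQ2
  have hw : -(((1/2:ℝ) • bf + f' (ends ht.le (S (prim t₀ t₁ Q2))) + (fun _ => δ),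
       (1/2:ℝ) • bg + g' (ends ht.le (S (prim t₀ t₁ Q2)))) :
        (Fin m₁ → ℝ) × (Fin m₂ → ℝ)) ∈
      interior (Submodule.span NNReal (gens ht.le U S (fun s u => F s (xh s, u)) (fun s => F s (xh s, uh s))
        f' g' (f E0)) : Set ((Fin m₁ → ℝ) × (Fin m₂ → ℝ))) := by
    apply hball
    rw [Metric.mem_ball, dist_eq_norm]
    have e1 : -(((1/2:ℝ) • bf + f' (ends ht.le (S (prim t₀ t₁ Q2))) + (fun _ => δ),
       (1/2:ℝ) • bg + g' (ends ht.le (S (prim t₀ t₁ Q2)))) : (Fin m₁ → ℝ) × (Fin m₂ → ℝ)) -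
       -((1/2:ℝ) • bf + f' (ends ht.le (S (prim t₀ t₁ Q2))),
       (1/2:ℝ) • bg + g' (ends ht.le (S (prim t₀ t₁ Q2)))) = -((fun _ => δ), 0) := by
      ext <;> simp
    rw [e1, norm_neg, Prod.norm_def]
    refine max_lt ?_ ?_
    · refine lt_of_le_of_lt ((pi_norm_le_iff_of_nonneg hδ.le).2 fun i => ?_) (half_lt_self hr₀)
      rw [Real.norm_eq_abs, abs_of_pos hδ]
    · simpa using hr₀
  obtain ⟨k, d, β, B, ρc, hρc, hdD, hid, hpos⟩ := cone_param _ _ hw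
  choose us hus Es hEs a sl hsl hd' using hdD
  set ψ : Fin k → ℝ → Fin n → ℝ := fun i => (Es i).indicator fun s => F s (xh s, us i) - F s (xh s, uh s) with hψdef
  have hψm : ∀ i, Measurable (ψ i) := fun i =>
    (((hmu (us i) (hus i)).sub hm0).measurable).indicator (hEs i)
  have hψb : ∃ M, ∀ i, ∀ s ∈ Icc t₀ t₁, ‖ψ i s‖ ≤ M := by
    obtain ⟨M, hM⟩ := (hcomp (range us) (finite_range us).isCompact).exists_bound_of_continuousOn
        (h0.mono (hsubU (range us) (by rintro _ ⟨i, rfl⟩; exact hus i)))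
    refine ⟨M + M0, fun i s hs => (norm_indicator_le_norm_self _ _).trans ((norm_sub_le _ _).trans
      (add_le_add (hM (s, xh s, us i) ⟨hs, ⟨s, hs, rfl⟩, ⟨i, rfl⟩⟩) (hM0 s hs)))⟩
  obtain ⟨Mψ, hMψ⟩ := hψb
  have hQ2i : IntervalIntegrable Q2 volume t₀ t₁ := (ii_of_bdd ht.le hQm hQb).smul (1/2:ℝ)
  have hid' : ∀ z, ∑ i, (β i + B z i) •
      ((f' (ends ht.le (S (ContinuousMap.const _ (a i) + prim t₀ t₁ (ψ i)))) + sl i,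
        g' (ends ht.le (S (ContinuousMap.const _ (a i) + prim t₀ t₁ (ψ i))))) :
          (Fin m₁ → ℝ) × (Fin m₂ → ℝ)) =
      -((1/2:ℝ) • bf + f' (ends ht.le (S (prim t₀ t₁ Q2))) + (fun _ => δ),
        (1/2:ℝ) • bg + g' (ends ht.le (S (prim t₀ t₁ Q2)))) + z := by
    intro z
    rw [← hid z]
    exact Finset.sum_congr rfl fun i _ => by rw [hd' i]
  obtain ⟨αm, ρ, η, σ, hαm, hρ, hη, hσ, m, hm, Hsolve⟩ := solve ht hA hL hK hS hQ2i ψ hψm Mψ hMψ f' g'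
    (fun j => f E0 j = 0) bf bg a sl (fun i j hj => hsl i j hj) β B hρc hδ hpos hid'
  obtain ⟨γ, hγ, hγ2⟩ : ∃ γ > (0:ℝ), ∀ j, f E0 j ≠ 0 → f E0 j ≤ - (2 * γ) := by
    have : ∀ᶠ γ in 𝓝[>] (0:ℝ), ∀ j, f E0 j ≠ 0 → f E0 j ≤ - (2 * γ) := by
      refine eventually_all.2 fun j => ?_
      by_cases hj : f E0 j = 0
      · exact Eventually.of_forall fun _ h => absurd hj h
      · have hlt : 0 < -(f E0 j) / 2 := by
          have := lt_of_le_of_ne (hbf j) hj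
          linarith
        filter_upwards [Ioo_mem_nhdsGT hlt] with γ hγ _
        have := hγ.2
        linarith
    obtain ⟨γ, h1, h2⟩ := (this.and self_mem_nhdsWithin).exists
    exact ⟨γ, h2, h1⟩
  obtain ⟨e1, he1, he1', H1⟩ := est_exists U hU F h0 h1 h2 hd hd2 Kc hKc hKU xh h uh v hx hh hu hv huK hCq hvb hhb
    Es hEs us hus hρ.le hη
  obtain ⟨e2, he2, he2', H2⟩ := bdry hf E0 η0 hρ.le (η := min (δ/4) γ) (lt_min (by positivity) hγ)
  obtain ⟨e3, he3, he3', H3⟩ := bdry hg E0 η0 hρ.le hη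
  refine ⟨min σ (min (δ/4) γ), lt_min hσ (lt_min (by positivity) hγ), ρ, hρ,
    min (min e1 e2) (min e3 (1 / ((αm + 1) * (k + 1)))),
    lt_min (lt_min he1 he2) (lt_min he3 (by positivity)), ((min_le_left _ _).trans (min_le_left _ _)).trans he1', ?_⟩
  intro ε hε hεlt y₁ y₂ hy hyn
  simp only [lt_min_iff] at hεlt
  obtain ⟨⟨hε1, hε2⟩, hε3, hε4⟩ := hεlt
  have hεle : ε ≤ 1 := hε1.le.trans he1'
  have hpos2 : 0 < ε ^ 2 := by positivity
  have hne2 : ε ^ 2 ≠ 0 := hpos2.ne'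
  have hεsq : ε ^ 2 ≤ 1 := by nlinarith
  have hk : 0 < k := by
    rcases Nat.eq_zero_or_pos k with hk0 | hk0
    · exfalso
      subst hk0
      have a1 := hid' (y₁, y₂)
      have a2 := hid' 0
      simp only [Finset.univ_eq_empty, Finset.sum_empty, add_zero] at a1 a2
      rw [← a2, zero_add] at a1
      exact hy a1.symm
    · exact hk0
  have hkR : (1:ℝ) ≤ k := by exact_mod_cast hk
  have heα : ε ^ 2 * αm ≤ (1:ℝ) / k := by
    rw [lt_div_iff₀ (by positivity)] at hε4
    rw [le_div_iff₀ (by linarith)]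
    have b1 : ε ^ 2 ≤ ε := by nlinarith
    have b2 : αm * k ≤ (αm + 1) * (k + 1) := by nlinarith
    have b3 : 0 ≤ αm * k := by positivity
    calc ε ^ 2 * αm * k = ε ^ 2 * (αm * k) := by ring
      _ ≤ ε * ((αm + 1) * (k + 1)) := by gcongr
      _ ≤ 1 := hε4.le
  have hinv : ∀ (X : Fin m₂ → ℝ) (b : ℝ), ‖X‖ ≤ ε ^ 2 * b → ‖(ε ^ 2)⁻¹ • X‖ ≤ b := by
    intro X b hX
    rw [norm_smul, Real.norm_eq_abs, abs_of_pos (by positivity), inv_mul_le_iff₀ (by positivity)]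
    exact hX
  obtain ⟨hUv, hEst⟩ := H1 ε hε hε1
  have hy1n : ‖y₁‖ ≤ ε ^ 2 * min σ (min (δ/4) γ) := (norm_fst_le (y₁, y₂)).trans hyn
  have hy2n : ‖y₂‖ ≤ ε ^ 2 * min σ (min (δ/4) γ) := (norm_snd_le (y₁, y₂)).trans hyn
  obtain ⟨ξ, α, hξ, hα, hNNi, ⟨a₀, hξeq⟩, hG, hact⟩ := Hsolve (ε ^ 2)
    (Th F (fun s => (xh s, uh s)) (fun s => (h s, v s)) ε)
    (Om F (fun s => (xh s, uh s)) (fun s => (h s, v s)) ε Es us)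
    (fun E => (ε ^ 2)⁻¹ • g (E0 + (ε • η0 + ε ^ 2 • E))) hpos2 heα hEst
    (by
      intro E E' hE hE'
      have e := (H3 ε hε hε3 E hE).2.2 E' hE'
      have e' : (ε ^ 2)⁻¹ • g (E0 + (ε • η0 + ε ^ 2 • E)) - (ε ^ 2)⁻¹ • g (E0 + (ε • η0 + ε ^ 2 • E')) - g' (E - E') =
        (ε ^ 2)⁻¹ • (g (E0 + (ε • η0 + ε ^ 2 • E)) - g (E0 + (ε • η0 + ε ^ 2 • E')) - ε ^ 2 • g' (E - E')) := by
        rw [smul_sub, smul_sub, inv_smul_smul₀ hne2]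
      show ‖(ε ^ 2)⁻¹ • g (E0 + (ε • η0 + ε ^ 2 • E)) - (ε ^ 2)⁻¹ • g (E0 + (ε • η0 + ε ^ 2 • E')) - g' (E - E')‖ ≤ _
      rw [e']
      exact hinv _ _ e)
    (by
      intro E hE
      have e := (H3 ε hε hε3 E hE).2.1
      rw [hbg, ← hg', hqg, smul_zero, sub_zero, sub_zero] at e
      have e' : (ε ^ 2)⁻¹ • g (E0 + (ε • η0 + ε ^ 2 • E)) - g' E - (1/2:ℝ) • bg =
        (ε ^ 2)⁻¹ • (g (E0 + (ε • η0 + ε ^ 2 • E)) - ε ^ 2 • g' E - ε ^ 2 • (1/2:ℝ) • bg) := by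
        rw [smul_sub, smul_sub, inv_smul_smul₀ hne2, inv_smul_smul₀ hne2]
      show ‖(ε ^ 2)⁻¹ • g (E0 + (ε • η0 + ε ^ 2 • E)) - g' E - (1/2:ℝ) • bg‖ ≤ _
      rw [e']
      exact hinv _ _ e)
    ((ε ^ 2)⁻¹ • y₂) (hinv _ _ (hy2n.trans (mul_le_mul_of_nonneg_left (min_le_left _ _) hpos2.le)))
  set xx : ℝ → Fin n → ℝ := fun t => xh t + (ε • h t + ε ^ 2 • ext ht.le ξ t) with hxx
  set un : ℝ → Fin r → ℝ := uu m (ε ^ 2) α (fun s => uh s + ε • v s) Es us with hun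
  have hdyn : (fun s => F s (xx s, un s)) = fun s => F s (xh s, uh s) +
      ε • fderiv ℝ (F s) (xh s, uh s) (h s, v s) +
      ε ^ 2 • NN m (ε ^ 2) (Th F (fun s => (xh s, uh s)) (fun s => (h s, v s)) ε)
        (Om F (fun s => (xh s, uh s)) (fun s => (h s, v s)) ε Es us) α (ext ht.le ξ) s :=
    funext fun s => uu_dyn F xh h uh v (ext ht.le ξ) Es us hε heα (fun i => (hα i).2) s
  have hl : t₀ ∈ Icc t₀ t₁ := left_mem_Icc.2 ht.le
  have hr : t₁ ∈ Icc t₀ t₁ := right_mem_Icc.2 ht.le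
  have hends : (xx t₀, xx t₁) = E0 + (ε • η0 + ε ^ 2 • ends ht.le ξ) := by
    rw [ends_apply]
    simp only [hxx, hE0, hη0, ext_of_mem ht.le ξ hl, ext_of_mem ht.le ξ hr]
    rfl
  have hEn : ‖ends ht.le ξ‖ ≤ ρ := (ends_norm ht.le ξ).trans hξ
  refine ⟨xx, un, ?_, ?_, ?_, ?_, ?_, ?_, ?_, ?_, ?_⟩
  · have := ext_cont ht.le ξ
    fun_prop
  · exact uu_meas hm _ _ (hu.add (hv.const_smul ε)) hEs us
  · obtain ⟨Cu, hCu⟩ := hKc.isBounded.exists_norm_le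
    refine ⟨Cu + Cq + ∑ i, ‖us i‖, fun t => ?_⟩
    have hsum : 0 ≤ ∑ i, ‖us i‖ := Finset.sum_nonneg fun i _ => norm_nonneg _
    have hCu0 : 0 ≤ Cu := (norm_nonneg _).trans (hCu _ (huK t₀))
    rcases uu_cases (n := n) (m := m) (α := α) (fun s => uh s + ε • v s) Es us hpos2 heα (fun i => (hα i).2) t with
      ⟨c1, -⟩ | ⟨i, c1, -⟩
    · rw [hun, c1]
      refine (norm_add_le _ _).trans ?_
      have c2 := hCu _ (huK t)
      have c3 : ‖ε • v t‖ ≤ Cq := by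
        rw [norm_smul, Real.norm_eq_abs, abs_of_pos hε]
        have := hvb t
        nlinarith [norm_nonneg (v t)]
      linarith
    · rw [hun, c1]
      have := Finset.single_le_sum (f := fun i => ‖us i‖) (fun i _ => norm_nonneg _) (Finset.mem_univ i)
      linarith
  · intro t
    rcases uu_cases (n := n) (m := m) (α := α) (fun s => uh s + ε • v s) Es us hpos2 heα (fun i => (hα i).2) t with
      ⟨c1, -⟩ | ⟨i, c1, -⟩
    · rw [hun, c1]; exact hUv t
    · rw [hun, c1]; exact hus i
  · rw [hdyn]
    exact (i0.add (i1.smul ε)).add (hNNi.smul (ε ^ 2))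
  · intro t htt
    rw [hdyn, int3 ε (ε ^ 2) (ii_sub i0 htt) (ii_sub i1 htt) (ii_sub hNNi htt)]
    have c1 : ξ ⟨t, htt⟩ = a₀ + ∫ s in t₀..t, NN m (ε ^ 2) (Th F (fun s => (xh s, uh s)) (fun s => (h s, v s)) ε)
        (Om F (fun s => (xh s, uh s)) (fun s => (h s, v s)) ε Es us) α (ext ht.le ξ) s := hξeq ⟨t, htt⟩
    have c2 : ξ ⟨t₀, hl⟩ = a₀ := by
      have := hξeq ⟨t₀, hl⟩
      simpa using this
    simp only [hxx, ext_of_mem ht.le ξ hl, ext_of_mem ht.le ξ htt]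
    rw [c1, c2, hode t htt, hlin t htt]
    simp only [smul_add]
    abel
  · intro j
    rw [hends]
    have c1 := (abs_le.1 ((norm_le_pi_norm y₁ j).trans hy1n)).1
    have c2 := H2 ε hε hε2 _ hEn
    by_cases hj : f E0 j = 0
    · have c3 := (abs_le.1 ((norm_le_pi_norm _ j).trans c2.2.1)).2
      simp only [Pi.sub_apply, Pi.smul_apply, smul_eq_mul] at c3
      have c4 := hact j hj
      simp only [Pi.add_apply, Pi.smul_apply, smul_eq_mul] at c4
      have c5 := hqf j
      have c6 := mul_le_mul_of_nonneg_left c4 hpos2.le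
      have c7 := mul_nonpos_of_nonneg_of_nonpos hε.le c5
      have c8 : ε ^ 2 * min (δ/4) γ ≤ ε ^ 2 * (δ/4) := mul_le_mul_of_nonneg_left (min_le_left _ _) hpos2.le
      have c9 : ε ^ 2 * min σ (min (δ/4) γ) ≤ ε ^ 2 * (δ/4) :=
        mul_le_mul_of_nonneg_left ((min_le_right _ _).trans (min_le_left _ _)) hpos2.le
      linarith
    · have c3 := (abs_le.1 ((norm_le_pi_norm _ j).trans c2.1)).2
      simp only [Pi.sub_apply] at c3
      have c4 := hγ2 j hj
      have c5 : min (δ/4) γ ≤ γ := min_le_right _ _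
      have c9 : ε ^ 2 * min σ (min (δ/4) γ) ≤ 1 * γ :=
        mul_le_mul hεsq ((min_le_right _ _).trans (min_le_right _ _)) (by positivity) zero_le_one
      linarith
  · rw [hends]
    exact smul_right_injective _ (inv_ne_zero hne2) hG
  · intro t htt
    simp only [hxx, add_sub_cancel_left]
    refine (norm_add_le _ _).trans ?_
    rw [norm_smul, norm_smul, Real.norm_eq_abs, Real.norm_eq_abs, abs_of_pos hε, abs_of_pos hpos2]
    have c1 := hhb t htt
    have c2 := (norm_ext_le ht.le ξ t).trans hξ
    have c3 : ε ^ 2 ≤ ε := by nlinarith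
    calc ε * ‖h t‖ + ε ^ 2 * ‖ext ht.le ξ t‖ ≤ ε * Cq + ε * ρ := by gcongr
      _ = _ := by ring

end core
end ODEC

end Part13

section Part14

open Set Topology Filter MeasureTheory
set_option linter.unusedSectionVars false
set_option linter.unusedVariables false

namespace ODEC

lemma int_ae_congr {E : Type*} [NormedAddCommGroup E] [NormedSpace ℝ E] {t₀ t₁ : ℝ} {a b : ℝ → E}
    (hae : ∀ᵐ s ∂(volume.restrict (Icc t₀ t₁)), a s = b s) {t : ℝ} (ht : t ∈ Icc t₀ t₁) :
    ∫ s in t₀..t, a s = ∫ s in t₀..t, b s := by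
  rw [ae_restrict_iff' measurableSet_Icc] at hae
  refine intervalIntegral.integral_congr_ae (hae.mono fun s hs hst => hs ?_)
  rw [uIoc_of_le ht.1] at hst
  exact ⟨hst.1.le, hst.2.trans ht.2⟩

lemma ii_ae_congr {E : Type*} [NormedAddCommGroup E] [NormedSpace ℝ E] {t₀ t₁ : ℝ} (ht : t₀ ≤ t₁) {a b : ℝ → E}
    (hae : ∀ᵐ s ∂(volume.restrict (Icc t₀ t₁)), a s = b s) (ha : IntervalIntegrable a volume t₀ t₁) :
    IntervalIntegrable b volume t₀ t₁ := by
  rw [intervalIntegrable_iff_integrableOn_Icc_of_le ht] at ha ⊢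
  exact Integrable.congr ha hae

lemma exists_of_ae {t₀ t₁ : ℝ} (ht : t₀ < t₁) {P : ℝ → Prop}
    (h : ∀ᵐ s ∂(volume.restrict (Icc t₀ t₁)), P s) : ∃ s, P s := by
  have : (volume.restrict (Icc t₀ t₁)) ≠ 0 := by
    rw [Ne, Measure.restrict_eq_zero, Real.volume_Icc]
    simpa using ht
  haveI : NeBot (ae (volume.restrict (Icc t₀ t₁))) := ae_neBot.2 this
  exact h.exists

end ODEC

end Part14

open Set Topology Filter Matrix MeasureTheory intervalIntegral

/-- **Theorem 2 (local controllability of the control dynamical system).**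
Let `(xh,uh)` be an admissible process for the system
`ẋ = φ(t,x,u)`, `u(t) ∈ U` a.e. on `[t₀,t₁]`, `f(x(t₀),x(t₁)) ≤ 0`, `g(x(t₀),x(t₁)) = 0`.
Assume there exists `q = (h,v) ∈ K(xh,uh)` with `Λ(xh,uh,q) = ∅`.  Then the system is
locally controllable with respect to `(xh,uh)`, and moreover there is `c₀ > 0` such that the
trajectories can be chosen with `‖x_y − xh‖_C ≤ c₀ |y|^{1/2}`. -/
theorem ode_system_locally_controllable
    {n r m₁ m₂ : ℕ} (t₀ t₁ : ℝ) (ht : t₀ < t₁)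
    (U : Set (Fin r → ℝ)) (hU : IsOpen U)
    (φ : ℝ × (Fin n → ℝ) × (Fin r → ℝ) → Fin n → ℝ)
    (f : (Fin n → ℝ) × (Fin n → ℝ) → Fin m₁ → ℝ)
    (g : (Fin n → ℝ) × (Fin n → ℝ) → Fin m₂ → ℝ)
    -- smoothness of the data: φ is continuous together with its first and second
    -- derivatives with respect to w = (x,u) on ℝ × ℝⁿ × U; f, g are C²
    (hφc : ContinuousOn φ {p : ℝ × (Fin n → ℝ) × (Fin r → ℝ) | p.2.2 ∈ U})
    (hφ2 : ∀ t : ℝ, ContDiffOn ℝ 2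
      (fun w : (Fin n → ℝ) × (Fin r → ℝ) => φ (t, w.1, w.2)) (univ ×ˢ U))
    (hφ'c : ContinuousOn (fun p : ℝ × (Fin n → ℝ) × (Fin r → ℝ) =>
        fderiv ℝ (fun w : (Fin n → ℝ) × (Fin r → ℝ) => φ (p.1, w.1, w.2)) (p.2.1, p.2.2))
      {p : ℝ × (Fin n → ℝ) × (Fin r → ℝ) | p.2.2 ∈ U})
    (hφ''c : ContinuousOn (fun p : ℝ × (Fin n → ℝ) × (Fin r → ℝ) =>
        fderiv ℝ (fderiv ℝ (fun w : (Fin n → ℝ) × (Fin r → ℝ) => φ (p.1, w.1, w.2)))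
          (p.2.1, p.2.2))
      {p : ℝ × (Fin n → ℝ) × (Fin r → ℝ) | p.2.2 ∈ U})
    (hf : ContDiff ℝ 2 f) (hg : ContDiff ℝ 2 g)
    -- (xh, uh) is an admissible process (with a regular control uh)
    (xh : ℝ → Fin n → ℝ) (uh : ℝ → Fin r → ℝ)
    (hxc : ContinuousOn xh (Icc t₀ t₁))
    (humeas : Measurable uh)
    (hreg : ∃ Kc : Set (Fin r → ℝ), IsCompact Kc ∧ Kc ⊆ U ∧
      ∀ᵐ t ∂(volume.restrict (Icc t₀ t₁)), uh t ∈ Kc)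
    (hodeint : IntervalIntegrable (fun s => φ (s, xh s, uh s)) volume t₀ t₁)
    (hode : ∀ t ∈ Icc t₀ t₁, xh t = xh t₀ + ∫ s in t₀..t, φ (s, xh s, uh s))
    (hbf : ∀ i, f (xh t₀, xh t₁) i ≤ 0)
    (hbg : g (xh t₀, xh t₁) = 0)
    -- q = (h, v) ∈ K(xh, uh)
    (h : ℝ → Fin n → ℝ) (v : ℝ → Fin r → ℝ)
    (hhc : ContinuousOn h (Icc t₀ t₁))
    (hvmeas : Measurable v)
    (hvbd : ∃ C : ℝ, ∀ᵐ t ∂(volume.restrict (Icc t₀ t₁)), ‖v t‖ ≤ C)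
    (hlinint : IntervalIntegrable (fun s =>
        fderiv ℝ (fun w : (Fin n → ℝ) × (Fin r → ℝ) => φ (s, w.1, w.2)) (xh s, uh s)
          (h s, v s)) volume t₀ t₁)
    (hlin : ∀ t ∈ Icc t₀ t₁, h t = h t₀ + ∫ s in t₀..t,
        fderiv ℝ (fun w : (Fin n → ℝ) × (Fin r → ℝ) => φ (s, w.1, w.2)) (xh s, uh s)
          (h s, v s))
    (hqf : ∀ i, fderiv ℝ f (xh t₀, xh t₁) (h t₀, h t₁) i ≤ 0)
    (hqg : fderiv ℝ g (xh t₀, xh t₁) (h t₀, h t₁) = 0)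
    -- Λ(xh, uh, q) = ∅
    (hΛ : ¬ ∃ (p : ℝ → Fin n → ℝ) (l₁ : Fin m₁ → ℝ) (l₂ : Fin m₂ → ℝ),
      (∀ i, 0 ≤ l₁ i) ∧ (l₁ ≠ 0 ∨ l₂ ≠ 0) ∧
      ContinuousOn p (Icc t₀ t₁) ∧
      IntervalIntegrable (fun s => (fun i => p s ⬝ᵥ
          fderiv ℝ (fun w : (Fin n → ℝ) × (Fin r → ℝ) => φ (s, w.1, w.2)) (xh s, uh s)
            (Pi.single i 1, 0))) volume t₀ t₁ ∧
      (∀ t ∈ Icc t₀ t₁, p t = p t₀ - ∫ s in t₀..t, (fun i => p s ⬝ᵥ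
          fderiv ℝ (fun w : (Fin n → ℝ) × (Fin r → ℝ) => φ (s, w.1, w.2)) (xh s, uh s)
            (Pi.single i 1, 0))) ∧
      p t₀ = (fun i => l₁ ⬝ᵥ fderiv ℝ f (xh t₀, xh t₁) (Pi.single i 1, 0)
                     + l₂ ⬝ᵥ fderiv ℝ g (xh t₀, xh t₁) (Pi.single i 1, 0)) ∧
      p t₁ = (fun i => -(l₁ ⬝ᵥ fderiv ℝ f (xh t₀, xh t₁) (0, Pi.single i 1))
                     - l₂ ⬝ᵥ fderiv ℝ g (xh t₀, xh t₁) (0, Pi.single i 1)) ∧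
      (∀ᵐ t ∂(volume.restrict (Icc t₀ t₁)), ∀ u ∈ U,
        p t ⬝ᵥ φ (t, xh t, u) ≤ p t ⬝ᵥ φ (t, xh t, uh t)) ∧
      l₁ ⬝ᵥ f (xh t₀, xh t₁) = 0 ∧
      0 ≤ -(∫ t in t₀..t₁, p t ⬝ᵥ
              (fderiv ℝ (fderiv ℝ (fun w : (Fin n → ℝ) × (Fin r → ℝ) => φ (t, w.1, w.2)))
                (xh t, uh t) (h t, v t) (h t, v t)))
          + l₁ ⬝ᵥ fderiv ℝ (fderiv ℝ f) (xh t₀, xh t₁) (h t₀, h t₁) (h t₀, h t₁)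
          + l₂ ⬝ᵥ fderiv ℝ (fderiv ℝ g) (xh t₀, xh t₁) (h t₀, h t₁) (h t₀, h t₁)) :
    -- conclusion: local controllability with a square-root estimate
    ∃ c₀ > (0:ℝ), ∀ δ > (0:ℝ), ∃ δ₁ > (0:ℝ), ∃ δ₂ > (0:ℝ),
      ∀ y₁ : Fin m₁ → ℝ, ‖y₁‖ < δ₁ → ∀ y₂ : Fin m₂ → ℝ, ‖y₂‖ < δ₂ →
        ∃ (x : ℝ → Fin n → ℝ) (u : ℝ → Fin r → ℝ),
          ContinuousOn x (Icc t₀ t₁) ∧ Measurable u ∧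
          (∃ C : ℝ, ∀ᵐ t ∂(volume.restrict (Icc t₀ t₁)), ‖u t‖ ≤ C) ∧
          (∀ᵐ t ∂(volume.restrict (Icc t₀ t₁)), u t ∈ U) ∧
          IntervalIntegrable (fun s => φ (s, x s, u s)) volume t₀ t₁ ∧
          (∀ t ∈ Icc t₀ t₁, x t = x t₀ + ∫ s in t₀..t, φ (s, x s, u s)) ∧
          (∀ i, f (x t₀, x t₁) i ≤ y₁ i) ∧ g (x t₀, x t₁) = y₂ ∧
          (∀ t ∈ Icc t₀ t₁, ‖x t - xh t‖ < δ) ∧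
          (∀ t ∈ Icc t₀ t₁, ‖x t - xh t‖
            ≤ c₀ * Real.sqrt ‖((y₁, y₂) : (Fin m₁ → ℝ) × (Fin m₂ → ℝ))‖) := by
  obtain ⟨Kc, hKc, hKU, hKae⟩ := hreg
  obtain ⟨Cv, hCv⟩ := hvbd
  obtain ⟨sK, hsK⟩ := ODEC.exists_of_ae ht hKae
  obtain ⟨Ch, hCh⟩ := isCompact_Icc.exists_bound_of_continuousOn hhc
  have hl : t₀ ∈ Icc t₀ t₁ := left_mem_Icc.2 ht.le
  have hr : t₁ ∈ Icc t₀ t₁ := right_mem_Icc.2 ht.le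
  have hCq : 0 ≤ max Ch (max Cv 0) := (le_max_right _ _).trans (le_max_right _ _)
  have hproj : Continuous fun s : ℝ => ((projIcc t₀ t₁ ht.le s : Icc t₀ t₁) : ℝ) :=
    continuous_subtype_val.comp continuous_projIcc
  have hpid : ∀ s ∈ Icc t₀ t₁, ((projIcc t₀ t₁ ht.le s : Icc t₀ t₁) : ℝ) = s := fun s hs => by
    rw [projIcc_of_mem ht.le hs]
  -- regularised data
  obtain ⟨x', hx'c, hx'⟩ : ∃ x' : ℝ → Fin n → ℝ, Continuous x' ∧ ∀ s ∈ Icc t₀ t₁, x' s = xh s :=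
    ⟨fun s => xh (projIcc t₀ t₁ ht.le s), hxc.comp_continuous hproj fun s => Subtype.coe_prop _,
      fun s hs => by simp only [hpid s hs]⟩
  obtain ⟨h', hh'c, hh'⟩ : ∃ h' : ℝ → Fin n → ℝ, Continuous h' ∧ ∀ s ∈ Icc t₀ t₁, h' s = h s :=
    ⟨fun s => h (projIcc t₀ t₁ ht.le s), hhc.comp_continuous hproj fun s => Subtype.coe_prop _,
      fun s hs => by simp only [hpid s hs]⟩
  obtain ⟨u', hu'm, hu'K, hu'⟩ : ∃ u' : ℝ → Fin r → ℝ, Measurable u' ∧ (∀ s, u' s ∈ Kc) ∧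
      ∀ᵐ s ∂(volume.restrict (Icc t₀ t₁)), u' s = uh s := by
    classical
    refine ⟨fun s => if uh s ∈ Kc then uh s else uh sK,
      Measurable.ite (humeas hKc.measurableSet) humeas measurable_const, fun s => ?_, ?_⟩
    · by_cases hs : uh s ∈ Kc
      · simp only [if_pos hs]; exact hs
      · simp only [if_neg hs]; exact hsK
    · exact hKae.mono fun s hs => by simp only [if_pos hs]
  obtain ⟨v', hv'm, hv'b, hv'⟩ : ∃ v' : ℝ → Fin r → ℝ, Measurable v' ∧ (∀ s, ‖v' s‖ ≤ max Ch (max Cv 0)) ∧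
      ∀ᵐ s ∂(volume.restrict (Icc t₀ t₁)), v' s = v s := by
    classical
    refine ⟨fun s => if ‖v s‖ ≤ Cv then v s else 0,
      Measurable.ite (measurableSet_le hvmeas.norm measurable_const) hvmeas measurable_const, fun s => ?_, ?_⟩
    · by_cases hs : ‖v s‖ ≤ Cv
      · simp only [if_pos hs]; exact hs.trans ((le_max_left _ _).trans (le_max_right _ _))
      · simp only [if_neg hs, norm_zero]; exact hCq
    · exact hCv.mono fun s hs => by simp only [if_pos hs]
  have hae : ∀ᵐ s ∂(volume.restrict (Icc t₀ t₁)), x' s = xh s ∧ h' s = h s ∧ u' s = uh s ∧ v' s = v s := by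
    filter_upwards [hu', hv', ae_restrict_mem measurableSet_Icc] with s a b c
    exact ⟨hx' s c, hh' s c, a, b⟩
  set F : ℝ → (Fin n → ℝ) × (Fin r → ℝ) → Fin n → ℝ := fun s w => φ (s, w.1, w.2) with hF
  have hCD : ∀ p : ℝ × (Fin n → ℝ) × (Fin r → ℝ), p.2.2 ∈ U → ContDiffAt ℝ 2 (F p.1) p.2 := fun p hp =>
    (hφ2 p.1).contDiffAt ((isOpen_univ.prod hU).mem_nhds ⟨mem_univ _, hp⟩)
  obtain ⟨σ, hσ, ρ, hρ, ε₀, hε₀, hε₀1, H⟩ := ODEC.core1 ht U hU F hφc hφ'c hφ''c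
    (fun p hp => (hCD p hp).differentiableAt (by norm_num))
    (fun p hp => ((hCD p hp).fderiv_right (m := 1) (by norm_num)).differentiableAt (by norm_num))
    f g hf hg Kc hKc hKU x' h' u' v' hx'c hh'c hu'm hv'm hu'K hCq hv'b
    (fun s hs => by rw [hh' s hs]; exact (hCh s hs).trans (le_max_left _ _))
    (fun t htt => by
      rw [hx' t htt, hx' t₀ hl, hode t htt]
      congr 1
      exact ODEC.int_ae_congr (hae.mono fun s hs => by rw [hs.1, hs.2.2.1]) htt)
    (by rw [hx' t₀ hl, hx' t₁ hr]; exact hbf)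
    (by rw [hx' t₀ hl, hx' t₁ hr]; exact hbg)
    (fun t htt => by
      rw [hh' t htt, hh' t₀ hl, hlin t htt]
      congr 1
      exact ODEC.int_ae_congr (hae.mono fun s hs => by rw [hs.1, hs.2.1, hs.2.2.1, hs.2.2.2]) htt)
    (by rw [hx' t₀ hl, hx' t₁ hr, hh' t₀ hl, hh' t₁ hr]; exact hqf)
    (by rw [hx' t₀ hl, hx' t₁ hr, hh' t₀ hl, hh' t₁ hr]; exact hqg)
    (by
      rw [hx' t₀ hl, hx' t₁ hr, hh' t₀ hl, hh' t₁ hr]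
      rintro ⟨p, l₁, l₂, q1, q2, q3, q4, q5, q6, q7, q8, q9, q10⟩
      have ha1 : ∀ᵐ s ∂(volume.restrict (Icc t₀ t₁)),
          (fun i : Fin n => p s ⬝ᵥ fderiv ℝ (F s) (x' s, u' s) (Pi.single i 1, 0)) =
          (fun i : Fin n => p s ⬝ᵥ fderiv ℝ (F s) (xh s, uh s) (Pi.single i 1, 0)) :=
        hae.mono fun s hs => by rw [hs.1, hs.2.2.1]
      have ha2 : ∀ᵐ s ∂(volume.restrict (Icc t₀ t₁)),
          p s ⬝ᵥ (fderiv ℝ (fderiv ℝ (F s)) (x' s, u' s) (h' s, v' s) (h' s, v' s)) =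
          p s ⬝ᵥ (fderiv ℝ (fderiv ℝ (F s)) (xh s, uh s) (h s, v s) (h s, v s)) :=
        hae.mono fun s hs => by rw [hs.1, hs.2.1, hs.2.2.1, hs.2.2.2]
      refine hΛ ⟨p, l₁, l₂, q1, q2, q3.continuousOn, ODEC.ii_ae_congr ht.le ha1 q4, fun t htt => ?_, q6, q7, ?_, q9, ?_⟩
      · rw [q5 t htt]
        congr 1
        exact ODEC.int_ae_congr ha1 htt
      · filter_upwards [q8, hae] with s hs hs2 u hu
        have := hs u hu
        rw [hs2.1, hs2.2.2.1] at this
        exact this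
      · rw [ODEC.int_ae_congr ha2 hr] at q10
        exact q10)
  set Cq := max Ch (max Cv 0) with hCqdef
  have hCρ : 0 < Cq + ρ := by linarith
  have hsσ : 0 < Real.sqrt σ := Real.sqrt_pos.2 hσ
  refine ⟨(Cq + ρ) / Real.sqrt σ, by positivity, fun δ hδ => ?_⟩
  have hτ : 0 < min ε₀ (δ / (Cq + ρ)) := lt_min hε₀ (by positivity)
  refine ⟨σ * min ε₀ (δ / (Cq + ρ)) ^ 2, by positivity, σ * min ε₀ (δ / (Cq + ρ)) ^ 2, by positivity, ?_⟩
  intro y₁ hy₁ y₂ hy₂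
  by_cases hy : (y₁, y₂) = 0
  · obtain ⟨rfl, rfl⟩ := Prod.mk_eq_zero.1 hy
    obtain ⟨Cu, hCu⟩ := hKc.isBounded.exists_norm_le
    refine ⟨xh, uh, hxc, humeas, ⟨Cu, hKae.mono fun s hs => hCu _ hs⟩, hKae.mono fun s hs => hKU hs, hodeint, hode,
      hbf, hbg, fun t _ => by simpa using hδ, fun t _ => ?_⟩
    rw [sub_self, norm_zero]
    positivity
  · set N := ‖((y₁, y₂) : (Fin m₁ → ℝ) × (Fin m₂ → ℝ))‖ with hN
    have hN0 : 0 < N := norm_pos_iff.2 hy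
    have hNlt : N < σ * min ε₀ (δ / (Cq + ρ)) ^ 2 := by
      rw [hN, Prod.norm_def]; exact max_lt hy₁ hy₂
    have hεpos : 0 < Real.sqrt (N / σ) := Real.sqrt_pos.2 (by positivity)
    have hεlt : Real.sqrt (N / σ) < min ε₀ (δ / (Cq + ρ)) := by
      rw [Real.sqrt_lt' hτ, div_lt_iff₀ hσ, mul_comm]
      exact hNlt
    obtain ⟨x, u, k1, k2, ⟨C, k3⟩, k4, k5, k6, k7, k8, k9⟩ := H _ hεpos (hεlt.trans_le (min_le_left _ _)) y₁ y₂ hy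
      (by rw [Real.sq_sqrt (by positivity), div_mul_cancel₀ _ hσ.ne'])
    have k10 : ∀ t ∈ Icc t₀ t₁, ‖x t - xh t‖ ≤ Real.sqrt (N / σ) * (Cq + ρ) := fun t htt => by
      rw [← hx' t htt]; exact k9 t htt
    refine ⟨x, u, k1.continuousOn, k2, ⟨C, Eventually.of_forall k3⟩, Eventually.of_forall k4, k5, k6, k7, k8,
      fun t htt => (k10 t htt).trans_lt ?_, fun t htt => (k10 t htt).trans_eq ?_⟩
    · have := hεlt.trans_le (min_le_right _ _)
      rwa [lt_div_iff₀ hCρ] at this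
    · rw [Real.sqrt_div hN0.le]
      ring
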